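/- For r ∈ {5,6}, let 𝕋_r denote the r-uniform generalized triangle. There exist constants N_0 and c_r > 0 such that for all integers n ≥ N_0 and all integers t with 0 ≤ t ≤ c_r·n, one has EX(n,(t+1)𝕋_r) = { K_t^r ⋈ 𝕎_r(n−t) }. -/

import Mathlib

open Filter

namespace DensityCH

/-- An `r`-uniform hypergraph with vertices in `ℕ`:
a finite vertex set together with a set of `r`-element edges. -/
structure HGraph (r : ℕ) where
  verts : Finset ℕ
  edges : Finset (Finset ℕ)
  edges_sub : ∀ e ∈ edges, e ⊆ verts
  edges_card : ∀ e ∈ edges, e.card = r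

namespace HGraph

/-- Build an `r`-graph from a vertex set and a set of candidate edges,
keeping exactly the well-formed candidates. -/
def ofEdges (r : ℕ) (V : Finset ℕ) (E : Finset (Finset ℕ)) : HGraph r where
  verts := V
  edges := E.filter fun e => e ⊆ V ∧ e.card = r
  edges_sub := fun e he => ((Finset.mem_filter.mp he).2).1
  edges_card := fun e he => ((Finset.mem_filter.mp he).2).2

variable {r : ℕ}

/-- `H` contains a copy of `F`, i.e. a subgraph isomorphic to `F`. -/
def IsCopyIn (F H : HGraph r) : Prop :=
  ∃ f : ℕ → ℕ, Set.InjOn f ↑F.verts ∧ (∀ v ∈ F.verts, f v ∈ H.verts) ∧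
    ∀ e ∈ F.edges, e.image f ∈ H.edges

/-- The subgraph of `H` induced on `S`. -/
def induce (H : HGraph r) (S : Finset ℕ) : HGraph r :=
  ofEdges r (H.verts ∩ S) (H.edges.filter fun e => e ⊆ S)

/-- Delete a vertex from `H`. -/
def deleteVert (H : HGraph r) (v : ℕ) : HGraph r :=
  ofEdges r (H.verts.erase v) (H.edges.filter fun e => v ∉ e)

/-- The degree of a vertex. -/
def deg (H : HGraph r) (v : ℕ) : ℕ := (H.edges.filter fun e => v ∈ e).card

/-- The maximum degree `Δ(H)`. -/
def maxDeg (H : HGraph r) : ℕ := H.verts.sup H.deg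

/-- The minimum degree `δ(H)`. -/
def minDeg (H : HGraph r) : ℕ :=
  if h : H.verts.Nonempty then H.verts.inf' h H.deg else 0

/-- The average degree `d(H) = r·|E(H)|/|V(H)|`. -/
noncomputable def avgDeg (H : HGraph r) : ℝ :=
  (r : ℝ) * (H.edges.card : ℝ) / (H.verts.card : ℝ)

/-- `H` contains `k` pairwise vertex-disjoint copies of `F`, i.e. `ν(F,H) ≥ k`. -/
def HasMatching (F H : HGraph r) (k : ℕ) : Prop :=
  ∃ S : Fin k → Finset ℕ,
    (∀ i, S i ⊆ H.verts ∧ (S i).card = F.verts.card) ∧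
    (∀ i j, i ≠ j → Disjoint (S i) (S j)) ∧
    ∀ i, F.IsCopyIn (H.induce (S i))

/-- Isomorphism of hypergraphs. -/
def Iso (G H : HGraph r) : Prop :=
  ∃ f : ℕ → ℕ, Set.BijOn f ↑G.verts ↑H.verts ∧
    ∀ e ∈ Finset.powersetCard r G.verts, (e ∈ G.edges ↔ e.image f ∈ H.edges)

/-- The join `G ⋈ H`: all edges of `G`, all edges of `H`, and all `r`-sets meeting
both vertex sets. -/
def join (G H : HGraph r) : HGraph r :=
  ofEdges r (G.verts ∪ H.verts)
    (G.edges ∪ H.edges ∪ ((Finset.powersetCard r (G.verts ∪ H.verts)).filter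
      fun e => (e ∩ G.verts).Nonempty ∧ (e ∩ H.verts).Nonempty))

end HGraph

/-- The complete `r`-graph on a vertex set `S`. -/
def completeOn (r : ℕ) (S : Finset ℕ) : HGraph r :=
  HGraph.ofEdges r S (Finset.powersetCard r S)

/-- The `r`-graph on `V` with no edges. -/
def emptyOn (r : ℕ) (V : Finset ℕ) : HGraph r := HGraph.ofEdges r V ∅

/-- The Turán number `ex(n,F)`. -/
noncomputable def exN (r n : ℕ) (F : HGraph r) : ℕ :=
  sSup {m | ∃ H : HGraph r, H.verts.card = n ∧ ¬ F.IsCopyIn H ∧ H.edges.card = m}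

/-- `d(n,F) = r·ex(n,F)/n`. -/
noncomputable def dN (r n : ℕ) (F : HGraph r) : ℝ := (r : ℝ) * (exN r n F : ℝ) / (n : ℝ)

/-- `δ(n,F) = ex(n,F) − ex(n−1,F)` (as a real number). -/
noncomputable def deltaN (r n : ℕ) (F : HGraph r) : ℝ := (exN r n F : ℝ) - (exN r (n-1) F : ℝ)

/-- `x` is the Turán density `π(F)`, i.e. the limit of `ex(n,F)/C(n,r)`. -/
def HasTuranDensity (r : ℕ) (F : HGraph r) (x : ℝ) : Prop :=
  Tendsto (fun n : ℕ => (exN r n F : ℝ) / (n.choose r : ℝ)) atTop (nhds x)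

/-- `ex(n,(t+1)F)`: the maximum number of edges of an `n`-vertex `r`-graph with no
`t+1` pairwise vertex-disjoint copies of `F`. -/
noncomputable def exMatchN (r n t : ℕ) (F : HGraph r) : ℕ :=
  sSup {m | ∃ H : HGraph r, H.verts.card = n ∧ ¬ F.HasMatching H (t+1) ∧ H.edges.card = m}

/-- `H ∈ EX(n,F)`. -/
def IsExtremalFree (r n : ℕ) (F H : HGraph r) : Prop :=
  H.verts.card = n ∧ ¬ F.IsCopyIn H ∧ H.edges.card = exN r n F

/-- `H ∈ EX(n,(t+1)F)`. -/
def IsExtremalMatchingFree (r n t : ℕ) (F H : HGraph r) : Prop :=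
  H.verts.card = n ∧ ¬ F.HasMatching H (t+1) ∧ H.edges.card = exMatchN r n t F

/-- `F` is `(f1, f2)`-bounded at `n`. -/
def BoundedAt (r n : ℕ) (F : HGraph r) (f1 f2 : ℝ) : Prop :=
  ∀ H : HGraph r, H.verts.card = n → ¬ F.IsCopyIn H →
    dN r n F - f1 ≤ H.avgDeg → (H.maxDeg : ℝ) ≤ dN r n F + f2

/-- `ex(·,F)` is `g`-smooth at `n`: `|δ(n,F) − d(n−1,F)| ≤ g(n)`. -/
def SmoothAt (r n : ℕ) (F : HGraph r) (g : ℝ) : Prop :=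
  |deltaN r n F - dN r (n-1) F| ≤ g

/-- The collection `H 0, …, H t` (on a common vertex set) has a rainbow `F`-matching. -/
def HasRainbowMatching (r t : ℕ) (F : HGraph r) (H : Fin (t+1) → HGraph r) : Prop :=
  ∃ S : Fin (t+1) → Finset ℕ,
    (∀ i, S i ⊆ (H i).verts ∧ (S i).card = F.verts.card) ∧
    (∀ i j, i ≠ j → Disjoint (S i) (S j)) ∧
    ∀ i, F.IsCopyIn ((H i).induce (S i))

/-!  Patterns -/

/-- An `r`-uniform pattern: a finite index set together with a collection of
`r`-multisets on it. -/
structure Pattern (r : ℕ) where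
  idx : Finset ℕ
  mE : Finset (Multiset ℕ)
  card_eq : ∀ s ∈ mE, Multiset.card s = r
  mem_idx : ∀ s ∈ mE, ∀ i ∈ s, i ∈ idx

namespace Pattern

variable {r : ℕ}

/-- The pattern `P − i`. -/
def erase (P : Pattern r) (i : ℕ) : Pattern r where
  idx := P.idx.erase i
  mE := P.mE.filter fun s => i ∉ s
  card_eq := fun s hs => P.card_eq s (Finset.mem_filter.mp hs).1
  mem_idx := by
    intro s hs j hj
    have h1 := Finset.mem_filter.mp hs
    refine Finset.mem_erase.mpr ⟨?_, P.mem_idx s h1.1 j hj⟩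
    rintro rfl
    exact h1.2 hj

/-- `H` is a `P`-construction: a blowup of the pattern `P`. -/
def IsConstruction (P : Pattern r) (H : HGraph r) : Prop :=
  ∃ part : ℕ → ℕ, (∀ v ∈ H.verts, part v ∈ P.idx) ∧
    ∀ e : Finset ℕ, e ∈ H.edges ↔ (e ⊆ H.verts ∧ e.card = r ∧ Multiset.map part e.val ∈ P.mE)

/-- `H` is a `P`-subconstruction: a subgraph of a `P`-construction. -/
def IsSubconstruction (P : Pattern r) (H : HGraph r) : Prop :=
  ∃ G : HGraph r, P.IsConstruction G ∧ H.verts ⊆ G.verts ∧ H.edges ⊆ G.edges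

end Pattern

/-- `Λ(P,n)`: the maximum number of edges of an `n`-vertex `P`-construction. -/
noncomputable def patEx (r : ℕ) (P : Pattern r) (n : ℕ) : ℕ :=
  sSup {m | ∃ H : HGraph r, P.IsConstruction H ∧ H.verts.card = n ∧ H.edges.card = m}

/-- The Lagrangian `λ(P) = lim Λ(P,n)/C(n,r)`. -/
noncomputable def patLagrangian (r : ℕ) (P : Pattern r) : ℝ :=
  limUnder atTop fun n : ℕ => (patEx r P n : ℝ) / (n.choose r : ℝ)

/-- The pattern `P` is minimal: `λ(P−i) < λ(P)` for all `i`. -/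
def Pattern.Minimal {r : ℕ} (P : Pattern r) : Prop :=
  ∀ i ∈ P.idx, patLagrangian r (P.erase i) < patLagrangian r P

/-- `(F,P)` is a Turán pair. -/
def IsTuranPair (r : ℕ) (F : HGraph r) (P : Pattern r) : Prop :=
  (∀ H : HGraph r, P.IsConstruction H → ¬ F.IsCopyIn H) ∧
  (∀ H : HGraph r, ¬ F.IsCopyIn H → H.edges.card = exN r H.verts.card F →
    P.IsConstruction H)

/-- `F` is edge-stable with respect to `P` (with Turán density `π`). -/
def EdgeStable (r : ℕ) (F : HGraph r) (P : Pattern r) (π : ℝ) : Prop :=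
  ∀ δ : ℝ, 0 < δ → ∃ N₀ : ℕ, ∃ ζ : ℝ, 0 < ζ ∧
    ∀ H : HGraph r, N₀ ≤ H.verts.card → ¬ F.IsCopyIn H →
      (π - ζ) * (H.verts.card.choose r : ℝ) ≤ (H.edges.card : ℝ) →
      ∃ H' : HGraph r, H'.verts ⊆ H.verts ∧ H'.edges ⊆ H.edges ∧
        (π - δ) * (H.verts.card.choose r : ℝ) ≤ (H'.edges.card : ℝ) ∧
        P.IsSubconstruction H'

/-- `F` is weakly vertex-extendable with respect to `P` (with Turán density `π`). -/
def WeaklyVertexExtendable (r : ℕ) (F : HGraph r) (P : Pattern r) (π : ℝ) : Prop :=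
  ∀ δ : ℝ, 0 < δ → ∃ N₀ : ℕ, ∃ ζ : ℝ, 0 < ζ ∧
    ∀ H : HGraph r, N₀ ≤ H.verts.card → ¬ F.IsCopyIn H →
      (π - ζ) * (((H.verts.card - 1).choose (r-1) : ℕ) : ℝ) ≤ (H.minDeg : ℝ) →
      ∀ v ∈ H.verts, P.IsSubconstruction (H.deleteVert v) →
        (H.deg v : ℝ) ≤ (π + δ) * (((H.verts.card - 1).choose (r-1) : ℕ) : ℝ)

/-- `F` is degree-stable with respect to `P` (with Turán density `π`). -/
def DegreeStable (r : ℕ) (F : HGraph r) (P : Pattern r) (π : ℝ) : Prop :=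
  ∃ ζ : ℝ, 0 < ζ ∧ ∃ N₀ : ℕ,
    ∀ H : HGraph r, N₀ ≤ H.verts.card → ¬ F.IsCopyIn H →
      (π - ζ) * (((H.verts.card - 1).choose (r-1) : ℕ) : ℝ) ≤ (H.minDeg : ℝ) →
      P.IsSubconstruction H

/-!  Concrete constructions -/

/-- The generalized Turán graph `T_r(·,ℓ)` on vertex set `V` (parts are residue
classes mod `ℓ`; on an interval these are balanced). -/
def turanOn (r ℓ : ℕ) (V : Finset ℕ) : HGraph r :=
  HGraph.ofEdges r V ((Finset.powersetCard r V).filter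
    fun e => ∀ u ∈ e, ∀ v ∈ e, u % ℓ = v % ℓ → u = v)

/-- The `r`-graph on `V₁ ∪ V₂` whose edges are all `r`-sets meeting both parts. -/
def crossOn (r : ℕ) (V₁ V₂ : Finset ℕ) : HGraph r :=
  HGraph.ofEdges r (V₁ ∪ V₂) ((Finset.powersetCard r (V₁ ∪ V₂)).filter
    fun e => (e ∩ V₁).Nonempty ∧ (e ∩ V₂).Nonempty)

/-- The `r`-graph on `V₁ ∪ V₂` whose edges are all `r`-sets meeting `V₁` in an odd
number of vertices. -/
def oddCross (r : ℕ) (V₁ V₂ : Finset ℕ) : HGraph r :=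
  HGraph.ofEdges r (V₁ ∪ V₂) ((Finset.powersetCard r (V₁ ∪ V₂)).filter
    fun e => Odd (e ∩ V₁).card)

/-- The Fano plane. -/
def fano : HGraph 3 :=
  HGraph.ofEdges 3 (Finset.Icc 1 7)
    {({1,2,3} : Finset ℕ), {3,4,5}, {5,6,1}, {1,7,4}, {2,7,5}, {3,7,6}, {2,4,6}}

/-- The generalized triangle `𝕋_r`, with edges `{1,…,r}`, `{1,…,r−1,r+1}` and
`{r,…,2r−1}`. -/
def genTri (r : ℕ) : HGraph r :=
  HGraph.ofEdges r (Finset.Icc 1 (2*r - 1))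
    {Finset.Icc 1 r, Finset.Icc 1 (r-1) ∪ {r+1}, Finset.Icc r (2*r - 1)}

/-- `G` is a blowup of the `r`-graph `W` (viewing `W` as a pattern). -/
def IsBlowupOf {r : ℕ} (W G : HGraph r) : Prop :=
  ∃ part : ℕ → ℕ, (∀ v ∈ G.verts, part v ∈ W.verts) ∧
    ∀ e : Finset ℕ, e ∈ G.edges ↔
      (e ⊆ G.verts ∧ e.card = r ∧ ∃ f ∈ W.edges, Multiset.map part e.val = f.val)

/-- The expansion `H^F` of an `r`-graph `F`: for every pair of vertices not covered
by an edge of `F`, add an edge consisting of this pair plus `r−2` new vertices,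
these sets of new vertices being pairwise disjoint. -/
def HGraph.expansion {r : ℕ} (F : HGraph r) : HGraph r :=
  HGraph.ofEdges r
    (F.verts ∪ (((F.verts ×ˢ F.verts).filter fun p =>
        p.1 < p.2 ∧ ∀ e ∈ F.edges, ¬ (p.1 ∈ e ∧ p.2 ∈ e)).biUnion fun p =>
      (Finset.range (r-2)).image fun s =>
        (F.verts.sup id + 1) + (p.1 * (F.verts.sup id + 1) + p.2) * r + s))
    (F.edges ∪ (((F.verts ×ˢ F.verts).filter fun p =>
        p.1 < p.2 ∧ ∀ e ∈ F.edges, ¬ (p.1 ∈ e ∧ p.2 ∈ e)).image fun p =>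
      insert p.1 (insert p.2 ((Finset.range (r-2)).image fun s =>
        (F.verts.sup id + 1) + (p.1 * (F.verts.sup id + 1) + p.2) * r + s))))

/-- A `2`-graph is a tree on `k` vertices: `k` vertices, `k−1` edges, connected. -/
def IsTreeGraph (k : ℕ) (T : HGraph 2) : Prop :=
  T.verts.card = k ∧ T.edges.card = k - 1 ∧
  ∀ S : Finset ℕ, S ⊆ T.verts → S.Nonempty → S ≠ T.verts →
    ∃ e ∈ T.edges, (e ∩ S).Nonempty ∧ (e \ S).Nonempty

/-- `T` satisfies the Erdős–Sós property for `k`: every graph with average degree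
greater than `k−2` contains `T`. -/
def ErdosSos (k : ℕ) (T : HGraph 2) : Prop :=
  ∀ G : HGraph 2, ((k : ℝ) - 2) * (G.verts.card : ℝ) < 2 * (G.edges.card : ℝ) →
    T.IsCopyIn G

/-- The `(r−2)`-expansion `Exp(T)` of a `2`-graph `T`: enlarge every edge by one
common fixed set of `r−2` new vertices. -/
def expTree (r : ℕ) (T : HGraph 2) : HGraph r :=
  HGraph.ofEdges r
    (T.verts ∪ ((Finset.range (r-2)).image fun s => T.verts.sup id + 1 + s))
    (T.edges.image fun e =>
      e ∪ ((Finset.range (r-2)).image fun s => T.verts.sup id + 1 + s))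

/-- The chromatic number of a `2`-graph. -/
noncomputable def chrom (F : HGraph 2) : ℕ :=
  sInf {k | ∃ c : ℕ → ℕ, (∀ v ∈ F.verts, c v < k) ∧
    ∀ e ∈ F.edges, ∀ u ∈ e, ∀ v ∈ e, u ≠ v → c u ≠ c v}

/-- A graph is edge-critical if deleting some edge lowers its chromatic number. -/
def EdgeCritical (F : HGraph 2) : Prop :=
  ∃ e ∈ F.edges, chrom (HGraph.ofEdges 2 F.verts (F.edges.erase e)) < chrom F

/-- `H` is semibipartite: the vertex set splits into `V₁ ∪ V₂` so that every edge
has exactly one vertex in `V₁`. -/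
def Semibipartite (r : ℕ) (H : HGraph r) : Prop :=
  ∃ V₁ ⊆ H.verts, ∀ e ∈ H.edges, (e ∩ V₁).card = 1

/-- `H` is a `K_ℓ^r`-subconstruction, i.e. an `ℓ`-partite `r`-graph. -/
def IsKlSub (r ℓ : ℕ) (H : HGraph r) : Prop :=
  ∃ f : ℕ → ℕ, (∀ v ∈ H.verts, f v < ℓ) ∧
    ∀ e ∈ H.edges, ∀ u ∈ e, ∀ v ∈ e, f u = f v → u = v

/-- The Lagrangian `λ(W)` of an `r`-graph `W`, viewing `W` as a pattern. -/
noncomputable def hgLagrangian (r : ℕ) (W : HGraph r) : ℝ :=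
  limUnder atTop fun n : ℕ =>
    ((sSup {m | ∃ G : HGraph r, IsBlowupOf W G ∧ G.verts.card = n ∧ G.edges.card = m} : ℕ) : ℝ)
      / (n.choose r : ℝ)

/-- The `r`-graph `B(r,ℓ+1)`. -/
def BGraph (r ℓ : ℕ) : HGraph r :=
  HGraph.ofEdges r (Finset.Icc 1 (ℓ+1))
    (insert (Finset.Icc 1 r)
      ((Finset.powersetCard r (Finset.Icc 2 (ℓ+1))).filter
        fun e => (e ∩ Finset.Icc 2 r).card ≤ 1))

/-- The `r`-uniform matching of size two, `M_2^r`. -/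
def matching2 (r : ℕ) : HGraph r :=
  HGraph.ofEdges r (Finset.Icc 1 (2*r)) {Finset.Icc 1 r, Finset.Icc (r+1) (2*r)}

/-- The expanded triangle `𝓒_3^{2r}`. -/
def expandedTriangle (r : ℕ) : HGraph (2*r) :=
  HGraph.ofEdges (2*r) (Finset.Icc 1 (3*r))
    {Finset.Icc 1 (2*r), Finset.Icc (r+1) (3*r), Finset.Icc 1 r ∪ Finset.Icc (2*r+1) (3*r)}

/-- The `4`-graph `𝔽_{4,3}`. -/
def F43 : HGraph 4 :=
  HGraph.ofEdges 4 (Finset.Icc 1 7)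
    {({1,2,3,4} : Finset ℕ), {1,2,3,5}, {1,2,3,6}, {1,2,3,7}, {4,5,6,7}}

/-- The `3`-graph `𝔽_{3,2}`. -/
def F32 : HGraph 3 :=
  HGraph.ofEdges 3 (Finset.Icc 1 5)
    {({1,2,3} : Finset ℕ), {1,2,4}, {1,2,5}, {3,4,5}}

/-- `H` contains pairwise vertex-disjoint copies of `F i`, `ts i` many of each. -/
def HasMixedMatching (r k : ℕ) (F : Fin k → HGraph r) (ts : Fin k → ℕ)
    (H : HGraph r) : Prop :=
  ∃ S : (i : Fin k) → Fin (ts i) → Finset ℕ,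
    (∀ i j, S i j ⊆ H.verts ∧ (S i j).card = (F i).verts.card) ∧
    (∀ p q : Σ i : Fin k, Fin (ts i), p ≠ q → Disjoint (S p.1 p.2) (S q.1 q.2)) ∧
    ∀ i j, (F i).IsCopyIn (H.induce (S i j))

/-- `ex(n, ⊔ᵢ tᵢ Fᵢ)`. -/
noncomputable def exMixedN (r k : ℕ) (F : Fin k → HGraph r) (ts : Fin k → ℕ)
    (n : ℕ) : ℕ :=
  sSup {m | ∃ H : HGraph r, H.verts.card = n ∧ ¬ HasMixedMatching r k F ts H ∧
    H.edges.card = m}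

/-- `ex(n, {F₁,…,F_k})`. -/
noncomputable def exFamN (r k : ℕ) (F : Fin k → HGraph r) (n : ℕ) : ℕ :=
  sSup {m | ∃ H : HGraph r, H.verts.card = n ∧ (∀ i, ¬ (F i).IsCopyIn H) ∧
    H.edges.card = m}



end DensityCH

section
namespace DensityCH
open Finset
set_option linter.all false

section Weights
variable {α : Type*} [DecidableEq α]

/-- weight of a set -/
def wt (x : α → ℝ) (s : Finset α) : ℝ := ∏ v ∈ s, x v
/-- weighted degree of a set `q` -/
def Dg (E : Finset (Finset α)) (x : α → ℝ) (q : Finset α) : ℝ :=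
  ∑ e ∈ E with q ⊆ e, wt x (e \ q)
/-- weight polynomial -/
def PE (E : Finset (Finset α)) (x : α → ℝ) : ℝ := ∑ e ∈ E, wt x e
/-- elementary symmetric polynomial -/
def es (T : Finset α) (k : ℕ) (x : α → ℝ) : ℝ := ∑ s ∈ T.powersetCard k, wt x s
/-- link -/
def lk (E : Finset (Finset α)) (a : α) : Finset (Finset α) :=
  (E.filter (a ∈ ·)).image (·.erase a)
/-- uniform families -/
def Unif (r : ℕ) (T : Finset α) (E : Finset (Finset α)) : Prop := ∀ e ∈ E, e ⊆ T ∧ e.card = r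

lemma wt_nonneg {x : α → ℝ} (hx : ∀ v, 0 ≤ x v) (s : Finset α) : 0 ≤ wt x s :=
  Finset.prod_nonneg fun v _ => hx v

lemma wt_empty (x : α → ℝ) : wt x ∅ = 1 := by simp [wt]

lemma wt_insert {x : α → ℝ} {v : α} {s : Finset α} (h : v ∉ s) :
    wt x (insert v s) = x v * wt x s := by simp [wt, Finset.prod_insert h]

lemma wt_erase {x : α → ℝ} {v : α} {s : Finset α} (h : v ∈ s) :
    wt x s = x v * wt x (s.erase v) := by
  simp [wt, Finset.mul_prod_erase s x h]

lemma wt_sdiff {x : α → ℝ} {q s : Finset α} (h : q ⊆ s) :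
    wt x s = wt x q * wt x (s \ q) := by
  unfold wt; rw [mul_comm, Finset.prod_sdiff h]

lemma wt_congr {x y : α → ℝ} {s : Finset α} (h : ∀ v ∈ s, x v = y v) : wt x s = wt y s :=
  Finset.prod_congr rfl h

lemma wt_smul (x : α → ℝ) (c : ℝ) (s : Finset α) :
    wt (fun v => c * x v) s = c ^ s.card * wt x s := by
  simp [wt, Finset.prod_mul_distrib]

lemma wt_const (c : ℝ) (s : Finset α) : wt (fun _ => c) s = c ^ s.card := by simp [wt]

lemma wt_mono {x y : α → ℝ} (hx : ∀ v, 0 ≤ x v) {s : Finset α} (h : ∀ v ∈ s, x v ≤ y v) :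
    wt x s ≤ wt y s := Finset.prod_le_prod (fun v _ => hx v) h

lemma Dg_nonneg {x : α → ℝ} (hx : ∀ v, 0 ≤ x v) (E : Finset (Finset α)) (q : Finset α) :
    0 ≤ Dg E x q := Finset.sum_nonneg fun e _ => wt_nonneg hx _

lemma PE_nonneg {x : α → ℝ} (hx : ∀ v, 0 ≤ x v) (E : Finset (Finset α)) :
    0 ≤ PE E x := Finset.sum_nonneg fun e _ => wt_nonneg hx _

lemma es_nonneg {x : α → ℝ} (hx : ∀ v, 0 ≤ x v) (T : Finset α) (k : ℕ) :
    0 ≤ es T k x := Finset.sum_nonneg fun e _ => wt_nonneg hx _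

lemma PE_mono {x : α → ℝ} (hx : ∀ v, 0 ≤ x v) {E F : Finset (Finset α)} (h : E ⊆ F) :
    PE E x ≤ PE F x :=
  Finset.sum_le_sum_of_subset_of_nonneg h fun e _ _ => wt_nonneg hx _

lemma PE_filter_add (E : Finset (Finset α)) (x : α → ℝ) (p : Finset α → Prop) [DecidablePred p] :
    PE (E.filter p) x + PE (E.filter (fun e => ¬ p e)) x = PE E x := by
  unfold PE; exact Finset.sum_filter_add_sum_filter_not E p _

lemma PE_union_le {x : α → ℝ} (hx : ∀ v, 0 ≤ x v) (E F : Finset (Finset α)) :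
    PE (E ∪ F) x ≤ PE E x + PE F x := by
  unfold PE
  rw [← Finset.sum_union_inter]
  have := Finset.sum_nonneg (s := E ∩ F) (f := wt x) fun e _ => wt_nonneg hx _
  linarith

lemma Dg_empty (E : Finset (Finset α)) (x : α → ℝ) : Dg E x ∅ = PE E x := by
  simp [Dg, PE]

lemma Dg_mono {x : α → ℝ} (hx : ∀ v, 0 ≤ x v) {E F : Finset (Finset α)} (h : E ⊆ F)
    (q : Finset α) : Dg E x q ≤ Dg F x q :=
  Finset.sum_le_sum_of_subset_of_nonneg (Finset.filter_subset_filter _ h)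
    fun e _ _ => wt_nonneg hx _

/-- weight of edges through `q` -/
lemma PE_through (E : Finset (Finset α)) (x : α → ℝ) (q : Finset α) :
    PE (E.filter (q ⊆ ·)) x = wt x q * Dg E x q := by
  unfold PE Dg
  rw [Finset.mul_sum]
  exact Finset.sum_congr rfl fun e he => wt_sdiff (Finset.mem_filter.1 he).2

lemma Dg_split (E : Finset (Finset α)) (x : α → ℝ) {q : Finset α} {u : α} (hu : u ∉ q) :
    Dg E x q = Dg (E.filter (u ∉ ·)) x q + x u * Dg E x (insert u q) := by
  unfold Dg
  rw [← Finset.sum_filter_add_sum_filter_not (E.filter (q ⊆ ·)) (u ∉ ·), Finset.mul_sum]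
  congr 1
  · apply Finset.sum_congr _ fun _ _ => rfl
    ext e; simp; tauto
  · have : (E.filter (q ⊆ ·)).filter (fun e => ¬ u ∉ e) = E.filter (insert u q ⊆ ·) := by
      ext e; simp [Finset.insert_subset_iff]; tauto
    rw [this]
    apply Finset.sum_congr rfl
    intro e he
    have he := (Finset.mem_filter.1 he).2
    rw [Finset.insert_subset_iff] at he
    have h2 : u ∈ e \ q := Finset.mem_sdiff.2 ⟨he.1, hu⟩
    rw [wt_erase h2]
    congr 2
    ext v; simp; tauto

lemma PE_split (E : Finset (Finset α)) (x : α → ℝ) (u : α) :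
    PE E x = PE (E.filter (u ∉ ·)) x + x u * Dg E x {u} := by
  rw [← Dg_empty, ← Dg_empty, Dg_split E x (u := u) (Finset.notMem_empty u)]; rfl

lemma Dg_congr {E : Finset (Finset α)} {x y : α → ℝ} {q : Finset α}
    (h : ∀ e ∈ E, q ⊆ e → ∀ v ∈ e, v ∉ q → x v = y v) : Dg E x q = Dg E y q := by
  unfold Dg
  refine Finset.sum_congr rfl fun e he => wt_congr fun v hv => ?_
  rw [Finset.mem_filter] at he
  rw [Finset.mem_sdiff] at hv
  exact h e he.1 he.2 v hv.1 hv.2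

lemma PE_congr {E : Finset (Finset α)} {x y : α → ℝ}
    (h : ∀ e ∈ E, ∀ v ∈ e, x v = y v) : PE E x = PE E y :=
  Finset.sum_congr rfl fun e he => wt_congr fun v hv => h e he v hv

lemma dc {β : Type*} [AddCommMonoid β] (E : Finset (Finset α)) (T : Finset α) (hE : ∀ e ∈ E, e ⊆ T)
    (f : Finset α → α → β) :
    ∑ e ∈ E, ∑ v ∈ e, f e v = ∑ v ∈ T, ∑ e ∈ E with v ∈ e, f e v := by
  apply Finset.sum_comm'
  intro e v
  simp only [Finset.mem_filter]
  exact ⟨fun h => ⟨⟨h.1, h.2⟩, hE e h.1 h.2⟩, fun h => h.1⟩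

lemma sum_x_Dg {r : ℕ} {T : Finset α} {E : Finset (Finset α)} (hE : Unif r T E) (x : α → ℝ) :
    ∑ v ∈ T, x v * Dg E x {v} = r * PE E x := by
  have h1 : ∀ v, x v * Dg E x {v} = ∑ e ∈ E with v ∈ e, wt x e := by
    intro v
    have := PE_through E x {v}
    simp only [Finset.singleton_subset_iff] at this
    rw [show wt x {v} = x v by simp [wt]] at this
    rw [← this]; rfl
  simp_rw [h1]
  rw [← dc E T (fun e he => (hE e he).1) (fun e _ => wt x e)]
  unfold PE
  rw [Finset.mul_sum]
  refine Finset.sum_congr rfl fun e he => ?_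
  simp [(hE e he).2]

lemma mem_lk {E : Finset (Finset α)} {a : α} {s : Finset α} :
    s ∈ lk E a ↔ a ∉ s ∧ insert a s ∈ E := by
  unfold lk
  simp only [Finset.mem_image, Finset.mem_filter]
  constructor
  · rintro ⟨e, ⟨h1, h2⟩, rfl⟩
    exact ⟨Finset.notMem_erase a e, by rwa [Finset.insert_erase h2]⟩
  · rintro ⟨h1, h2⟩
    exact ⟨_, ⟨h2, Finset.mem_insert_self _ _⟩, Finset.erase_insert h1⟩

lemma Dg_lk (E : Finset (Finset α)) (x : α → ℝ) (a : α) : Dg E x {a} = PE (lk E a) x := by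
  unfold Dg PE lk
  simp only [Finset.singleton_subset_iff]
  rw [Finset.sum_image]
  · exact Finset.sum_congr rfl fun e _ => by rw [Finset.sdiff_singleton_eq_erase]
  · intro e he f hf h
    have he := (Finset.mem_filter.1 he).2
    have hf := (Finset.mem_filter.1 hf).2
    dsimp only at h
    rw [← Finset.insert_erase he, h, Finset.insert_erase hf]

lemma unif_lk {r : ℕ} {T : Finset α} {E : Finset (Finset α)} (hE : Unif (r+1) T E) (a : α) :
    Unif r (T.erase a) (lk E a) := by
  intro s hs
  rw [mem_lk] at hs
  have := hE _ hs.2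
  rw [Finset.card_insert_of_notMem hs.1, Finset.insert_subset_iff] at this
  exact ⟨Finset.subset_erase.2 ⟨this.1.2, hs.1⟩, by omega⟩

lemma unif_mono {r : ℕ} {T : Finset α} {E F : Finset (Finset α)} (hE : Unif r T E) (h : F ⊆ E) :
    Unif r T F := fun e he => hE e (h he)

lemma PE_smul {r : ℕ} {T : Finset α} {E : Finset (Finset α)} (hE : Unif r T E) (x : α → ℝ) (c : ℝ) :
    PE E (fun v => c * x v) = c ^ r * PE E x := by
  unfold PE; rw [Finset.mul_sum]
  exact Finset.sum_congr rfl fun e he => by rw [wt_smul, (hE e he).2]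

/-! Symmetric polynomials -/

lemma es_eq_PE (T : Finset α) (k : ℕ) (x : α → ℝ) : es T k x = PE (T.powersetCard k) x := rfl

lemma unif_psc (T : Finset α) (k : ℕ) : Unif k T (T.powersetCard k) :=
  fun _ he => Finset.mem_powersetCard.1 he

lemma lk_psc {T : Finset α} {k : ℕ} {v : α} (hv : v ∈ T) :
    lk (T.powersetCard (k+1)) v = (T.erase v).powersetCard k := by
  ext s
  rw [mem_lk, Finset.mem_powersetCard, Finset.mem_powersetCard, Finset.insert_subset_iff,
    Finset.subset_erase]
  constructor
  · rintro ⟨h1, h2, h3⟩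
    rw [Finset.card_insert_of_notMem h1] at h3
    exact ⟨⟨h2.2, h1⟩, by omega⟩
  · rintro ⟨⟨h1, h2⟩, h3⟩
    exact ⟨h2, ⟨hv, h1⟩, by rw [Finset.card_insert_of_notMem h2, h3]⟩

lemma es_handshake (T : Finset α) (k : ℕ) (x : α → ℝ) :
    ∑ v ∈ T, x v * es (T.erase v) k x = (k+1) * es T (k+1) x := by
  have := sum_x_Dg (unif_psc T (k+1)) x
  rw [es_eq_PE]
  push_cast at this
  rw [← this]
  refine Finset.sum_congr rfl fun v hv => ?_
  rw [Dg_lk, lk_psc hv]; rfl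

lemma es_split {T : Finset α} {v : α} (hv : v ∈ T) (k : ℕ) (x : α → ℝ) :
    es T (k+1) x = es (T.erase v) (k+1) x + x v * es (T.erase v) k x := by
  rw [es_eq_PE, PE_split _ _ v, Dg_lk, lk_psc hv]
  congr 2
  ext s; simp [Finset.subset_erase]; tauto

lemma es_zero (T : Finset α) (x : α → ℝ) : es T 0 x = 1 := by simp [es, wt]
lemma es_one (T : Finset α) (x : α → ℝ) : es T 1 x = ∑ v ∈ T, x v := by
  have := es_handshake T 0 x
  simp [es_zero] at this
  exact this.symm

lemma es_sum_erase (T : Finset α) (k : ℕ) (x : α → ℝ) :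
    ∑ v ∈ T, es (T.erase v) k x = (T.card - k) * es T k x := by
  have h1 : ∀ v ∈ T, es (T.erase v) k x = ∑ s ∈ T.powersetCard k with v ∉ s, wt x s := by
    intro v _
    unfold es
    refine Finset.sum_congr ?_ fun _ _ => rfl
    ext s; simp [Finset.subset_erase]; tauto
  rw [Finset.sum_congr rfl h1]
  have h2 : ∑ v ∈ T, ∑ s ∈ T.powersetCard k with v ∉ s, wt x s =
      ∑ s ∈ T.powersetCard k, ∑ v ∈ T \ s, wt x s := by
    apply Finset.sum_comm'
    intro v s; simp; tauto
  rw [h2]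
  unfold es
  rw [Finset.mul_sum]
  refine Finset.sum_congr rfl fun s hs => ?_
  rw [Finset.mem_powersetCard] at hs
  rw [Finset.sum_const, Finset.card_sdiff_of_subset hs.1, nsmul_eq_mul,
    Nat.cast_sub (Finset.card_le_card hs.1), hs.2]

/-- Maclaurin step -/
lemma maclaurin_step {T : Finset α} {x : α → ℝ} (hx : ∀ v, 0 ≤ x v) (k : ℕ) :
    (T.card : ℝ) * ((k+1) * es T (k+1) x) ≤ (∑ v ∈ T, x v) * ((T.card - k) * es T k x) := by
  rw [← es_handshake, ← es_sum_erase]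
  apply AntivaryOn.card_mul_sum_le_sum_mul_sum
  intro u hu v hv huv
  cases k with
  | zero => simp [es_zero] at huv
  | succ k =>
  by_contra hc
  push Not at hc
  have huv' : u ≠ v := by rintro rfl; exact lt_irrefl _ hc
  have h1 := es_split (T := T.erase u) (v := v) (Finset.mem_erase.2 ⟨huv'.symm, hv⟩) k x
  have h2 := es_split (T := T.erase v) (v := u) (Finset.mem_erase.2 ⟨huv', hu⟩) k x
  rw [Finset.erase_right_comm] at h2
  have h3 := es_nonneg hx ((T.erase u).erase v) k
  dsimp only at huv
  rw [h1, h2] at huv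
  nlinarith

lemma es_succ_le {T : Finset α} {x : α → ℝ} (hx : ∀ v, 0 ≤ x v) (h1 : ∑ v ∈ T, x v = 1) (k : ℕ) :
    es T (k+1) x ≤ es T k x / (k+1) := by
  have h := maclaurin_step (T := T) hx k
  rw [h1, one_mul] at h
  have h0 := es_nonneg hx T k
  have hT : (0:ℝ) < T.card := by
    rcases Finset.eq_empty_or_nonempty T with rfl | h'
    · simp at h1
    · exact_mod_cast h'.card_pos
  rw [le_div_iff₀ (by positivity)]
  have hk : (0:ℝ) ≤ k := by positivity
  nlinarith [mul_nonneg hk h0]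

lemma es_le_one {T : Finset α} {x : α → ℝ} (hx : ∀ v, 0 ≤ x v) (h1 : ∑ v ∈ T, x v = 1) (k : ℕ) :
    es T k x ≤ 1 := by
  induction k with
  | zero => simp [es_zero]
  | succ k ih =>
    refine (es_succ_le hx h1 k).trans ?_
    rw [div_le_one (by positivity)]
    have : (0:ℝ) ≤ k := by positivity
    linarith

/-- Maclaurin: `es T k ≤ C(n,k)/n^k` -/
lemma maclaurin {T : Finset α} {x : α → ℝ} (hx : ∀ v, 0 ≤ x v) (k : ℕ) :
    es T k x * (T.card : ℝ) ^ k ≤ (T.card.choose k) * (∑ v ∈ T, x v) ^ k := by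
  induction k with
  | zero => simp [es_zero]
  | succ k ih =>
    have h := maclaurin_step (T := T) hx k
    have hs : 0 ≤ ∑ v ∈ T, x v := Finset.sum_nonneg fun v _ => hx v
    rcases lt_or_ge T.card k with hlt | hge
    · have : es T (k+1) x = 0 := by
        unfold es; rw [Finset.powersetCard_eq_empty.2 (by omega)]; simp
      rw [this]; simp; positivity
    have hc : ((T.card.choose (k+1) : ℕ) : ℝ) * (k+1) = T.card.choose k * (T.card - k) := by
      have := Nat.choose_succ_right_eq T.card k
      rw [← Nat.cast_sub hge]; exact_mod_cast this
    have hkT : (0:ℝ) ≤ T.card - k := by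
      rw [sub_nonneg]; exact_mod_cast hge
    have h4 : (T.card : ℝ) ^ k * (T.card * ((k+1) * es T (k+1) x)) ≤
        (T.card : ℝ) ^ k * ((∑ v ∈ T, x v) * ((T.card - k) * es T k x)) := by gcongr
    have h5 : (∑ v ∈ T, x v) * (T.card - k) * (es T k x * (T.card : ℝ) ^ k) ≤
        (∑ v ∈ T, x v) * (T.card - k) * ((T.card.choose k) * (∑ v ∈ T, x v) ^ k) := by gcongr
    have hk : (0:ℝ) < k + 1 := by positivity
    refine le_of_mul_le_mul_left ?_ hk
    calc (k+1 : ℝ) * (es T (k+1) x * (T.card : ℝ) ^ (k+1))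
        = (T.card : ℝ) ^ k * (T.card * ((k+1) * es T (k+1) x)) := by ring
      _ ≤ _ := h4
      _ = (∑ v ∈ T, x v) * (T.card - k) * (es T k x * (T.card : ℝ) ^ k) := by ring
      _ ≤ _ := h5
      _ = (T.card.choose k * (T.card - k)) * ((∑ v ∈ T, x v) * (∑ v ∈ T, x v) ^ k) := by ring
      _ = _ := by rw [← hc]; ring

end Weights
end DensityCH
end

section
namespace DensityCH
open Finset
set_option linter.all false

section FB
variable {α : Type*} [DecidableEq α]

/-- partial Steiner: every `k`-set is in at most one edge -/
def PSt (k : ℕ) (E : Finset (Finset α)) : Prop :=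
  ∀ e ∈ E, ∀ f ∈ E, k ≤ (e ∩ f).card → e = f

/-- Johnson bound -/
def jn : ℕ → ℕ → ℕ
  | _, 0 => 1
  | n, k+1 => n * jn (n-1) k / (k+2)

lemma card_lk (E : Finset (Finset α)) (a : α) : (lk E a).card = (E.filter (a ∈ ·)).card := by
  unfold lk
  apply Finset.card_image_of_injOn
  intro e he f hf h
  have he := (Finset.mem_filter.1 he).2
  have hf := (Finset.mem_filter.1 hf).2
  dsimp only at h
  rw [← Finset.insert_erase he, h, Finset.insert_erase hf]

lemma PSt_lk {k : ℕ} {E : Finset (Finset α)} (h : PSt (k+1) E) (a : α) : PSt k (lk E a) := by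
  intro e he f hf hef
  rw [mem_lk] at he hf
  have := h _ he.2 _ hf.2 (by
    rw [← Finset.insert_inter_distrib, Finset.card_insert_of_notMem (by simp [he.1])]; omega)
  rw [← Finset.erase_insert he.1, this, Finset.erase_insert hf.1]

lemma johnson {k : ℕ} {T : Finset α} {E : Finset (Finset α)} (hE : Unif (k+1) T E) (hP : PSt k E) :
    E.card ≤ jn T.card k := by
  induction k generalizing T E with
  | zero =>
    rw [jn, Finset.card_le_one]
    intro e he f hf
    exact hP e he f hf (Nat.zero_le _)
  | succ k ih =>
    rw [jn, Nat.le_div_iff_mul_le (by omega)]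
    have h1 : ∑ e ∈ E, ∑ v ∈ e, 1 = E.card * (k+2) := by
      rw [Finset.sum_congr rfl (g := fun _ => k+2) (fun e he => by simp [(hE e he).2])]
      simp
    rw [← h1, dc E T (fun e he => (hE e he).1)]
    calc ∑ v ∈ T, ∑ e ∈ E with v ∈ e, 1 ≤ ∑ v ∈ T, jn (T.card - 1) k := by
          apply Finset.sum_le_sum
          intro v hv
          rw [← Finset.card_eq_sum_ones, ← card_lk]
          have := ih (unif_lk hE v) (PSt_lk hP v)
          rwa [Finset.card_erase_of_mem hv] at this
      _ = _ := by simp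

/-- shadow -/
def shd (k : ℕ) (E : Finset (Finset α)) : Finset (Finset α) := E.biUnion (·.powersetCard k)

lemma psc_erase {k : ℕ} {e : Finset α} (he : e.card = k+1) :
    e.powersetCard k = e.image (e.erase ·) := by
  ext s
  rw [Finset.mem_powersetCard, Finset.mem_image]
  constructor
  · rintro ⟨h1, h2⟩
    have : (e \ s).card = 1 := by rw [Finset.card_sdiff_of_subset h1]; omega
    obtain ⟨v, hv⟩ := Finset.card_eq_one.1 this
    have hv' : v ∈ e \ s := by rw [hv]; simp
    rw [Finset.mem_sdiff] at hv'
    refine ⟨v, hv'.1, ?_⟩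
    rw [← Finset.sdiff_singleton_eq_erase, ← hv]
    ext z; simp; intro hz; exact h1 hz
  · rintro ⟨v, hv, rfl⟩
    exact ⟨Finset.erase_subset _ _, by rw [Finset.card_erase_of_mem hv]; omega⟩

lemma erase_injOn (e : Finset α) : Set.InjOn (e.erase ·) (e : Set α) := by
  intro u hu v hv h
  by_contra hne
  have : v ∈ e.erase u := Finset.mem_erase.2 ⟨fun h => hne h.symm, hv⟩
  dsimp only at h
  rw [h] at this
  simp at this

lemma shd_pd {k : ℕ} {E : Finset (Finset α)} (hP : PSt k E) :
    Set.PairwiseDisjoint (E : Set (Finset α)) (·.powersetCard k) := by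
  intro e he f hf hef
  rw [Function.onFun, Finset.disjoint_left]
  intro s hs hs'
  rw [Finset.mem_powersetCard] at hs hs'
  exact hef (hP e he f hf (by
    rw [← hs.2]; exact Finset.card_le_card (Finset.subset_inter hs.1 hs'.1)))

lemma sum_Dg_shd {k : ℕ} {T : Finset α} {E : Finset (Finset α)} (hE : Unif (k+1) T E) (hP : PSt k E)
    (x : α → ℝ) : ∑ v ∈ T, Dg E x {v} = PE (shd k E) x := by
  unfold PE shd
  rw [Finset.sum_biUnion (shd_pd hP)]
  have : ∀ e ∈ E, ∑ s ∈ e.powersetCard k, wt x s = ∑ v ∈ e, wt x (e.erase v) := by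
    intro e he
    rw [psc_erase (hE e he).2, Finset.sum_image (erase_injOn e)]
  rw [Finset.sum_congr rfl this, dc E T (fun e he => (hE e he).1)]
  refine Finset.sum_congr rfl fun v _ => ?_
  unfold Dg
  simp only [Finset.singleton_subset_iff, Finset.sdiff_singleton_eq_erase]

lemma shd_sub {k r : ℕ} {T : Finset α} {E : Finset (Finset α)} (hE : Unif r T E) :
    shd k E ⊆ T.powersetCard k := by
  intro s hs
  unfold shd at hs
  rw [Finset.mem_biUnion] at hs
  obtain ⟨e, he, hs⟩ := hs
  rw [Finset.mem_powersetCard] at hs ⊢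
  exact ⟨hs.1.trans (hE e he).1, hs.2⟩

lemma card_shd {k : ℕ} {T : Finset α} {E : Finset (Finset α)} (hE : Unif (k+1) T E) (hP : PSt k E) :
    (shd k E).card = E.card * (k+1) := by
  unfold shd
  rw [Finset.card_biUnion (shd_pd hP)]
  rw [Finset.sum_congr rfl (g := fun _ => k+1) (fun e he => by simp [(hE e he).2])]
  simp

lemma sum_Dg_unc {k : ℕ} {T : Finset α} {E : Finset (Finset α)} (hE : Unif (k+1) T E) (hP : PSt k E)
    (x : α → ℝ) : ∑ v ∈ T, Dg E x {v} + PE (T.powersetCard k \ shd k E) x = es T k x := by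
  rw [sum_Dg_shd hE hP, add_comm]
  exact Finset.sum_sdiff (shd_sub hE)

lemma sum_Dg_le_es {k : ℕ} {T : Finset α} {E : Finset (Finset α)} (hE : Unif (k+1) T E)
    (hP : PSt k E) {x : α → ℝ} (hx : ∀ v, 0 ≤ x v) : ∑ v ∈ T, Dg E x {v} ≤ es T k x := by
  have := sum_Dg_unc hE hP x
  have := PE_nonneg hx (T.powersetCard k \ shd k E)
  linarith

lemma FB1 {k : ℕ} {T : Finset α} {E : Finset (Finset α)} (hE : Unif (k+1) T E)
    (hP : PSt k E) {x : α → ℝ} (hx : ∀ v, 0 ≤ x v) (h1 : ∑ v ∈ T, x v = 1) :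
    ∑ v ∈ T, Dg E x {v} ≤ (T.card.choose k) / (T.card : ℝ) ^ k := by
  have hT : (0:ℝ) < T.card := by
    rcases Finset.eq_empty_or_nonempty T with rfl | h'
    · simp at h1
    · exact_mod_cast h'.card_pos
  have := maclaurin (T := T) hx k
  rw [h1, one_pow, mul_one] at this
  rw [le_div_iff₀ (by positivity)]
  refine le_trans ?_ this
  have := sum_Dg_le_es hE hP hx
  gcongr

lemma FB2 {k : ℕ} {T : Finset α} {E : Finset (Finset α)} (hE : Unif (k+2) T E)
    (hP : PSt (k+1) E) {x : α → ℝ} (hx : ∀ v, 0 ≤ x v) (h1 : ∑ v ∈ T, x v = 1) {n : ℕ}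
    (hn : T.card = n + 2) (U : ℕ) (hU : U + E.card * (k+2) ≤ (n+2).choose (k+1)) :
    ∃ s : ℝ, 0 ≤ s ∧ s ≤ 1 / (n+2) ∧ ∑ v ∈ T, Dg E x {v} ≤
      (n+1).choose (k+1) * ((1-s)/(n+1))^(k+1) + s * ((n+1).choose k * ((1-s)/(n+1))^k)
       - U * s^(k+1) := by
  have hne : T.Nonempty := by rw [← Finset.card_pos]; omega
  obtain ⟨v, hv, hmin⟩ := Finset.exists_min_image T x hne
  refine ⟨x v, hx v, ?_, ?_⟩
  · rw [le_div_iff₀ (by positivity)]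
    have := Finset.card_nsmul_le_sum T x (x v) hmin
    rw [h1, hn, nsmul_eq_mul] at this
    push_cast at this
    linarith
  · have h2 : ∑ u ∈ T.erase v, x u = 1 - x v := by
      rw [← h1, ← Finset.add_sum_erase T x hv]; ring
    have hc : (T.erase v).card = n + 1 := by rw [Finset.card_erase_of_mem hv]; omega
    have m1 := maclaurin (T := T.erase v) hx (k+1)
    have m2 := maclaurin (T := T.erase v) hx k
    rw [h2, hc] at m1 m2
    have e1 := es_split hv k x
    have e2 := sum_Dg_unc hE hP x
    have e3 : (U:ℝ) * x v ^ (k+1) ≤ PE (T.powersetCard (k+1) \ shd (k+1) E) x := by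
      have c1 : U ≤ (T.powersetCard (k+1) \ shd (k+1) E).card := by
        rw [Finset.card_sdiff_of_subset (shd_sub hE), card_shd hE hP, Finset.card_powersetCard, hn]
        have : k + 1 + 1 = k + 2 := rfl
        rw [this]; omega
      calc (U:ℝ) * x v ^ (k+1) ≤ (T.powersetCard (k+1) \ shd (k+1) E).card * x v ^ (k+1) := by
            have := hx v
            gcongr
        _ ≤ _ := by
            unfold PE
            rw [← nsmul_eq_mul]
            apply Finset.card_nsmul_le_sum
            intro s hs
            rw [Finset.mem_sdiff, Finset.mem_powersetCard] at hs
            rw [← hs.1.2]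
            unfold wt
            rw [← Finset.prod_const]
            exact Finset.prod_le_prod (fun _ _ => hx v) (fun u hu => hmin u (hs.1.1 hu))
    have hn0 : (0:ℝ) < n + 1 := by positivity
    have f1 : es (T.erase v) (k+1) x ≤ (n+1).choose (k+1) * ((1-x v)/(n+1))^(k+1) := by
      rw [div_pow, ← mul_div_assoc, le_div_iff₀ (by positivity)]
      push_cast at m1; linarith
    have f2 : es (T.erase v) k x ≤ (n+1).choose k * ((1-x v)/(n+1))^k := by
      rw [div_pow, ← mul_div_assoc, le_div_iff₀ (by positivity)]
      push_cast at m2; linarith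
    have f3 := mul_le_mul_of_nonneg_left f2 (hx v)
    linarith

/-- `r λ` -/
noncomputable def rlam (r : ℕ) : ℝ := (if r = 5 then 30 else 66) / ((r:ℝ) + 6) ^ (r-1)
/-- `λ` -/
noncomputable def lam (r : ℕ) : ℝ := rlam r / r
/-- gap constant -/
noncomputable def gp : ℝ := 1 / 10^6

lemma rlam5 : rlam 5 = 30 / 14641 := by norm_num [rlam]
lemma rlam6 : rlam 6 = 66 / 248832 := by norm_num [rlam]

lemma compl_card {T : Finset α} {E : Finset (Finset α)} (hE : Unif 5 T E)
    (hP : PSt 4 E) (hT : T.card = 9) : E.card ≤ 18 := by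
  have hc : (E.image (T \ ·)).card = E.card := by
    apply Finset.card_image_of_injOn
    intro e he f hf h
    dsimp only at h
    rw [← Finset.sdiff_sdiff_eq_self (hE e he).1, h, Finset.sdiff_sdiff_eq_self (hE f hf).1]
  rw [← hc]
  have : jn 9 3 = 18 := by decide
  rw [← this, ← hT]
  apply johnson
  · intro s hs
    rw [Finset.mem_image] at hs
    obtain ⟨e, he, rfl⟩ := hs
    refine ⟨Finset.sdiff_subset, ?_⟩
    rw [Finset.card_sdiff_of_subset (hE e he).1, (hE e he).2, hT]
  · intro s hs t ht hst
    rw [Finset.mem_image] at hs ht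
    obtain ⟨e, he, rfl⟩ := hs
    obtain ⟨f, hf, rfl⟩ := ht
    rw [← Finset.sdiff_union_distrib, Finset.card_sdiff_of_subset
      (Finset.union_subset (hE e he).1 (hE f hf).1), hT] at hst
    have := Finset.card_union_add_card_inter e f
    rw [(hE e he).2, (hE f hf).2] at this
    rw [hP e he f hf (by omega)]

lemma FB5 {T : Finset α} {E : Finset (Finset α)} (hE : Unif 5 T E)
    (hP : PSt 4 E) {x : α → ℝ} (hx : ∀ v, 0 ≤ x v) (h1 : ∑ v ∈ T, x v = 1) (hT : T.card ≠ 11) :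
    ∑ v ∈ T, Dg E x {v} ≤ T.card * (rlam 5 - gp) := by
  have hJ := johnson hE hP
  rw [rlam5, gp]
  have hT0 : 0 < T.card := by
    rcases Finset.eq_empty_or_nonempty T with rfl | h'
    · simp at h1
    · exact h'.card_pos
  by_cases h7 : T.card = 7
  · rw [h7] at hJ
    have : jn 7 4 = 5 := by decide
    obtain ⟨s, s0, s1, hs⟩ := FB2 (k := 3) hE hP hx h1 (n := 5) h7 10 (by
      simp [Nat.choose]; omega)
    refine hs.trans ?_
    rw [h7]
    norm_num [Nat.choose] at s1 ⊢
    rcases le_total s (1/14) with h | h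
    · have a := s0; have b : 0 ≤ 1/14 - s := by linarith
      nlinarith [pow_nonneg a 4, pow_nonneg b 4, mul_nonneg a (pow_nonneg b 3),
        mul_nonneg (pow_nonneg a 2) (pow_nonneg b 2), mul_nonneg (pow_nonneg a 3) b]
    · have a : 0 ≤ s - 1/14 := by linarith
      have b : 0 ≤ 1/7 - s := by linarith
      nlinarith [pow_nonneg a 4, pow_nonneg b 4, mul_nonneg a (pow_nonneg b 3),
        mul_nonneg (pow_nonneg a 2) (pow_nonneg b 2), mul_nonneg (pow_nonneg a 3) b]
  by_cases h8 : T.card = 8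
  · rw [h8] at hJ
    have : jn 8 4 = 11 := by decide
    obtain ⟨s, s0, s1, hs⟩ := FB2 (k := 3) hE hP hx h1 (n := 6) h8 15 (by
      simp [Nat.choose]; omega)
    refine hs.trans ?_
    rw [h8]
    norm_num [Nat.choose] at s1 ⊢
    rcases le_total s (1/16) with h | h
    · have a := s0; have b : 0 ≤ 1/16 - s := by linarith
      nlinarith [pow_nonneg a 4, pow_nonneg b 4, mul_nonneg a (pow_nonneg b 3),
        mul_nonneg (pow_nonneg a 2) (pow_nonneg b 2), mul_nonneg (pow_nonneg a 3) b]
    · have a : 0 ≤ s - 1/16 := by linarith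
      have b : 0 ≤ 1/8 - s := by linarith
      nlinarith [pow_nonneg a 4, pow_nonneg b 4, mul_nonneg a (pow_nonneg b 3),
        mul_nonneg (pow_nonneg a 2) (pow_nonneg b 2), mul_nonneg (pow_nonneg a 3) b]
  by_cases h9 : T.card = 9
  · have := compl_card hE hP h9
    obtain ⟨s, s0, s1, hs⟩ := FB2 (k := 3) hE hP hx h1 (n := 7) h9 36 (by
      simp [Nat.choose]; omega)
    refine hs.trans ?_
    rw [h9]
    norm_num [Nat.choose] at s1 ⊢
    rcases le_total s (1/36) with h | h
    · have a := s0; have b : 0 ≤ 1/36 - s := by linarith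
      nlinarith [pow_nonneg a 4, pow_nonneg b 4, mul_nonneg a (pow_nonneg b 3),
        mul_nonneg (pow_nonneg a 2) (pow_nonneg b 2), mul_nonneg (pow_nonneg a 3) b]
    rcases le_total s (1/18) with h' | h'
    · have a : 0 ≤ s - 1/36 := by linarith
      have b : 0 ≤ 1/18 - s := by linarith
      nlinarith [pow_nonneg a 4, pow_nonneg b 4, mul_nonneg a (pow_nonneg b 3),
        mul_nonneg (pow_nonneg a 2) (pow_nonneg b 2), mul_nonneg (pow_nonneg a 3) b]
    · have a : 0 ≤ s - 1/18 := by linarith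
      have b : 0 ≤ 1/9 - s := by linarith
      nlinarith [pow_nonneg a 4, pow_nonneg b 4, mul_nonneg a (pow_nonneg b 3),
        mul_nonneg (pow_nonneg a 2) (pow_nonneg b 2), mul_nonneg (pow_nonneg a 3) b]
  by_cases h10 : T.card = 10
  · rw [h10] at hJ
    have : jn 10 4 = 36 := by decide
    obtain ⟨s, s0, s1, hs⟩ := FB2 (k := 3) hE hP hx h1 (n := 8) h10 30 (by
      simp [Nat.choose]; omega)
    refine hs.trans ?_
    rw [h10]
    norm_num [Nat.choose] at s1 ⊢
    rcases le_total s (1/20) with h | h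
    · have a := s0; have b : 0 ≤ 1/20 - s := by linarith
      nlinarith [pow_nonneg a 4, pow_nonneg b 4, mul_nonneg a (pow_nonneg b 3),
        mul_nonneg (pow_nonneg a 2) (pow_nonneg b 2), mul_nonneg (pow_nonneg a 3) b]
    · have a : 0 ≤ s - 1/20 := by linarith
      have b : 0 ≤ 1/10 - s := by linarith
      nlinarith [pow_nonneg a 4, pow_nonneg b 4, mul_nonneg a (pow_nonneg b 3),
        mul_nonneg (pow_nonneg a 2) (pow_nonneg b 2), mul_nonneg (pow_nonneg a 3) b]
  refine (FB1 (k := 4) hE hP hx h1).trans ?_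
  rcases lt_or_ge T.card 21 with h | h
  · generalize T.card = n at *
    interval_cases n <;> first | omega | norm_num [Nat.choose]
  · have h4 : (T.card.choose 4 : ℝ) / (T.card:ℝ)^4 ≤ 1/24 := by
      rw [div_le_iff₀ (by positivity)]
      have := Nat.choose_le_pow_div 4 T.card (α := ℝ)
      norm_num [Nat.factorial] at this ⊢
      linarith
    have : (21:ℝ) ≤ T.card := by exact_mod_cast h
    refine h4.trans ?_
    norm_num
    linarith

lemma FB6 {T : Finset α} {E : Finset (Finset α)} (hE : Unif 6 T E)
    (hP : PSt 5 E) {x : α → ℝ} (hx : ∀ v, 0 ≤ x v) (h1 : ∑ v ∈ T, x v = 1) (hT : T.card ≠ 12) :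
    ∑ v ∈ T, Dg E x {v} ≤ T.card * (rlam 6 - gp) := by
  have hJ := johnson hE hP
  rw [rlam6, gp]
  have hT0 : 0 < T.card := by
    rcases Finset.eq_empty_or_nonempty T with rfl | h'
    · simp at h1
    · exact h'.card_pos
  by_cases h7 : T.card = 13
  · rw [h7] at hJ
    have : jn 13 5 = 182 := by decide
    obtain ⟨s, s0, s1, hs⟩ := FB2 (k := 4) hE hP hx h1 (n := 11) h7 195 (by
      simp [Nat.choose]; omega)
    refine hs.trans ?_
    rw [h7]
    norm_num [Nat.choose] at s1 ⊢
    rcases le_total s (1/26) with h | h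
    · have a := s0; have b : 0 ≤ 1/26 - s := by linarith
      nlinarith [pow_nonneg a 5, pow_nonneg b 5, mul_nonneg a (pow_nonneg b 4),
        mul_nonneg (pow_nonneg a 2) (pow_nonneg b 3), mul_nonneg (pow_nonneg a 3) (pow_nonneg b 2),
        mul_nonneg (pow_nonneg a 4) b]
    · have a : 0 ≤ s - 1/26 := by linarith
      have b : 0 ≤ 1/13 - s := by linarith
      nlinarith [pow_nonneg a 5, pow_nonneg b 5, mul_nonneg a (pow_nonneg b 4),
        mul_nonneg (pow_nonneg a 2) (pow_nonneg b 3), mul_nonneg (pow_nonneg a 3) (pow_nonneg b 2),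
        mul_nonneg (pow_nonneg a 4) b]
  by_cases h8 : T.card = 14
  · rw [h8] at hJ
    have : jn 14 5 = 326 := by decide
    obtain ⟨s, s0, s1, hs⟩ := FB2 (k := 4) hE hP hx h1 (n := 12) h8 46 (by
      simp [Nat.choose]; omega)
    refine hs.trans ?_
    rw [h8]
    norm_num [Nat.choose] at s1 ⊢
    rcases le_total s (1/28) with h | h
    · have a := s0; have b : 0 ≤ 1/28 - s := by linarith
      nlinarith [pow_nonneg a 5, pow_nonneg b 5, mul_nonneg a (pow_nonneg b 4),
        mul_nonneg (pow_nonneg a 2) (pow_nonneg b 3), mul_nonneg (pow_nonneg a 3) (pow_nonneg b 2),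
        mul_nonneg (pow_nonneg a 4) b]
    · have a : 0 ≤ s - 1/28 := by linarith
      have b : 0 ≤ 1/14 - s := by linarith
      nlinarith [pow_nonneg a 5, pow_nonneg b 5, mul_nonneg a (pow_nonneg b 4),
        mul_nonneg (pow_nonneg a 2) (pow_nonneg b 3), mul_nonneg (pow_nonneg a 3) (pow_nonneg b 2),
        mul_nonneg (pow_nonneg a 4) b]
  refine (FB1 (k := 5) hE hP hx h1).trans ?_
  rcases lt_or_ge T.card 32 with h | h
  · generalize T.card = n at *
    interval_cases n <;> first | omega | norm_num [Nat.choose]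
  · have h4 : (T.card.choose 5 : ℝ) / (T.card:ℝ)^5 ≤ 1/120 := by
      rw [div_le_iff₀ (by positivity)]
      have := Nat.choose_le_pow_div 5 T.card (α := ℝ)
      norm_num [Nat.factorial] at this ⊢
      linarith
    have : (32:ℝ) ≤ T.card := by exact_mod_cast h
    refine h4.trans ?_
    norm_num
    linarith

lemma FB {r : ℕ} (hr : r = 5 ∨ r = 6) {T : Finset α} {E : Finset (Finset α)} (hE : Unif r T E)
    (hP : PSt (r-1) E) {x : α → ℝ} (hx : ∀ v, 0 ≤ x v) (h1 : ∑ v ∈ T, x v = 1)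
    (hT : T.card ≠ r + 6) : ∑ v ∈ T, Dg E x {v} ≤ T.card * (rlam r - gp) := by
  rcases hr with rfl | rfl
  · exact FB5 hE hP hx h1 hT
  · exact FB6 hE hP hx h1 hT

lemma FBm {r : ℕ} (hr : r = 5 ∨ r = 6) {T : Finset α} {E : Finset (Finset α)} (hE : Unif r T E)
    (hP : PSt (r-1) E) {x : α → ℝ} (hx : ∀ v, 0 ≤ x v) (h1 : ∑ v ∈ T, x v = 1)
    (hT : T.card = r + 6) : ∑ v ∈ T, Dg E x {v} ≤ T.card * rlam r := by
  rcases hr with rfl | rfl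
  · refine (FB1 (k := 4) hE hP hx h1).trans ?_
    rw [hT, rlam5]; norm_num [Nat.choose]
  · refine (FB1 (k := 5) hE hP hx h1).trans ?_
    rw [hT, rlam6]; norm_num [Nat.choose]

end FB
end DensityCH
end

section
namespace DensityCH
open Finset
set_option linter.all false

section Lagr
variable {α : Type*} [DecidableEq α]

/-- cancellative (`Σ_r`-free) families -/
def SF (E : Finset (Finset α)) : Prop :=
  ∀ (S : Finset α) (a b : α), a ≠ b → a ∉ S → b ∉ S → insert a S ∈ E → insert b S ∈ E →
    ∀ C ∈ E, a ∈ C → b ∈ C → False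

lemma SF_mono {E F : Finset (Finset α)} (h : SF E) (hF : F ⊆ E) : SF F :=
  fun S a b h1 h2 h3 h4 h5 C hC => h S a b h1 h2 h3 (hF h4) (hF h5) C (hF hC)

lemma unif_filter_notMem {r : ℕ} {T : Finset α} {E : Finset (Finset α)} (hE : Unif r T E) (u : α) :
    Unif r (T.erase u) (E.filter (u ∉ ·)) := by
  intro e he
  rw [Finset.mem_filter] at he
  exact ⟨Finset.subset_erase.2 ⟨(hE e he.1).1, he.2⟩, (hE e he.1).2⟩

lemma PSt_of_SF {k : ℕ} {T : Finset α} {E : Finset (Finset α)} (hE : Unif (k+1) T E) (hS : SF E)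
    (hc : ∀ u ∈ T, ∀ v ∈ T, u ≠ v → ∃ e ∈ E, u ∈ e ∧ v ∈ e) : PSt k E := by
  intro e he f hf hk
  by_contra hne
  have hec := (hE e he).2
  have hfc := (hE f hf).2
  have h1 : (e ∩ f).card < k + 1 := by
    by_contra hlt
    push Not at hlt
    have h2 : e ∩ f = e := Finset.eq_of_subset_of_card_le Finset.inter_subset_left (by omega)
    have h3 : e ∩ f = f := Finset.eq_of_subset_of_card_le Finset.inter_subset_right (by omega)
    exact hne (h2.symm.trans h3)
  have h2 : e ∩ f ∈ e.powersetCard k :=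
    Finset.mem_powersetCard.2 ⟨Finset.inter_subset_left, by omega⟩
  have h3 : e ∩ f ∈ f.powersetCard k :=
    Finset.mem_powersetCard.2 ⟨Finset.inter_subset_right, by omega⟩
  rw [psc_erase hec, Finset.mem_image] at h2
  rw [psc_erase hfc, Finset.mem_image] at h3
  obtain ⟨a, ha, ha'⟩ := h2
  obtain ⟨b, hb, hb'⟩ := h3
  have hab : a ≠ b := by
    rintro rfl
    apply hne
    rw [← Finset.insert_erase ha, ← Finset.insert_erase hb, ha', hb']
  obtain ⟨C, hC, h4, h5⟩ := hc a ((hE e he).1 ha) b ((hE f hf).1 hb) hab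
  refine hS (e ∩ f) a b hab (by rw [← ha']; simp) (by rw [← hb']; simp) ?_ ?_ C hC h4 h5
  · rw [← ha', Finset.insert_erase ha]; exact he
  · rw [← hb', Finset.insert_erase hb]; exact hf

/-- shift weight `s` from `u` to `v` -/
noncomputable def shf (x : α → ℝ) (u v : α) (s : ℝ) : α → ℝ :=
  fun w => if w = u then x u - s else if w = v then x v + s else x w

lemma shf_u (x : α → ℝ) (u v : α) (s : ℝ) : shf x u v s u = x u - s := by simp [shf]
lemma shf_v (x : α → ℝ) {u v : α} (h : u ≠ v) (s : ℝ) : shf x u v s v = x v + s := by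
  simp [shf, h.symm]
lemma shf_o (x : α → ℝ) {u v w : α} (h : w ≠ u) (h' : w ≠ v) (s : ℝ) : shf x u v s w = x w := by
  simp [shf, h, h']

lemma shf_nonneg {x : α → ℝ} (hx : ∀ v, 0 ≤ x v) {u v : α} {s : ℝ} (hs : 0 ≤ s) (hs' : s ≤ x u) :
    ∀ w, 0 ≤ shf x u v s w := by
  intro w; unfold shf
  split_ifs
  · linarith
  · have := hx v; linarith
  · exact hx w

lemma sum_shf (x : α → ℝ) {u v : α} (h : u ≠ v) (s : ℝ) {T : Finset α} (hu : u ∈ T) (hv : v ∈ T) :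
    ∑ w ∈ T, shf x u v s w = ∑ w ∈ T, x w := by
  have hv' : v ∈ T.erase u := Finset.mem_erase.2 ⟨h.symm, hv⟩
  rw [← Finset.add_sum_erase T _ hu, ← Finset.add_sum_erase T x hu,
    ← Finset.add_sum_erase _ _ hv', ← Finset.add_sum_erase _ x hv', shf_u, shf_v x h]
  rw [Finset.sum_congr rfl (g := x)]
  · ring
  · intro w hw
    simp only [Finset.mem_erase] at hw
    exact shf_o x hw.2.1 hw.1 s

lemma PE_two (E : Finset (Finset α)) (x : α → ℝ) {u v : α} (h : u ≠ v) :
    PE E x = PE ((E.filter (u ∉ ·)).filter (v ∉ ·)) x + x v * Dg (E.filter (u ∉ ·)) x {v}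
      + x u * (Dg (E.filter (v ∉ ·)) x {u} + x v * Dg E x {u, v}) := by
  rw [PE_split E x u, PE_split (E.filter (u ∉ ·)) x v,
    Dg_split E x (q := {u}) (u := v) (by simpa using h.symm), Finset.pair_comm u v]

lemma D_two (E : Finset (Finset α)) (x : α → ℝ) {u v : α} (h : u ≠ v) :
    Dg E x {u} = Dg (E.filter (v ∉ ·)) x {u} + x v * Dg E x {u, v} := by
  rw [Dg_split E x (q := {u}) (u := v) (by simpa using h.symm), Finset.pair_comm u v]

lemma PE_shf (E : Finset (Finset α)) (x : α → ℝ) {u v : α} (h : u ≠ v) (s : ℝ) :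
    PE E (shf x u v s) = PE E x + s * (Dg E x {v} - Dg E x {u}) - s^2 * Dg E x {u, v} := by
  rw [PE_two E (shf x u v s) h, PE_two E x h, D_two E x h, D_two E x h.symm, shf_u, shf_v x h]
  rw [PE_congr (E := (E.filter (u ∉ ·)).filter (v ∉ ·)) (x := shf x u v s) (y := x),
    Dg_congr (E := E.filter (u ∉ ·)) (x := shf x u v s) (y := x),
    Dg_congr (E := E.filter (v ∉ ·)) (x := shf x u v s) (y := x),
    Dg_congr (E := E) (x := shf x u v s) (y := x), Finset.pair_comm v u]
  · ring
  · intro e he hq w hw hw'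
    simp at hw'
    exact shf_o x hw'.1 hw'.2 s
  · intro e he hq w hw hw'
    simp at he hw'
    exact shf_o x hw' (by rintro rfl; exact he.2 hw) s
  · intro e he hq w hw hw'
    simp at he hw'
    exact shf_o x (by rintro rfl; exact he.2 hw) hw' s
  · intro e he w hw
    simp at he
    exact shf_o x (by rintro rfl; exact he.1.2 hw) (by rintro rfl; exact he.2 hw) s

lemma Dg_pair_zero {E : Finset (Finset α)} (x : α → ℝ) {u v : α}
    (h : ∀ e ∈ E, u ∈ e → v ∈ e → False) : Dg E x {u, v} = 0 := by
  unfold Dg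
  rw [Finset.filter_false_of_mem]
  · simp
  · intro e he h'
    rw [Finset.insert_subset_iff, Finset.singleton_subset_iff] at h'
    exact h e he h'.1 h'.2

lemma PE_zero_at (E : Finset (Finset α)) {x : α → ℝ} {u : α} (h : x u = 0) :
    PE E x = PE (E.filter (u ∉ ·)) x := by rw [PE_split E x u, h]; ring

lemma exists_max (T : Finset α) (E : Finset (Finset α)) {y : α → ℝ}
    (hy : ∀ v, 0 ≤ y v) (hy1 : ∑ v ∈ T, y v = 1) (hE : ∀ e ∈ E, e ⊆ T) :
    ∃ x : α → ℝ, (∀ v, 0 ≤ x v) ∧ ∑ v ∈ T, x v = 1 ∧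
      ∀ z : α → ℝ, (∀ v, 0 ≤ z v) → ∑ v ∈ T, z v = 1 → PE E z ≤ PE E x := by
  let K : Set (α → ℝ) := {x | (∀ v, 0 ≤ x v) ∧ (∀ v, v ∉ T → x v = 0) ∧ ∑ v ∈ T, x v = 1}
  have hres : ∀ z : α → ℝ, (∀ v, 0 ≤ z v) → ∑ v ∈ T, z v = 1 →
      (fun v => if v ∈ T then z v else 0) ∈ K := by
    intro z hz hz1
    refine ⟨fun v => ?_, fun v hv => by simp [hv], ?_⟩
    · dsimp only; split_ifs; exacts [hz v, le_rfl]
    · rw [← hz1]; exact Finset.sum_congr rfl fun v hv => by simp [hv]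
  have hK : IsCompact K := by
    have h1 : IsCompact (Set.pi Set.univ fun _ : α => Set.Icc (0:ℝ) 1) :=
      isCompact_univ_pi fun _ => isCompact_Icc
    apply h1.of_isClosed_subset
    · have c1 : IsClosed {x : α → ℝ | ∀ v, 0 ≤ x v} := by
        rw [Set.setOf_forall]
        exact isClosed_iInter fun v => isClosed_le continuous_const (continuous_apply v)
      have c2 : IsClosed {x : α → ℝ | ∀ v, v ∉ T → x v = 0} := by
        rw [Set.setOf_forall]
        refine isClosed_iInter fun v => ?_
        by_cases hv : v ∈ T
        · simp [hv]
        · simp only [hv, not_false_eq_true, true_imp_iff]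
          exact isClosed_eq (continuous_apply v) continuous_const
      have c3 : IsClosed {x : α → ℝ | ∑ v ∈ T, x v = 1} :=
        isClosed_eq (by fun_prop) continuous_const
      exact c1.inter (c2.inter c3)
    · intro x hx v _
      refine ⟨hx.1 v, ?_⟩
      by_cases hv : v ∈ T
      · rw [← hx.2.2]; exact Finset.single_le_sum (fun w _ => hx.1 w) hv
      · rw [hx.2.1 v hv]; norm_num
  obtain ⟨x, hx, hmax⟩ := hK.exists_isMaxOn ⟨_, hres y hy hy1⟩
    (f := fun x => PE E x) (Continuous.continuousOn (by unfold PE wt; fun_prop))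
  refine ⟨x, hx.1, hx.2.2, fun z hz hz1 => ?_⟩
  have := hmax (hres z hz hz1)
  simp only [Set.mem_setOf_eq] at this
  refine le_trans (le_of_eq ?_) this
  apply PE_congr
  intro e he v hv
  simp [hE e he hv]

lemma r_pos {r : ℕ} (hr : r = 5 ∨ r = 6) : 0 < (r:ℝ) := by
  rcases hr with rfl | rfl <;> norm_num
lemma r_lam {r : ℕ} (hr : r = 5 ∨ r = 6) : r * lam r = rlam r := by
  have := r_pos hr
  unfold lam; field_simp
lemma gp_pos : 0 < gp := by norm_num [gp]

theorem lagr {r : ℕ} (hr : r = 5 ∨ r = 6) (n : ℕ) : ∀ (T : Finset α) (_ : T.card = n)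
    (E : Finset (Finset α)), Unif r T E → SF E → ∀ x : α → ℝ, (∀ v, 0 ≤ x v) → ∑ v ∈ T, x v = 1 →
    PE E x ≤ lam r ∧ (T.card < r + 6 → PE E x ≤ lam r - gp / r) := by
  induction n with
  | zero =>
    intro T hT E hE hS x hx h1
    rw [Finset.card_eq_zero] at hT
    subst hT; simp at h1
  | succ n ih =>
    intro T hT E hE hS y hy hy1
    obtain ⟨x, hx, h1, hmax⟩ := exists_max T E hy hy1 (fun e he => (hE e he).1)
    suffices h : PE E x ≤ lam r ∧ (T.card < r + 6 → PE E x ≤ lam r - gp / r) from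
      ⟨(hmax y hy hy1).trans h.1, fun h' => (hmax y hy hy1).trans (h.2 h')⟩
    clear hy hy1 y
    have red : ∀ u ∈ T, ∀ z : α → ℝ, (∀ v, 0 ≤ z v) → ∑ v ∈ T, z v = 1 → z u = 0 →
        PE E x ≤ PE E z → PE E x ≤ lam r ∧ (T.card < r + 6 → PE E x ≤ lam r - gp / r) := by
      intro u hu z hz hz1 hu0 hle
      have hc : (T.erase u).card = n := by rw [Finset.card_erase_of_mem hu]; omega
      have := ih (T.erase u) hc (E.filter (u ∉ ·)) (unif_filter_notMem hE u)
        (SF_mono hS (Finset.filter_subset _ _)) z hz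
        (by rw [← hz1, ← Finset.add_sum_erase T z hu, hu0, zero_add])
      rw [← PE_zero_at E hu0] at this
      exact ⟨hle.trans this.1, fun h => hle.trans (this.2 (by omega))⟩
    by_cases h0 : ∃ v ∈ T, x v = 0
    · obtain ⟨v, hv, hv0⟩ := h0
      exact red v hv x hx h1 hv0 le_rfl
    push Not at h0
    have hpos : ∀ v ∈ T, 0 < x v := fun v hv => lt_of_le_of_ne (hx v) (h0 v hv).symm
    by_cases hcov : ∀ u ∈ T, ∀ v ∈ T, u ≠ v → ∃ e ∈ E, u ∈ e ∧ v ∈ e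
    swap
    · push Not at hcov
      obtain ⟨u, hu, v, hv, huv, hno⟩ := hcov
      have key : ∀ u ∈ T, ∀ v ∈ T, u ≠ v → (∀ e ∈ E, u ∈ e → v ∉ e) → Dg E x {u} ≤ Dg E x {v} →
          PE E x ≤ lam r ∧ (T.card < r + 6 → PE E x ≤ lam r - gp / r) := by
        intro u hu v hv huv hno hD
        apply red u hu (shf x u v (x u)) (shf_nonneg hx (hx u) le_rfl)
        · rw [sum_shf x huv _ hu hv, h1]
        · rw [shf_u]; ring
        · rw [PE_shf E x huv, Dg_pair_zero x (fun e he h1 h2 => hno e he h1 h2)]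
          have := hx u
          nlinarith
      rcases le_total (Dg E x {u}) (Dg E x {v}) with h | h
      · exact key u hu v hv huv hno h
      · exact key v hv u hu huv.symm (fun e he h1 h2 => hno e he h2 h1) h
    · obtain ⟨k, hk⟩ : ∃ k, r = k + 1 := ⟨r - 1, by omega⟩
      have hP : PSt (r-1) E := by
        subst hk; exact PSt_of_SF hE hS hcov
      have kkt : ∀ u ∈ T, ∀ v ∈ T, Dg E x {v} ≤ Dg E x {u} := by
        intro u hu v hv
        rcases eq_or_ne u v with rfl | huv
        · exact le_rfl
        by_contra hlt
        push Not at hlt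
        set d := Dg E x {v} - Dg E x {u} with hd
        set c := Dg E x {u, v} with hc
        have hc0 : 0 ≤ c := Dg_nonneg hx _ _
        have hd0 : 0 < d := by linarith
        set s := min (x u) (d / (2 * (c + 1))) with hs
        have hs0 : 0 < s := lt_min (hpos u hu) (by positivity)
        have hs1 : s * (2 * (c+1)) ≤ d := by
          rw [← le_div_iff₀ (by positivity)]; exact min_le_right _ _
        have := hmax (shf x u v s) (shf_nonneg hx hs0.le (min_le_left _ _))
          (by rw [sum_shf x huv _ hu hv, h1])
        rw [PE_shf E x huv, ← hd, ← hc] at this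
        nlinarith
      have hall : ∀ v ∈ T, Dg E x {v} = r * PE E x := by
        intro v hv
        rw [← sum_x_Dg hE x]
        rw [Finset.sum_congr rfl (g := fun w => x w * Dg E x {v})
          (fun w hw => by rw [le_antisymm (kkt v hv w hw) (kkt w hw v hv)]),
          ← Finset.sum_mul, h1, one_mul]
      have hsum : ∑ v ∈ T, Dg E x {v} = T.card * (r * PE E x) := by
        rw [Finset.sum_congr rfl hall]; simp
      have hT0 : (0:ℝ) < T.card := by rw [hT]; positivity
      have hr0 := r_pos hr
      have hg := gp_pos
      by_cases hm : T.card = r + 6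
      · have := FBm hr hE hP hx h1 hm
        rw [hsum] at this
        have := le_of_mul_le_mul_left this hT0
        rw [← r_lam hr] at this
        exact ⟨le_of_mul_le_mul_left this hr0, fun h => by omega⟩
      · have := FB hr hE hP hx h1 hm
        rw [hsum] at this
        have := le_of_mul_le_mul_left this hT0
        have h3 : PE E x ≤ lam r - gp / r := by
          unfold lam
          rw [← sub_div, le_div_iff₀ hr0]; linarith
        refine ⟨h3.trans ?_, fun _ => h3⟩
        have : 0 < gp / r := by positivity
        linarith

theorem lagr_le {r : ℕ} (hr : r = 5 ∨ r = 6) {T : Finset α} {E : Finset (Finset α)}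
    (hE : Unif r T E) (hS : SF E) {x : α → ℝ} (hx : ∀ v, 0 ≤ x v) (h1 : ∑ v ∈ T, x v = 1) :
    PE E x ≤ lam r := (lagr hr _ T rfl E hE hS x hx h1).1

/-- homogeneous version -/
theorem lagr_hom {r : ℕ} (hr : r = 5 ∨ r = 6) {T : Finset α} {E : Finset (Finset α)}
    (hE : Unif r T E) (hS : SF E) {x : α → ℝ} (hx : ∀ v, 0 ≤ x v) {c : ℝ}
    (hc : ∑ v ∈ T, x v = c) (ht : 0 < c) :
    PE E x ≤ lam r * c ^ r ∧ (T.card < r + 6 → PE E x ≤ (lam r - gp / r) * c ^ r) := by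
  have h := lagr hr _ T rfl E hE hS (fun v => c⁻¹ * x v) (fun v => mul_nonneg (by positivity) (hx v))
    (by rw [← Finset.mul_sum, hc]; field_simp)
  rw [PE_smul hE] at h
  have e : PE E x = (c⁻¹ ^ r * PE E x) * c ^ r := by
    rw [inv_pow]; field_simp
  rw [e]
  constructor
  · exact mul_le_mul_of_nonneg_right h.1 (by positivity)
  · intro hT
    exact mul_le_mul_of_nonneg_right (h.2 hT) (by positivity)

end Lagr
end DensityCH
end

section
namespace DensityCH
open Finset
set_option linter.all false

section Low
variable {α : Type*} [DecidableEq α]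

lemma pow_bern {r : ℕ} (hr : r = 5 ∨ r = 6) {s : ℝ} (h0 : 0 ≤ s) (h1 : s ≤ 1) :
    (1 - s)^r ≤ 1 - r * s + 15 * s^2 := by
  rcases hr with rfl | rfl
  · have : 0 ≤ s^3 * (10 - 5*s + s^2) + 5 * s^2 := by
      have : 0 ≤ s^3 := by positivity
      have : 0 ≤ 10 - 5*s + s^2 := by nlinarith
      positivity
    push_cast; nlinarith
  · have : 0 ≤ s^3 * (20 - 15*s + 6*s^2 - s^3) := by
      have : 0 ≤ s^3 := by positivity
      have : 0 ≤ s^2*(1-s) := mul_nonneg (by positivity) (by linarith)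
      have : 0 ≤ 20 - 15*s + 6*s^2 - s^3 := by nlinarith
      positivity
    push_cast; nlinarith

lemma lam_pos {r : ℕ} (hr : r = 5 ∨ r = 6) : 0 < lam r := by
  unfold lam; rcases hr with rfl | rfl
  · rw [rlam5]; norm_num
  · rw [rlam6]; norm_num
lemma rlam_pos {r : ℕ} (hr : r = 5 ∨ r = 6) : 0 < rlam r := by
  rcases hr with rfl | rfl
  · rw [rlam5]; norm_num
  · rw [rlam6]; norm_num
lemma rlam_lt {r : ℕ} (hr : r = 5 ∨ r = 6) : rlam r < 1/100 := by
  rcases hr with rfl | rfl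
  · rw [rlam5]; norm_num
  · rw [rlam6]; norm_num
lemma lam_le {r : ℕ} (hr : r = 5 ∨ r = 6) : lam r ≤ 1/100 := by
  have := r_lam hr; have := rlam_lt hr
  have : (1:ℝ) ≤ r := by rcases hr with rfl | rfl <;> norm_num
  have := lam_pos hr
  nlinarith

lemma low {r : ℕ} (hr : r = 5 ∨ r = 6) {T : Finset α} {E : Finset (Finset α)}
    (hE : Unif r T E) (hS : SF E) {x : α → ℝ} (hx : ∀ v, 0 ≤ x v) (h1 : ∑ v ∈ T, x v = 1)
    {δ γ : ℝ} (hP : lam r - δ ≤ PE E x) {u : α} (hu : u ∈ T) (hD : Dg E x {u} ≤ rlam r - γ)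
    (hγ : 0 < γ) (hγ1 : γ < 1) (hδ : δ < γ^2/60) : x u * γ ≤ 2 * δ := by
  have key : ∀ s, 0 ≤ s → s ≤ x u → s < 1 → s * γ ≤ δ + 15 * s^2 := by
    intro s hs hsu hs1
    let y : α → ℝ := fun w => if w = u then x u - s else x w
    have hy : ∀ v, 0 ≤ y v := by
      intro v; dsimp only [y]; split_ifs; linarith; exact hx v
    have hyu : y u = x u - s := by simp [y]
    have hyo : ∀ w, w ≠ u → y w = x w := by intro w hw; simp [y, hw]
    have hsum : ∑ v ∈ T, y v = 1 - s := by
      rw [← h1, ← Finset.add_sum_erase T y hu, ← Finset.add_sum_erase T x hu, hyu,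
        Finset.sum_congr rfl (g := x) (fun w hw => hyo w (Finset.mem_erase.1 hw).1)]
      ring
    have hp := (lagr_hom hr hE hS hy hsum (by linarith)).1
    have h2 : PE E y = PE E x - s * Dg E x {u} := by
      rw [PE_split E y u, PE_split E x u, PE_congr (E := E.filter (u ∉ ·)) (x := y) (y := x),
        Dg_congr (E := E) (x := y) (y := x), hyu]
      · ring
      · intro e he hq w hw hw'
        exact hyo w (by simpa using hw')
      · intro e he w hw
        rw [Finset.mem_filter] at he
        exact hyo w (by rintro rfl; exact he.2 hw)
    have h3 := pow_bern hr hs hs1.le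
    have h4 := r_lam hr
    have h5 := lam_pos hr
    have h6 := lam_le hr
    have h7 : s * Dg E x {u} ≤ s * (rlam r - γ) := mul_le_mul_of_nonneg_left hD hs
    have h8 : lam r * (1-s)^r ≤ lam r * (1 - r * s + 15 * s^2) := mul_le_mul_of_nonneg_left h3 h5.le
    have h9 : lam r * (15 * s^2) ≤ 1 * (15 * s^2) :=
      mul_le_mul_of_nonneg_right (by linarith) (by positivity)
    have h10 : lam r * (1 - r * s + 15 * s^2) = lam r - s * rlam r + lam r * (15*s^2) := by
      rw [← h4]; ring
    nlinarith
  by_cases hxu : γ / 30 ≤ x u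
  · have := key (γ/30) (by positivity) hxu (by linarith)
    nlinarith
  · push Not at hxu
    have := key (x u) (hx u) le_rfl (by linarith)
    have h0 := hx u
    nlinarith

/-- removing a vertex of few-vertex families gives a gap -/
lemma low_all {r : ℕ} (hr : r = 5 ∨ r = 6) {T : Finset α} {E : Finset (Finset α)}
    (hE : Unif r T E) (hS : SF E) (hT : T.card ≤ r + 6)
    {x : α → ℝ} (hx : ∀ v, 0 ≤ x v) (h1 : ∑ v ∈ T, x v = 1)
    {γ : ℝ} (hγ : 0 < γ) (hγ1 : γ < 1) (hP : lam r - γ^2/10^8 ≤ PE E x) :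
    ∀ u ∈ T, rlam r - γ < Dg E x {u} := by
  intro u hu
  by_contra hD
  push Not at hD
  have hl := low hr hE hS hx h1 hP hu hD hγ hγ1 (by have : 0 < γ^2 := by positivity
                                                    linarith)
  have hxu : x u ≤ 2 * γ / 10^8 := by
    have : x u * γ ≤ (2 * γ / 10^8) * γ := by nlinarith
    exact le_of_mul_le_mul_right this hγ
  have hs : ∑ v ∈ T.erase u, x v = 1 - x u := by
    rw [← h1, ← Finset.add_sum_erase T x hu]; ring
  have hc : (T.erase u).card < r + 6 := by
    rw [Finset.card_erase_of_mem hu]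
    have := Finset.card_pos.2 ⟨u, hu⟩; omega
  have h0 := hx u
  have hp := (lagr_hom hr (unif_filter_notMem hE u) (SF_mono hS (Finset.filter_subset _ _)) hx hs
    (by linarith)).2 hc
  have h2 := PE_split E x u
  have h3 : x u * Dg E x {u} ≤ x u * (1/100) :=
    mul_le_mul_of_nonneg_left (by have := rlam_lt hr; linarith) h0
  have hg : (1:ℝ)/10^7 ≤ gp / r := by
    unfold gp; rcases hr with rfl | rfl <;> norm_num
  have hpw : (1 - x u)^r ≤ 1 := pow_le_one₀ (by linarith) (by linarith)
  have hpw0 : 0 ≤ (1 - x u)^r := pow_nonneg (by linarith) _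
  have : (lam r - gp/r) * (1 - x u)^r ≤ lam r - gp / r := by
    have : 0 ≤ lam r - gp / r := by
      unfold lam gp; rcases hr with rfl | rfl
      · rw [rlam5]; norm_num
      · rw [rlam6]; norm_num
    nlinarith
  nlinarith

lemma es_two (T : Finset α) {x : α → ℝ} (h1 : ∑ v ∈ T, x v = 1) :
    2 * es T 2 x = 1 - ∑ v ∈ T, x v ^ 2 := by
  have h := es_handshake T 1 x
  norm_num at h
  rw [← h]
  have : ∀ v ∈ T, x v * es (T.erase v) 1 x = x v - x v ^ 2 := by
    intro v hv
    have := Finset.add_sum_erase T x hv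
    rw [es_one]
    rw [h1] at this
    rw [show ∑ w ∈ T.erase v, x w = 1 - x v by linarith]; ring
  rw [Finset.sum_congr rfl this, Finset.sum_sub_distrib, h1]

lemma qmac {r : ℕ} (hr : r = 5 ∨ r = 6) {T : Finset α} (hT : T.card = r + 6)
    {x : α → ℝ} (hx : ∀ v, 0 ≤ x v) (h1 : ∑ v ∈ T, x v = 1)
    {ε : ℝ} (hes : (r + 6) * rlam r - ε ≤ es T (r-1) x) :
    ∑ v ∈ T, (x v - 1/((r:ℝ)+6))^2 ≤ 500 * ε := by
  have h2 := es_two T h1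
  have hsq : ∑ v ∈ T, (x v - 1/((r:ℝ)+6))^2 = ∑ v ∈ T, x v ^ 2 - 1/((r:ℝ)+6) := by
    have : ∀ v ∈ T, (x v - 1/((r:ℝ)+6))^2 = x v ^2 - 2/((r:ℝ)+6) * x v + (1/((r:ℝ)+6))^2 := by
      intro v _; ring
    rw [Finset.sum_congr rfl this, Finset.sum_add_distrib, Finset.sum_sub_distrib, ← Finset.mul_sum,
      h1]
    simp [hT]
    field_simp; ring
  have hnn : 0 ≤ ∑ v ∈ T, (x v - 1/((r:ℝ)+6))^2 := Finset.sum_nonneg fun v _ => sq_nonneg _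
  rw [hsq] at hnn ⊢
  have s2 := maclaurin_step (T := T) hx 2
  have s3 := maclaurin_step (T := T) hx 3
  have s4 := maclaurin_step (T := T) hx 4
  rw [h1, hT] at s2 s3 s4
  rcases hr with rfl | rfl
  · rw [rlam5] at hes; norm_num at *; nlinarith
  · rw [rlam6] at hes; norm_num at *; nlinarith

lemma near_unif {r : ℕ} (hr : r = 5 ∨ r = 6) {T : Finset α} (hT : T.card = r + 6)
    {x : α → ℝ} (hx : ∀ v, 0 ≤ x v) (h1 : ∑ v ∈ T, x v = 1)
    {ε : ℝ} (hε : 0 ≤ ε) (hes : (r + 6) * rlam r - ε^2/500 ≤ es T (r-1) x) :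
    ∀ v ∈ T, |x v - 1/((r:ℝ)+6)| ≤ ε := by
  intro v hv
  have h := qmac hr hT hx h1 hes
  have h3 : (x v - 1/((r:ℝ)+6))^2 ≤ ε^2 := by
    have := Finset.single_le_sum (f := fun v => (x v - 1/((r:ℝ)+6))^2)
      (fun w _ => sq_nonneg _) hv
    linarith
  exact abs_le_of_sq_le_sq h3 hε

lemma near_unif_PSt {r : ℕ} (hr : r = 5 ∨ r = 6) {T : Finset α} (hT : T.card = r + 6)
    {E : Finset (Finset α)} (hE : Unif r T E) (hP : PSt (r-1) E)
    {x : α → ℝ} (hx : ∀ v, 0 ≤ x v) (h1 : ∑ v ∈ T, x v = 1)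
    {ε γ : ℝ} (hε : 0 ≤ ε) (hD : ∀ v ∈ T, rlam r - γ ≤ Dg E x {v}) (hγ : γ ≤ ε^2/6000) :
    (∀ v ∈ T, |x v - 1/((r:ℝ)+6)| ≤ ε) ∧ PE (T.powersetCard (r-1) \ shd (r-1) E) x ≤ 12 * γ := by
  obtain ⟨k, hk⟩ : ∃ k, r = k + 1 := ⟨r - 1, by omega⟩
  have hs : ∑ v ∈ T, Dg E x {v} + PE (T.powersetCard (r-1) \ shd (r-1) E) x = es T (r-1) x := by
    subst hk; exact sum_Dg_unc hE hP x
  have h0 := PE_nonneg hx (T.powersetCard (r-1) \ shd (r-1) E)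
  have hlow : (r + 6) * (rlam r - γ) ≤ ∑ v ∈ T, Dg E x {v} := by
    have := Finset.card_nsmul_le_sum T _ _ hD
    rw [hT] at this
    simpa using this
  have hr6 : (r:ℝ) ≤ 6 := by rcases hr with rfl | rfl <;> norm_num
  have hγ' : (r+6) * γ ≤ ε^2/500 := by
    have : (0:ℝ) ≤ r + 6 := by positivity
    nlinarith
  refine ⟨near_unif hr hT hx h1 hε (by nlinarith), ?_⟩
  have hm : es T (r-1) x ≤ (r+6) * rlam r := by
    have := maclaurin (T := T) hx (r-1)
    rw [h1, hT] at this
    rcases hr with rfl | rfl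
    · rw [rlam5]; norm_num [Nat.choose] at *; linarith
    · rw [rlam6]; norm_num [Nat.choose] at *; linarith
  by_cases hγ0 : 0 ≤ γ
  · nlinarith
  · nlinarith
end Low
end DensityCH
end

section
namespace DensityCH
open Finset
set_option linter.all false

section Clean
variable {α : Type*} [DecidableEq α]

lemma Dg_insert (F : Finset (Finset α)) (x : α → ℝ) {v : α} {q : Finset α} (hv : v ∉ q) :
    Dg F x (insert v q) = Dg (lk F v) x q := by
  unfold Dg
  symm
  refine Finset.sum_bij' (fun s _ => insert v s) (fun e _ => e.erase v) ?_ ?_ ?_ ?_ ?_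
  · intro s hs
    rw [Finset.mem_filter, mem_lk] at hs
    rw [Finset.mem_filter]
    exact ⟨hs.1.2, Finset.insert_subset_insert _ hs.2⟩
  · intro e he
    rw [Finset.mem_filter] at he
    rw [Finset.mem_filter, mem_lk]
    have hve : v ∈ e := he.2 (Finset.mem_insert_self _ _)
    refine ⟨⟨by simp, by rw [Finset.insert_erase hve]; exact he.1⟩, ?_⟩
    intro w hw
    exact Finset.mem_erase.2 ⟨by rintro rfl; exact hv hw, he.2 (Finset.mem_insert_of_mem hw)⟩
  · intro s hs
    rw [Finset.mem_filter, mem_lk] at hs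
    exact Finset.erase_insert hs.1.1
  · intro e he
    rw [Finset.mem_filter] at he
    exact Finset.insert_erase (he.2 (Finset.mem_insert_self _ _))
  · intro s hs
    rw [Finset.mem_filter, mem_lk] at hs
    congr 1
    ext w
    simp only [Finset.mem_sdiff, Finset.mem_insert]
    constructor
    · rintro ⟨h1, h2⟩
      refine ⟨Or.inr h1, ?_⟩
      rintro (rfl | h)
      · exact hs.1.1 h1
      · exact h2 h
    · rintro ⟨h1 | h1, h2⟩
      · exact absurd (Or.inl h1) h2
      · exact ⟨h1, fun h => h2 (Or.inr h)⟩

lemma fam_lb {k : ℕ} {T : Finset α} {x : α → ℝ} (hx : ∀ v, 0 ≤ x v) {η : ℝ} (hη : 0 < η) :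
    ∀ F : Finset (Finset α), Unif k T F → F.Nonempty →
    (∀ e ∈ F, ∀ q ⊆ e, q.card + 1 = k → η ≤ Dg F x q) → η^k / k.factorial ≤ PE F x := by
  induction k generalizing T with
  | zero =>
    rintro F hF ⟨e, he⟩ _
    have : e = ∅ := Finset.card_eq_zero.1 (hF e he).2
    subst this
    have := Finset.single_le_sum (f := wt x) (fun e _ => wt_nonneg hx e) he
    rw [wt_empty] at this
    simpa [PE] using this
  | succ k ih =>
    rintro F hF ⟨e, he⟩ hq
    set U := F.biUnion id with hU
    have hUT : U ⊆ T := by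
      intro v hv
      rw [hU, Finset.mem_biUnion] at hv
      obtain ⟨f, hf, hv⟩ := hv
      exact (hF f hf).1 hv
    have h1 : ∀ v ∈ U, η^k / k.factorial ≤ Dg F x {v} := by
      intro v hv
      rw [hU, Finset.mem_biUnion] at hv
      obtain ⟨f, hf, hv⟩ := hv
      simp only [id] at hv
      rw [Dg_lk]
      apply ih _ (unif_lk hF v)
      · exact ⟨f.erase v, mem_lk.2 ⟨by simp, by rwa [Finset.insert_erase hv]⟩⟩
      · intro s hs q hqs hqc
        rw [mem_lk] at hs
        have hvq : v ∉ q := fun h => hs.1 (hqs h)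
        rw [← Dg_insert F x hvq]
        exact hq _ hs.2 _ (Finset.insert_subset_insert _ hqs)
          (by rw [Finset.card_insert_of_notMem hvq, hqc])
    have h2 : η ≤ ∑ v ∈ U, x v := by
      have hec := (hF e he).2
      obtain ⟨v, hv⟩ : e.Nonempty := Finset.card_pos.1 (by omega)
      refine (hq e he (e.erase v) (Finset.erase_subset _ _)
        (by rw [Finset.card_erase_of_mem hv]; omega)).trans ?_
      unfold Dg
      have hsd : ∀ f ∈ F.filter (e.erase v ⊆ ·), ∃ w, f \ e.erase v = {w} := by
        intro f hf
        rw [Finset.mem_filter] at hf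
        rw [← Finset.card_eq_one, Finset.card_sdiff_of_subset hf.2, (hF f hf.1).2,
          Finset.card_erase_of_mem hv, hec]
        omega
      have hinj : Set.InjOn (fun f => f \ e.erase v) (F.filter (e.erase v ⊆ ·) : Set (Finset α)) := by
        intro f hf g hg h
        have hf := (Finset.mem_filter.1 hf).2
        have hg := (Finset.mem_filter.1 hg).2
        dsimp only at h
        rw [← Finset.sdiff_union_of_subset hf, h, Finset.sdiff_union_of_subset hg]
      rw [← Finset.sum_image (f := wt x) (g := fun f => f \ e.erase v) hinj]
      have : ∑ v ∈ U, x v = ∑ s ∈ U.image (fun w => ({w} : Finset α)), wt x s := by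
        rw [Finset.sum_image (by intro a _ b _ h; simpa using h)]
        simp [wt]
      rw [this]
      apply Finset.sum_le_sum_of_subset_of_nonneg
      · intro s hs
        rw [Finset.mem_image] at hs ⊢
        obtain ⟨f, hf, rfl⟩ := hs
        obtain ⟨w, hw⟩ := hsd f hf
        refine ⟨w, ?_, hw.symm⟩
        rw [hU, Finset.mem_biUnion]
        refine ⟨f, (Finset.mem_filter.1 hf).1, ?_⟩
        have : w ∈ f \ e.erase v := by rw [hw]; simp
        exact (Finset.mem_sdiff.1 this).1
      · intro s _ _; exact wt_nonneg hx s
    have h3 := sum_x_Dg hF x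
    have h4 : ∑ v ∈ U, x v * Dg F x {v} ≤ ∑ v ∈ T, x v * Dg F x {v} :=
      Finset.sum_le_sum_of_subset_of_nonneg hUT
        fun v _ _ => mul_nonneg (hx v) (Dg_nonneg hx _ _)
    have h5 : (∑ v ∈ U, x v) * (η^k / k.factorial) ≤ ∑ v ∈ U, x v * Dg F x {v} := by
      rw [Finset.sum_mul]
      exact Finset.sum_le_sum fun v hv => mul_le_mul_of_nonneg_left (h1 v hv) (hx v)
    have h6 : η * (η^k / k.factorial) ≤ (∑ v ∈ U, x v) * (η^k / k.factorial) :=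
      mul_le_mul_of_nonneg_right h2 (by positivity)
    have h7 : η * (η^k / k.factorial) ≤ ((k+1 : ℕ):ℝ) * PE F x := by linarith
    rw [Nat.factorial_succ]
    push_cast at h7 ⊢
    rw [div_le_iff₀ (by positivity)]
    have h8 : η * (η^k / k.factorial) * k.factorial ≤ ((k+1 : ℝ) * PE F x) * k.factorial :=
      mul_le_mul_of_nonneg_right h7 (by positivity)
    have h9 : η * (η^k / k.factorial) * k.factorial = η^(k+1) := by field_simp; ring
    rw [h9] at h8
    linarith

lemma shd_mono {k : ℕ} {E F : Finset (Finset α)} (h : E ⊆ F) : shd k E ⊆ shd k F := by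
  unfold shd; exact Finset.biUnion_subset_biUnion_of_subset_left _ h

lemma mem_shd {k : ℕ} {E : Finset (Finset α)} {q : Finset α} :
    q ∈ shd k E ↔ ∃ e ∈ E, q ⊆ e ∧ q.card = k := by
  unfold shd; simp [Finset.mem_biUnion, Finset.mem_powersetCard]

lemma cleaning {x : α → ℝ} (hx : ∀ v, 0 ≤ x v) {η : ℝ} (hη : 0 < η) (k : ℕ) (n : ℕ) :
    ∀ E : Finset (Finset α), E.card = n → ∃ E' ⊆ E,
      (∀ e ∈ E', ∀ q ⊆ e, q.card = k → η ≤ Dg E' x q) ∧ PE (E \ E') x ≤ η * PE (shd k E) x := by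
  induction n using Nat.strong_induction_on with
  | _ n ih =>
  intro E hE
  by_cases h : ∀ e ∈ E, ∀ q ⊆ e, q.card = k → η ≤ Dg E x q
  · refine ⟨E, subset_rfl, h, ?_⟩
    rw [Finset.sdiff_self]
    have := PE_nonneg hx (shd k E)
    simp only [PE, Finset.sum_empty] at this ⊢
    positivity
  · push Not at h
    obtain ⟨e, he, q, hqe, hqk, hlt⟩ := h
    set E1 := E.filter (fun f => ¬ q ⊆ f) with hE1
    have hsub : E1 ⊆ E := Finset.filter_subset _ _
    have hss : E1 ⊂ E := Finset.ssubset_iff_subset_ne.2 ⟨hsub, fun h => by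
      rw [← h, hE1, Finset.mem_filter] at he; exact he.2 hqe⟩
    obtain ⟨E', h1, h2, h3⟩ := ih E1.card (by rw [← hE]; exact Finset.card_lt_card hss) E1 rfl
    refine ⟨E', h1.trans hsub, h2, ?_⟩
    have ha : PE (E \ E') x ≤ PE (E.filter (q ⊆ ·)) x + PE (E1 \ E') x := by
      refine le_trans (PE_mono hx ?_) (PE_union_le hx _ _)
      intro f hf
      rw [Finset.mem_sdiff] at hf
      rw [Finset.mem_union, Finset.mem_sdiff, hE1, Finset.mem_filter, Finset.mem_filter]
      tauto
    rw [PE_through] at ha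
    have hb : wt x q + PE (shd k E1) x ≤ PE (shd k E) x := by
      have hq1 : q ∉ shd k E1 := by
        rw [mem_shd]; rintro ⟨f, hf, hqf, _⟩
        exact (Finset.mem_filter.1 hf).2 hqf
      have : PE (insert q (shd k E1)) x = wt x q + PE (shd k E1) x := by
        unfold PE; rw [Finset.sum_insert hq1]
      rw [← this]
      apply PE_mono hx
      rw [Finset.insert_subset_iff]
      exact ⟨mem_shd.2 ⟨e, he, hqe, hqk⟩, shd_mono hsub⟩
    have hc : wt x q * Dg E x q ≤ wt x q * η := mul_le_mul_of_nonneg_left hlt.le (wt_nonneg hx _)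
    nlinarith

lemma small_shd {r : ℕ} {T : Finset α} {x : α → ℝ} (hx : ∀ v, 0 ≤ x v) {η : ℝ} (hη : 0 < η)
    {B : Finset (Finset α)} (hB : Unif (r+1) T B) (hlt : PE B x < η^(r+1) / (r+1).factorial) :
    PE B x ≤ η * PE (shd r B) x := by
  obtain ⟨E', h1, h2, h3⟩ := cleaning hx hη r _ B rfl
  have : E' = ∅ := by
    by_contra hne
    have := fam_lb hx hη E' (unif_mono hB h1) (Finset.nonempty_iff_ne_empty.2 hne)
      (fun e he q hq hc => h2 e he q hq (by omega))
    have := PE_mono hx h1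
    linarith
  rw [this, Finset.sdiff_empty] at h3
  exact h3
end Clean

section Steiner
variable {ι : Type*} [Fintype ι] [DecidableEq ι]

/-- Steiner systems `S(r-1,r,r+6)` -/
structure St (r : ℕ) (W : Finset (Finset ι)) : Prop where
  ci : Fintype.card ι = r + 6
  ce : ∀ e ∈ W, e.card = r
  ex : ∀ S : Finset ι, S.card = r - 1 → ∃! e, e ∈ W ∧ S ⊆ e

variable {r : ℕ} {W : Finset (Finset ι)}

lemma St.unif (h : St r W) : Unif r Finset.univ W := fun e he => ⟨Finset.subset_univ _, h.ce e he⟩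

lemma St.pst (h : St r W) : PSt (r-1) W := by
  intro e he f hf hc
  obtain ⟨S, hS, hS'⟩ := Finset.exists_subset_card_eq hc
  obtain ⟨g, _, hg⟩ := h.ex S hS'
  rw [hg e ⟨he, hS.trans Finset.inter_subset_left⟩, hg f ⟨hf, hS.trans Finset.inter_subset_right⟩]

lemma St.eq_of (h : St r W) (hr : 0 < r) {S : Finset ι} {a b : ι} (ha : a ∉ S) (hb : b ∉ S)
    (ha' : insert a S ∈ W) (hb' : insert b S ∈ W) : a = b := by
  have hc := h.ce _ ha'
  rw [Finset.card_insert_of_notMem ha] at hc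
  have := h.pst _ ha' _ hb' (by
    have : S.card ≤ (insert a S ∩ insert b S).card := Finset.card_le_card (by
      intro w hw; simp [hw])
    omega)
  have h2 : a ∈ insert b S := this ▸ Finset.mem_insert_self a S
  rw [Finset.mem_insert] at h2
  tauto

lemma St.sf (h : St r W) (hr : 0 < r) : SF W := fun S a b hab ha hb ha' hb' _ _ _ _ =>
  hab (h.eq_of hr ha hb ha' hb')

lemma St.compl (h : St r W) (hr : 0 < r) {S : Finset ι} (hS : S.card = r - 1) :
    ∃ i, i ∉ S ∧ insert i S ∈ W := by
  obtain ⟨e, ⟨he, hSe⟩, _⟩ := h.ex S hS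
  have hc := h.ce e he
  have : (e \ S).card = 1 := by rw [Finset.card_sdiff_of_subset hSe]; omega
  obtain ⟨i, hi⟩ := Finset.card_eq_one.1 this
  have hi' : i ∈ e \ S := by rw [hi]; simp
  rw [Finset.mem_sdiff] at hi'
  refine ⟨i, hi'.2, ?_⟩
  convert he
  rw [Finset.insert_eq, ← hi, Finset.sdiff_union_of_subset hSe]

lemma St.near (hr : r = 5 ∨ r = 6) (h : St r W) {a : ι → ℝ} (ha : ∀ i, 0 ≤ a i) (h1 : ∑ i, a i = 1)
    {η : ℝ} (hη : 0 < η) (hη1 : η ≤ 1) (hP : lam r - (η^2/6000)^2/10^8 ≤ PE W a) :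
    ∀ i, |a i - 1/((r:ℝ)+6)| ≤ η := by
  have hr0 : 0 < r := by omega
  have hm : (Finset.univ : Finset ι).card = r + 6 := h.ci
  have hg : 0 < η^2/6000 := by positivity
  have hl := low_all hr h.unif (h.sf hr0) hm.le ha h1 hg
    (by have : η^2 ≤ 1 := pow_le_one₀ hη.le hη1
        linarith) hP
  intro i
  exact (near_unif_PSt hr hm h.unif h.pst ha h1 hη.le (fun v hv => (hl v hv).le) le_rfl).1 i
    (Finset.mem_univ i)

/-- the degree of the design -/
def dW (r : ℕ) : ℕ := if r = 5 then 30 else 66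

lemma rlam_dW (hr : r = 5 ∨ r = 6) : rlam r = dW r * (1/((r:ℝ)+6))^(r-1) := by
  rcases hr with rfl | rfl
  · rw [rlam5]; norm_num [dW]
  · rw [rlam6]; norm_num [dW]

lemma St.deg (hr : r = 5 ∨ r = 6) (h : St r W) (i : ι) : (lk W i).card = dW r := by
  obtain ⟨k, hk⟩ : ∃ k, r = k + 2 := ⟨r - 2, by omega⟩
  subst hk
  have hu : Unif (k+1) (Finset.univ.erase i) (lk W i) := unif_lk h.unif i
  have hp : PSt k (lk W i) := PSt_lk (by simpa using h.pst) i
  have h1 := card_shd hu hp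
  have h2 : shd k (lk W i) = (Finset.univ.erase i).powersetCard k := by
    apply subset_antisymm (shd_sub hu)
    intro S hS
    rw [Finset.mem_powersetCard] at hS
    have hiS : i ∉ S := fun hh => by simpa using hS.1 hh
    obtain ⟨e, ⟨he, hSe⟩, _⟩ := h.ex (insert i S) (by
      rw [Finset.card_insert_of_notMem hiS, hS.2]; omega)
    rw [Finset.insert_subset_iff] at hSe
    exact mem_shd.2 ⟨e.erase i, mem_lk.2 ⟨by simp, by rwa [Finset.insert_erase hSe.1]⟩,
      Finset.subset_erase.2 ⟨hSe.2, hiS⟩, hS.2⟩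
  rw [h2, Finset.card_powersetCard, Finset.card_erase_of_mem (Finset.mem_univ i), Finset.card_univ,
    h.ci] at h1
  rcases hr with hk | hk
  · have : k = 3 := by omega
    subst this; norm_num [Nat.choose, dW] at h1 ⊢; omega
  · have : k = 4 := by omega
    subst this; norm_num [Nat.choose, dW] at h1 ⊢; omega

end Steiner

section Blow
variable {α ι : Type*} [DecidableEq α] [DecidableEq ι]

lemma wt_sub {x y : α → ℝ} (hx : ∀ v, 0 ≤ x v) (hx1 : ∀ v, x v ≤ 1) (hy : ∀ v, 0 ≤ y v)
    (hy1 : ∀ v, y v ≤ 1) {η : ℝ} {s : Finset α} (h : ∀ v ∈ s, |x v - y v| ≤ η) :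
    |wt x s - wt y s| ≤ s.card * η := by
  induction s using Finset.induction_on with
  | empty => simp [wt_empty]
  | insert v s hv ih =>
    rw [wt_insert hv, wt_insert hv, Finset.card_insert_of_notMem hv]
    have h1 := ih fun w hw => h w (Finset.mem_insert_of_mem hw)
    have h2 := h v (Finset.mem_insert_self _ _)
    have e : x v * wt x s - y v * wt y s = x v * (wt x s - wt y s) + (x v - y v) * wt y s := by ring
    rw [e]
    refine (abs_add_le _ _).trans ?_
    rw [abs_mul, abs_mul, abs_of_nonneg (hx v), abs_of_nonneg (wt_nonneg hy s)]
    have h3 : wt y s ≤ 1 := Finset.prod_le_one (fun w _ => hy w) (fun w _ => hy1 w)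
    have h4 := wt_nonneg hy s
    have a1 : x v * |wt x s - wt y s| ≤ 1 * |wt x s - wt y s| :=
      mul_le_mul_of_nonneg_right (hx1 v) (abs_nonneg _)
    have a2 : |x v - y v| * wt y s ≤ |x v - y v| * 1 :=
      mul_le_mul_of_nonneg_left h3 (abs_nonneg _)
    push_cast
    linarith

/-- part weights -/
def pt (φ : α → ι) (T : Finset α) (x : α → ℝ) (i : ι) : ℝ := ∑ v ∈ T with φ v = i, x v

/-- full blowup of a family -/
def BF (φ : α → ι) (T : Finset α) (W : Finset (Finset ι)) : Finset (Finset α) :=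
  T.powerset.filter fun e => (e.image φ).card = e.card ∧ e.image φ ∈ W

lemma mem_BF {φ : α → ι} {T : Finset α} {W : Finset (Finset ι)} {e : Finset α} :
    e ∈ BF φ T W ↔ e ⊆ T ∧ Set.InjOn φ (e : Set α) ∧ e.image φ ∈ W := by
  unfold BF
  rw [Finset.mem_filter, Finset.mem_powerset, Finset.card_image_iff]

lemma BF_one (φ : α → ι) (T : Finset α) (f : Finset ι) (x : α → ℝ) :
    PE (BF φ T {f}) x = wt (pt φ T x) f := by
  unfold wt pt PE
  rw [Finset.prod_sum]
  symm
  apply Finset.sum_bij (fun p _ => f.attach.image (fun i => p i.1 i.2))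
  · intro p hp
    rw [Finset.mem_pi] at hp
    have hp' : ∀ i (hi : i ∈ f), p i hi ∈ T ∧ φ (p i hi) = i := fun i hi => by
      simpa using hp i hi
    rw [mem_BF]
    refine ⟨?_, ?_, ?_⟩
    · intro v hv
      rw [Finset.mem_image] at hv
      obtain ⟨i, _, rfl⟩ := hv
      exact (hp' _ _).1
    · intro u hu v hv huv
      rw [Finset.mem_coe, Finset.mem_image] at hu hv
      obtain ⟨i, _, rfl⟩ := hu
      obtain ⟨j, _, rfl⟩ := hv
      rw [(hp' _ _).2, (hp' _ _).2] at huv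
      have : i = j := Subtype.ext huv
      rw [this]
    · rw [Finset.mem_singleton]
      ext i
      simp only [Finset.mem_image, Finset.mem_attach, true_and, Subtype.exists]
      constructor
      · rintro ⟨v, ⟨j, hj, rfl⟩, rfl⟩
        rwa [(hp' _ _).2]
      · intro hi
        exact ⟨_, ⟨i, hi, rfl⟩, (hp' _ _).2⟩
  · intro p hp q hq h
    rw [Finset.mem_pi] at hp hq
    have hp' : ∀ i (hi : i ∈ f), p i hi ∈ T ∧ φ (p i hi) = i := fun i hi => by
      simpa using hp i hi
    have hq' : ∀ i (hi : i ∈ f), q i hi ∈ T ∧ φ (q i hi) = i := fun i hi => by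
      simpa using hq i hi
    funext i hi
    have : p i hi ∈ f.attach.image (fun i => q i.1 i.2) := by
      rw [← h]; exact Finset.mem_image.2 ⟨⟨i, hi⟩, Finset.mem_attach _ _, rfl⟩
    rw [Finset.mem_image] at this
    obtain ⟨j, _, hj⟩ := this
    have hji : (j : ι) = i := by rw [← (hp' i hi).2, ← hj, (hq' _ _).2]
    subst hji
    exact hj.symm
  · intro e he
    rw [mem_BF, Finset.mem_singleton] at he
    obtain ⟨h1, h2, rfl⟩ := he
    choose g hg using fun (i : ι) (hi : i ∈ e.image φ) => Finset.mem_image.1 hi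
    refine ⟨fun i hi => g i hi, ?_, ?_⟩
    · rw [Finset.mem_pi]
      intro i hi
      rw [Finset.mem_filter]
      exact ⟨h1 (hg i hi).1, (hg i hi).2⟩
    · ext v
      simp only [Finset.mem_image, Finset.mem_attach, true_and, Subtype.exists]
      constructor
      · rintro ⟨i, hi, rfl⟩
        exact (hg i (Finset.mem_image.2 hi)).1
      · intro hv
        have hv' : φ v ∈ e.image φ := Finset.mem_image_of_mem _ hv
        exact ⟨φ v, ⟨v, hv, rfl⟩, h2 (hg _ hv').1 hv (hg _ hv').2⟩
  · intro p hp
    rw [Finset.mem_pi] at hp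
    rw [wt, Finset.prod_image]
    intro i _ j _ hij
    have h1 := (Finset.mem_filter.1 (hp i.1 i.2)).2
    have h2 := (Finset.mem_filter.1 (hp j.1 j.2)).2
    dsimp only at hij
    rw [hij] at h1
    exact Subtype.ext (h1.symm.trans h2)

lemma PE_BF (φ : α → ι) (T : Finset α) (W : Finset (Finset ι)) (x : α → ℝ) :
    PE (BF φ T W) x = PE W (pt φ T x) := by
  rw [PE, ← Finset.sum_fiberwise_of_maps_to (g := fun e => e.image φ) (t := W)
    (fun e he => (mem_BF.1 he).2.2)]
  unfold PE
  refine Finset.sum_congr rfl fun f hf => ?_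
  rw [← BF_one]
  unfold PE
  congr 1
  ext e
  simp only [Finset.mem_filter, mem_BF, Finset.mem_singleton]
  constructor
  · tauto
  · rintro ⟨h1, h2, rfl⟩; exact ⟨⟨h1, h2, hf⟩, rfl⟩

lemma pt_nonneg (φ : α → ι) (T : Finset α) {x : α → ℝ} (hx : ∀ v, 0 ≤ x v) (i : ι) :
    0 ≤ pt φ T x i := Finset.sum_nonneg fun v _ => hx v

lemma pt_sum [Fintype ι] (φ : α → ι) (T : Finset α) (x : α → ℝ) :
    ∑ i, pt φ T x i = ∑ v ∈ T, x v := Finset.sum_fiberwise T φ x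

lemma pt_le [Fintype ι] (φ : α → ι) {T : Finset α} {x : α → ℝ} (hx : ∀ v, 0 ≤ x v)
    (h1 : ∑ v ∈ T, x v = 1) (i : ι) : pt φ T x i ≤ 1 := by
  rw [← h1]; exact Finset.sum_le_sum_of_subset_of_nonneg (Finset.filter_subset _ _) fun v _ _ => hx v

lemma pW_le [Fintype ι] {r : ℕ} (hr : r = 5 ∨ r = 6) {W : Finset (Finset ι)} (hW : St r W)
    {a : ι → ℝ} (ha : ∀ i, 0 ≤ a i) (h1 : ∑ i, a i = 1) : PE W a ≤ lam r :=
  lagr_le hr hW.unif (hW.sf (by omega)) ha h1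

lemma lkW_le [Fintype ι] {r : ℕ} (hr : r = 5 ∨ r = 6) {W : Finset (Finset ι)} (hW : St r W)
    {a : ι → ℝ} (ha : ∀ i, 0 ≤ a i) (ha1 : ∀ i, a i ≤ 1) {η : ℝ}
    (hn : ∀ i, |a i - 1/((r:ℝ)+6)| ≤ η) (i : ι) :
    |PE (lk W i) a - rlam r| ≤ 400 * η := by
  have hη : 0 ≤ η := (abs_nonneg _).trans (hn i)
  have hk : Unif (r-1) (Finset.univ.erase i) (lk W i) := by
    obtain ⟨k, hk⟩ : ∃ k, r = k + 1 := ⟨r - 1, by omega⟩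
    subst hk; exact unif_lk hW.unif i
  have h1 : ∀ s ∈ lk W i, |wt a s - (1/((r:ℝ)+6))^(r-1)| ≤ (r-1 : ℕ) * η := by
    intro s hs
    have := wt_sub (y := fun _ => 1/((r:ℝ)+6)) ha ha1 (fun _ => by positivity)
      (fun _ => by rw [div_le_one (by positivity)]; linarith [r_pos hr]) (fun v (hv : v ∈ s) => hn v)
    rw [wt_const, (hk s hs).2] at this
    exact this
  have h2 : PE (lk W i) a - rlam r = ∑ s ∈ lk W i, (wt a s - (1/((r:ℝ)+6))^(r-1)) := by
    rw [Finset.sum_sub_distrib, rlam_dW hr, ← hW.deg hr i]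
    simp [PE]
  rw [h2]
  refine (Finset.abs_sum_le_sum_abs _ _).trans ((Finset.sum_le_sum h1).trans ?_)
  rw [Finset.sum_const, hW.deg hr i, nsmul_eq_mul]
  rcases hr with rfl | rfl <;> norm_num [dW] <;> linarith

end Blow
end DensityCH
end

section
namespace DensityCH
open Finset
set_option linter.all false

section Expect
variable {α ι : Type*} [DecidableEq α] [DecidableEq ι] [Fintype ι]

/-- expectation over the product measure -/
def Ex (V : ι → Finset α) (y : α → ℝ) (f : (ι → α) → ℝ) : ℝ :=
  ∑ w ∈ Fintype.piFinset V, (∏ j, y (w j)) * f w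

variable {V : ι → Finset α} {y : α → ℝ}

lemma Ex_mono (hy : ∀ v, 0 ≤ y v) {f g : (ι → α) → ℝ}
    (h : ∀ w, (∀ j, w j ∈ V j) → f w ≤ g w) : Ex V y f ≤ Ex V y g :=
  Finset.sum_le_sum fun w hw => mul_le_mul_of_nonneg_left (h w (Fintype.mem_piFinset.1 hw))
    (Finset.prod_nonneg fun j _ => hy _)

lemma Ex_add (f g : (ι → α) → ℝ) : Ex V y (fun w => f w + g w) = Ex V y f + Ex V y g := by
  unfold Ex; rw [← Finset.sum_add_distrib]; exact Finset.sum_congr rfl fun w _ => by ring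

lemma Ex_sub (f g : (ι → α) → ℝ) : Ex V y (fun w => f w - g w) = Ex V y f - Ex V y g := by
  unfold Ex; rw [← Finset.sum_sub_distrib]; exact Finset.sum_congr rfl fun w _ => by ring

lemma Ex_cmul (c : ℝ) (f : (ι → α) → ℝ) : Ex V y (fun w => c * f w) = c * Ex V y f := by
  unfold Ex; rw [Finset.mul_sum]; exact Finset.sum_congr rfl fun w _ => by ring

lemma Ex_sum {κ : Type*} (s : Finset κ) (f : κ → (ι → α) → ℝ) :
    Ex V y (fun w => ∑ k ∈ s, f k w) = ∑ k ∈ s, Ex V y (f k) := by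
  unfold Ex; rw [Finset.sum_comm]; exact Finset.sum_congr rfl fun w _ => by rw [Finset.mul_sum]

lemma Ex_prod (g : ι → α → ℝ) :
    Ex V y (fun w => ∏ j, g j (w j)) = ∏ j, ∑ v ∈ V j, y v * g j v := by
  unfold Ex
  rw [Finset.prod_univ_sum]
  exact Finset.sum_congr rfl fun w _ => by rw [Finset.prod_mul_distrib]

lemma Ex_const (h1 : ∀ j, ∑ v ∈ V j, y v = 1) (c : ℝ) : Ex V y (fun _ => c) = c := by
  have := Ex_prod (V := V) (y := y) (fun _ _ => 1)
  simp [h1] at this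
  have h2 := Ex_cmul (V := V) (y := y) c (fun _ => 1)
  rw [this] at h2
  simpa using h2

lemma prod_ite_one (p : ι → Prop) [DecidablePred p] :
    ∏ j, (if p j then (1:ℝ) else 0) = if ∀ j, p j then 1 else 0 := by
  split_ifs with h
  · exact Finset.prod_eq_one fun j _ => by simp [h j]
  · push Not at h
    obtain ⟨j, hj⟩ := h
    exact Finset.prod_eq_zero (Finset.mem_univ j) (by simp [hj])

lemma Ex_marg {φ : α → ι} {T : Finset α} (hV : ∀ j, V j = T.filter (φ · = j))
    (h1 : ∀ j, ∑ v ∈ V j, y v = 1) {e : Finset α} (heT : e ⊆ T) (hinj : Set.InjOn φ (e : Set α)) :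
    Ex V y (fun w => if ∀ v ∈ e, w (φ v) = v then 1 else 0) = wt y e := by
  have h2 := Ex_prod (V := V) (y := y)
    (fun j v => if (j ∈ e.image φ → v ∈ e) then 1 else 0)
  have h3 : Ex V y (fun w => if ∀ v ∈ e, w (φ v) = v then 1 else 0) =
      Ex V y (fun w => ∏ j, (fun j v => if (j ∈ e.image φ → v ∈ e) then (1:ℝ) else 0) j (w j)) := by
    unfold Ex
    refine Finset.sum_congr rfl fun w hw => ?_
    congr 1
    dsimp only
    rw [prod_ite_one]
    have hw := Fintype.mem_piFinset.1 hw
    have hw' : ∀ j, w j ∈ T ∧ φ (w j) = j := fun j => by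
      have := hw j; rw [hV, Finset.mem_filter] at this; exact this
    congr 1
    apply propext
    constructor
    · intro h j hj
      obtain ⟨v, hv, rfl⟩ := Finset.mem_image.1 hj
      rw [h v hv]; exact hv
    · intro h v hv
      exact hinj (h _ (Finset.mem_image_of_mem _ hv)) hv (hw' _).2
  rw [h3, h2]
  have h4 : ∀ j, ∑ v ∈ V j, y v * (if (j ∈ e.image φ → v ∈ e) then (1:ℝ) else 0) =
      if j ∈ e.image φ then ∑ v ∈ e with φ v = j, y v else 1 := by
    intro j
    split_ifs with hj
    · simp only [hj, true_imp_iff, mul_ite, mul_one, mul_zero]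
      rw [← Finset.sum_filter]
      congr 1
      ext v
      rw [hV]; simp only [Finset.mem_filter]
      constructor
      · rintro ⟨⟨_, h⟩, h'⟩; exact ⟨h', h⟩
      · rintro ⟨h, h'⟩; exact ⟨⟨heT h, h'⟩, h⟩
    · simp [hj, h1]
  rw [Finset.prod_congr rfl (fun j _ => h4 j), Finset.prod_ite_mem, Finset.univ_inter,
    Finset.prod_image hinj]
  unfold wt
  refine Finset.prod_congr rfl fun v hv => ?_
  rw [Finset.sum_eq_single v]
  · intro b hb hbv
    rw [Finset.mem_filter] at hb
    exact absurd (hinj hb.1 hv hb.2) hbv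
  · intro h; simp [hv] at h

/-- probability that all coordinates in `J` avoid `N` -/
lemma Ex_avoid (h1 : ∀ j, ∑ v ∈ V j, y v = 1) (J : Finset ι) (p : ι → α → Prop)
    [∀ j, DecidablePred (p j)] :
    Ex V y (fun w => if ∀ j ∈ J, p j (w j) then 1 else 0) = ∏ j ∈ J, ∑ v ∈ V j with p j v, y v := by
  have h2 := Ex_prod (V := V) (y := y)
    (fun j v => if (j ∈ J → p j v) then 1 else 0)
  have h3 : Ex V y (fun w => if ∀ j ∈ J, p j (w j) then 1 else 0) =
      Ex V y (fun w => ∏ j, (fun j v => if (j ∈ J → p j v) then (1:ℝ) else 0) j (w j)) := by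
    unfold Ex
    refine Finset.sum_congr rfl fun w hw => ?_
    congr 1
    dsimp only
    rw [prod_ite_one]
  rw [h3, h2]
  have h4 : ∀ j, ∑ v ∈ V j, y v * (if (j ∈ J → p j v) then (1:ℝ) else 0) =
      if j ∈ J then ∑ v ∈ V j with p j v, y v else 1 := by
    intro j
    split_ifs with hj
    · simp only [hj, true_imp_iff, mul_ite, mul_one, mul_zero]
      rw [← Finset.sum_filter]
    · simp [hj, h1]
  rw [Finset.prod_congr rfl (fun j _ => h4 j), Finset.prod_ite_mem, Finset.univ_inter]

end Expect

section Setup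
variable {α ι : Type*} [DecidableEq α] [DecidableEq ι] [Fintype ι]

/-- approximate cancellativity conditions -/
structure Apx (E : Finset (Finset α)) (x : α → ℝ) (θ : ℝ) : Prop where
  P1 : ∀ (S : Finset α) (a b : α), a ≠ b → a ∉ S → b ∉ S → insert a S ∈ E → insert b S ∈ E →
    Dg E x {a, b} ≤ θ
  P2 : ∀ (a b : α), a ≠ b → ∀ e ∈ E, a ∈ e → b ∈ e → PE (lk E a ∩ lk E b) x ≤ θ

/-- standing hypotheses -/
structure LS (r : ℕ) (W : Finset (Finset ι)) (T : Finset α) (E : Finset (Finset α)) (x : α → ℝ)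
    (φ : α → ι) (η θ : ℝ) : Prop where
  hr : r = 5 ∨ r = 6
  hW : St r W
  hE : Unif r T E
  hx : ∀ v, 0 ≤ x v
  h1 : ∑ v ∈ T, x v = 1
  hn : ∀ i, |pt φ T x i - 1/((r:ℝ)+6)| ≤ η
  hP : lam r - η ≤ PE (E ∩ BF φ T W) x
  ap : Apx E x θ
  hθ0 : 0 ≤ θ
  hθ : θ ≤ η
  hη : η ≤ 1/10^8

variable {r : ℕ} {W : Finset (Finset ι)} {T : Finset α} {E : Finset (Finset α)} {x : α → ℝ}
    {φ : α → ι} {η θ : ℝ}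

lemma LS.hη0 (h : LS r W T E x φ η θ) : 0 ≤ η := h.hθ0.trans h.hθ

lemma LS.pt_lb (h : LS r W T E x φ η θ) (i : ι) : 1/24 ≤ pt φ T x i := by
  have := (abs_le.1 (h.hn i)).1
  have h2 := h.hη
  have : (1:ℝ)/12 ≤ 1/((r:ℝ)+6) := by
    rcases h.hr with rfl | rfl <;> norm_num
  linarith

lemma LS.lk_le (h : LS r W T E x φ η θ) (i : ι) :
    PE (BF φ T (lk W i)) x ≤ rlam r + 400 * η := by
  rw [PE_BF]
  have := (abs_le.1 (lkW_le h.hr h.hW (pt_nonneg φ T h.hx) (pt_le φ h.hx h.h1) h.hn i)).2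
  linarith

lemma lk_inter_BF {a : α} (ha : a ∈ T) (E : Finset (Finset α)) (W : Finset (Finset ι)) :
    lk (E ∩ BF φ T W) a = lk E a ∩ BF φ T (lk W (φ a)) := by
  ext s
  rw [Finset.mem_inter, mem_lk, mem_lk, Finset.mem_inter, mem_BF, mem_BF, mem_lk,
    Finset.image_insert, Finset.coe_insert, Finset.insert_subset_iff]
  constructor
  · rintro ⟨h1, h2, ⟨_, h3⟩, h4, h5⟩
    refine ⟨⟨h1, h2⟩, h3, h4.mono (Set.subset_insert _ _), ?_, h5⟩
    intro hh
    obtain ⟨b, hb, hba⟩ := Finset.mem_image.1 hh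
    have := h4 (Set.mem_insert_of_mem _ hb) (Set.mem_insert _ _) hba
    exact h1 (this ▸ hb)
  · rintro ⟨⟨h1, h2⟩, h3, h4, h5, h6⟩
    refine ⟨h1, h2, ⟨ha, h3⟩, ?_, h6⟩
    rw [Set.injOn_insert (by simpa using h1)]
    refine ⟨h4, ?_⟩
    rintro ⟨b, hb, hba⟩
    exact h5 (Finset.mem_image.2 ⟨b, hb, hba⟩)

/-- link of `u` seen with colour `i` -/
def Lc (φ : α → ι) (T : Finset α) (W : Finset (Finset ι)) (E : Finset (Finset α)) (u : α) (i : ι) :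
    Finset (Finset α) := lk E u ∩ BF φ T (lk W i)

lemma LS.Lc_le (h : LS r W T E x φ η θ) (u : α) (i : ι) :
    PE (Lc φ T W E u i) x ≤ rlam r + 400 * η :=
  (PE_mono h.hx Finset.inter_subset_right).trans (h.lk_le i)

/-- atypical vertices -/
noncomputable def Aty (r : ℕ) (φ : α → ι) (T : Finset α) (W : Finset (Finset ι)) (E : Finset (Finset α))
    (x : α → ℝ) : Finset α :=
  T.filter fun a => PE (Lc φ T W E a (φ a)) x < 2/3 * rlam r

lemma rlam_lb (hr : r = 5 ∨ r = 6) : 1/4000 ≤ rlam r := by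
  rcases hr with rfl | rfl
  · rw [rlam5]; norm_num
  · rw [rlam6]; norm_num

lemma LS.Aty_le (h : LS r W T E x φ η θ) : ∑ v ∈ Aty r φ T W E x, x v ≤ 10^7 * η := by
  have hu : Unif r T (E ∩ BF φ T W) := unif_mono h.hE Finset.inter_subset_left
  have h1 := sum_x_Dg hu x
  have h2 : ∀ v ∈ T, x v * Dg (E ∩ BF φ T W) x {v} ≤
      x v * (rlam r + 400 * η) - (if v ∈ Aty r φ T W E x then x v * (1/3 * rlam r) else 0) := by
    intro v hv
    have e : Dg (E ∩ BF φ T W) x {v} = PE (Lc φ T W E v (φ v)) x := by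
      rw [Dg_lk, lk_inter_BF hv]; rfl
    rw [e]
    have := h.Lc_le v (φ v)
    have hxv := h.hx v
    have := h.hη0
    split_ifs with hA
    · have := (Finset.mem_filter.1 hA).2
      nlinarith
    · nlinarith
  have h3 := Finset.sum_le_sum h2
  rw [h1, Finset.sum_sub_distrib, ← Finset.sum_mul, h.h1, ← Finset.sum_filter, ← Finset.sum_mul,
    Finset.filter_mem_eq_inter, Finset.inter_eq_right.2 (show Aty r φ T W E x ⊆ T from Finset.filter_subset _ _)] at h3
  have h4 := h.hP
  have h5 := r_lam h.hr
  have h6 := rlam_lb h.hr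
  have h7 := h.hη0
  have hr6 : (r:ℝ) ≤ 6 := by rcases h.hr with hh | hh <;> rw [hh] <;> norm_num
  have hr0 := r_pos h.hr
  have h8 : 0 ≤ ∑ v ∈ Aty r φ T W E x, x v := Finset.sum_nonneg fun v _ => h.hx v
  have h9 : r * (lam r - η) ≤ r * PE (E ∩ BF φ T W) x := mul_le_mul_of_nonneg_left h4 hr0.le
  nlinarith

lemma PE_inter_ge (hx : ∀ v, 0 ≤ x v) {A B C : Finset (Finset α)} (hA : A ⊆ C) (hB : B ⊆ C) :
    PE A x + PE B x - PE C x ≤ PE (A ∩ B) x := by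
  have h1 : PE (A ∪ B) x + PE (A ∩ B) x = PE A x + PE B x := Finset.sum_union_inter
  have h2 := PE_mono hx (Finset.union_subset hA hB)
  linarith

/-- two vertices of an edge cannot both see large links of the same colour -/
lemma LS.two_col (h : LS r W T E x φ η θ) {b c : α} (hbc : b ≠ c) {e : Finset α} (he : e ∈ E)
    (hb : b ∈ e) (hc : c ∈ e) {i : ι} (h1 : 2/3 * rlam r ≤ PE (Lc φ T W E b i) x)
    (h2 : 2/3 * rlam r ≤ PE (Lc φ T W E c i) x) : False := by
  have h3 := PE_inter_ge h.hx (A := Lc φ T W E b i) (B := Lc φ T W E c i)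
    Finset.inter_subset_right Finset.inter_subset_right
  have h4 : PE (Lc φ T W E b i ∩ Lc φ T W E c i) x ≤ PE (lk E b ∩ lk E c) x :=
    PE_mono h.hx (Finset.inter_subset_inter Finset.inter_subset_left Finset.inter_subset_left)
  have h5 := h.ap.P2 b c hbc e he hb hc
  have h6 := h.lk_le i
  have h7 := rlam_lb h.hr
  have := h.hθ; have := h.hη
  linarith

lemma LS.atyp (h : LS r W T E x φ η θ) {b c : α} (hbc : b ≠ c) {e : Finset α} (he : e ∈ E)
    (hb : b ∈ e) (hc : c ∈ e) (hφ : φ b = φ c) : b ∈ Aty r φ T W E x ∨ c ∈ Aty r φ T W E x := by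
  by_contra hcon
  push Not at hcon
  have hbT := (h.hE e he).1 hb
  have hcT := (h.hE e he).1 hc
  have h1 : 2/3 * rlam r ≤ PE (Lc φ T W E b (φ b)) x := by
    by_contra hh; push Not at hh
    exact hcon.1 (Finset.mem_filter.2 ⟨hbT, hh⟩)
  have h2 : 2/3 * rlam r ≤ PE (Lc φ T W E c (φ b)) x := by
    rw [hφ]
    by_contra hh; push Not at hh
    exact hcon.2 (Finset.mem_filter.2 ⟨hcT, hh⟩)
  exact h.two_col hbc he hb hc h1 h2

/-- significant neighbours -/
noncomputable def Nb (T : Finset α) (E : Finset (Finset α)) (x : α → ℝ) (θ : ℝ) (u : α) : Finset α :=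
  T.filter fun b => b ≠ u ∧ θ < Dg E x {u, b}

/-- main part of the link -/
noncomputable def Lm (φ : α → ι) (T : Finset α) (E : Finset (Finset α)) (x : α → ℝ) (θ : ℝ) (u : α) :
    Finset (Finset α) :=
  (lk E u).filter fun s => (s.image φ).card = s.card ∧ s ⊆ Nb T E x θ u

lemma Dg_le_one (hx : ∀ v, 0 ≤ x v) (h1 : ∑ v ∈ T, x v = 1) {k : ℕ} {L : Finset (Finset α)}
    (hL : Unif k T L) : PE L x ≤ 1 := by
  have : PE L x ≤ es T k x := PE_mono hx fun e he => Finset.mem_powersetCard.2 (hL e he)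
  exact this.trans (es_le_one hx h1 k)

lemma unif_sup {k : ℕ} {T' : Finset α} (h : T' ⊆ T) {L : Finset (Finset α)} (hL : Unif k T' L) :
    Unif k T L := fun e he => ⟨(hL e he).1.trans h, (hL e he).2⟩

/-- weight of the members meeting a set -/
lemma PE_meet (hx : ∀ v, 0 ≤ x v) {L : Finset (Finset α)} {A : Finset α} {c : ℝ}
    (hc : ∀ a ∈ A, Dg L x {a} ≤ c) :
    PE (L.filter fun s => ∃ a ∈ A, a ∈ s) x ≤ c * ∑ a ∈ A, x a := by
  have h1 : PE (L.filter fun s => ∃ a ∈ A, a ∈ s) x ≤ ∑ a ∈ A, PE (L.filter ({a} ⊆ ·)) x := by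
    unfold PE
    rw [Finset.sum_comm' (t' := L) (s' := fun s => A.filter (· ∈ s)) (by
      intro a s; simp; tauto)]
    rw [Finset.sum_filter]
    apply Finset.sum_le_sum
    intro s hs
    rw [Finset.sum_const]
    split_ifs with hh
    · obtain ⟨a, ha, has⟩ := hh
      have : 1 ≤ (A.filter (· ∈ s)).card := Finset.card_pos.2 ⟨a, by simp [ha, has]⟩
      rw [nsmul_eq_mul]
      have h2 : (1:ℝ) ≤ (A.filter (· ∈ s)).card := by exact_mod_cast this
      have := wt_nonneg hx s
      nlinarith
    · exact nsmul_nonneg (wt_nonneg hx s) _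
  refine h1.trans ?_
  rw [Finset.mul_sum]
  refine Finset.sum_le_sum fun a ha => ?_
  rw [PE_through]
  simp only [wt, Finset.prod_singleton]
  rw [mul_comm]
  exact mul_le_mul_of_nonneg_right (hc a ha) (hx a)

lemma LS.sub_sum (h : LS r W T E x φ η θ) {A : Finset α} (hA : A ⊆ T) : ∑ v ∈ A, x v ≤ 1 := by
  rw [← h.h1]; exact Finset.sum_le_sum_of_subset_of_nonneg hA fun v _ _ => h.hx v

lemma LS.D_le (h : LS r W T E x φ η θ) {u : α} (hu : u ∈ T) :
    Dg E x {u} ≤ PE (Lm φ T E x θ u) x + 2 * 10^7 * η := by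
  obtain ⟨k, hk⟩ : ∃ k, r = k + 2 := ⟨r - 2, by have := h.hr; omega⟩
  have huL : Unif (k+1) (T.erase u) (lk E u) := by
    have := h.hE; rw [hk] at this; exact unif_lk this u
  have hA := PE_meet h.hx (L := lk E u) (A := Aty r φ T W E x) (c := 1) (by
    intro a _
    rw [Dg_lk]
    exact Dg_le_one h.hx h.h1 (unif_sup ((Finset.erase_subset _ _).trans (Finset.erase_subset _ _))
      (unif_lk huL a)))
  have hB := PE_meet h.hx (L := lk E u) (A := (T.erase u) \ Nb T E x θ u) (c := θ) (by
    intro a ha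
    rw [Finset.mem_sdiff, Finset.mem_erase] at ha
    rw [← Dg_insert E x (by simpa using ha.1.1.symm)]
    by_contra hh; push Not at hh
    exact ha.2 (Finset.mem_filter.2 ⟨ha.1.2, ha.1.1, hh⟩))
  have hA' := h.Aty_le
  have hB' := h.sub_sum (A := (T.erase u) \ Nb T E x θ u)
    (Finset.sdiff_subset.trans (Finset.erase_subset _ _))
  rw [Dg_lk]
  have hcov : lk E u ⊆ (Lm φ T E x θ u ∪ (lk E u).filter fun s => ∃ a ∈ Aty r φ T W E x, a ∈ s) ∪
      (lk E u).filter fun s => ∃ a ∈ (T.erase u) \ Nb T E x θ u, a ∈ s := by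
    intro s hs
    rw [Finset.mem_union, Finset.mem_union]
    by_cases hN : s ⊆ Nb T E x θ u
    · left
      by_cases hi : (s.image φ).card = s.card
      · left; exact Finset.mem_filter.2 ⟨hs, hi, hN⟩
      · right
        refine Finset.mem_filter.2 ⟨hs, ?_⟩
        rw [Finset.card_image_iff] at hi
        unfold Set.InjOn at hi
        push Not at hi
        obtain ⟨b, hb, c, hc, hbc, hne⟩ := hi
        have hs' := mem_lk.1 hs
        rcases h.atyp hne hs'.2 (Finset.mem_insert_of_mem hb) (Finset.mem_insert_of_mem hc) hbc with
          hh | hh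
        · exact ⟨b, hh, hb⟩
        · exact ⟨c, hh, hc⟩
    · right
      rw [Finset.not_subset] at hN
      obtain ⟨a, ha, ha'⟩ := hN
      exact Finset.mem_filter.2 ⟨hs, a, Finset.mem_sdiff.2 ⟨(huL s hs).1 ha, ha'⟩, ha⟩
  have h3 := (PE_mono h.hx hcov).trans ((PE_union_le h.hx _ _).trans
    (add_le_add_left (PE_union_le h.hx _ _) _))
  have := h.hθ; have := h.hθ0; have := h.hη0
  have : θ * ∑ a ∈ (T.erase u) \ Nb T E x θ u, x a ≤ θ * 1 := mul_le_mul_of_nonneg_left hB' h.hθ0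
  linarith

end Setup
end DensityCH
end

section
namespace DensityCH
open Finset
set_option linter.all false

section Setup
variable {α ι : Type*} [DecidableEq α] [DecidableEq ι] [Fintype ι]
variable {r : ℕ} {W : Finset (Finset ι)} {T : Finset α} {E : Finset (Finset α)} {x : α → ℝ}
    {φ : α → ι} {η θ : ℝ}

/-- normalised weights -/
noncomputable def yy (φ : α → ι) (T : Finset α) (x : α → ℝ) (v : α) : ℝ := x v / pt φ T x (φ v)
/-- colour classes -/
def VV (φ : α → ι) (T : Finset α) (j : ι) : Finset α := T.filter (φ · = j)

lemma LS.y0 (h : LS r W T E x φ η θ) (v : α) : 0 ≤ yy φ T x v :=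
  div_nonneg (h.hx v) (pt_nonneg φ T h.hx _)

lemma LS.ysum (h : LS r W T E x φ η θ) (j : ι) : ∑ v ∈ VV φ T j, yy φ T x v = 1 := by
  have h1 : ∀ v ∈ VV φ T j, yy φ T x v = x v / pt φ T x j := by
    intro v hv
    rw [yy, (Finset.mem_filter.1 hv).2]
  rw [Finset.sum_congr rfl h1, ← Finset.sum_div]
  have := h.pt_lb j
  exact div_self (by change pt φ T x j ≠ 0; linarith)

lemma LS.xy (h : LS r W T E x φ η θ) (v : α) : x v = pt φ T x (φ v) * yy φ T x v := by
  have := h.pt_lb (φ v)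
  unfold yy; field_simp

lemma LS.wty (h : LS r W T E x φ η θ) (s : Finset α) :
    wt x s = wt (fun v => pt φ T x (φ v)) s * wt (yy φ T x) s := by
  unfold wt; rw [← Finset.prod_mul_distrib]
  exact Finset.prod_congr rfl fun v _ => h.xy v

lemma LS.wtx_le (h : LS r W T E x φ η θ) (s : Finset α) :
    wt x s ≤ ((1/((r:ℝ)+6))^s.card + s.card * η) * wt (yy φ T x) s := by
  rw [h.wty]
  apply mul_le_mul_of_nonneg_right _ (wt_nonneg h.y0 s)
  have := wt_sub (x := fun v => pt φ T x (φ v)) (y := fun _ => 1/((r:ℝ)+6)) (s := s) (η := η)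
    (fun v => pt_nonneg φ T h.hx _) (fun v => pt_le φ h.hx h.h1 _) (fun _ => by positivity)
    (fun _ => by rw [div_le_one (by positivity)]; linarith [r_pos h.hr]) (fun v _ => h.hn _)
  rw [wt_const] at this
  linarith [(abs_le.1 this).2]

lemma LS.wtx_le_y (h : LS r W T E x φ η θ) (s : Finset α) : wt x s ≤ wt (yy φ T x) s := by
  rw [h.wty]
  have : wt (fun v => pt φ T x (φ v)) s ≤ 1 :=
    Finset.prod_le_one (fun v _ => pt_nonneg φ T h.hx _) (fun v _ => pt_le φ h.hx h.h1 _)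
  have := wt_nonneg h.y0 s
  nlinarith

lemma LS.wty_le (h : LS r W T E x φ η θ) (s : Finset α) : wt (yy φ T x) s ≤ 24^s.card * wt x s := by
  rw [← wt_smul]
  apply wt_mono h.y0
  intro v _
  have h1 := h.pt_lb (φ v)
  rw [yy, div_le_iff₀ (by linarith)]
  have := h.hx v
  nlinarith

/-- strong good edges -/
noncomputable def Es (φ : α → ι) (T : Finset α) (W : Finset (Finset ι)) (E : Finset (Finset α))
    (x : α → ℝ) (θ : ℝ) : Finset (Finset α) :=
  (E ∩ BF φ T W).filter fun e => ∀ a ∈ e, ∀ b ∈ e, a ≠ b → θ < Dg E x {a, b}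

lemma LS.Es_ge (h : LS r W T E x φ η θ) : lam r - 2 * η ≤ PE (Es φ T W E x θ) x := by
  have h1 := PE_filter_add (E ∩ BF φ T W) x (fun e => ∀ a ∈ e, ∀ b ∈ e, a ≠ b → θ < Dg E x {a, b})
  have h2 : PE ((E ∩ BF φ T W).filter fun e => ¬ ∀ a ∈ e, ∀ b ∈ e, a ≠ b → θ < Dg E x {a, b}) x ≤
      ∑ a ∈ T, ∑ b ∈ T.filter (fun b => a ≠ b ∧ Dg E x {a,b} ≤ θ), PE (E.filter ({a, b} ⊆ ·)) x := by
    unfold PE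
    have : ∀ e ∈ (E ∩ BF φ T W).filter fun e => ¬ ∀ a ∈ e, ∀ b ∈ e, a ≠ b → θ < Dg E x {a, b},
        wt x e ≤ ∑ a ∈ T, ∑ b ∈ T.filter (fun b => a ≠ b ∧ Dg E x {a,b} ≤ θ),
          if {a, b} ⊆ e then wt x e else 0 := by
      intro e he
      rw [Finset.mem_filter, Finset.mem_inter] at he
      obtain ⟨⟨heE, _⟩, hne⟩ := he
      push Not at hne
      obtain ⟨a, ha, b, hb, hab, hD⟩ := hne
      have hnn : ∀ a b, 0 ≤ (if {a, b} ⊆ e then wt x e else 0) := by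
        intro a b; split_ifs; exacts [wt_nonneg h.hx e, le_rfl]
      have haT := (h.hE e heE).1 ha
      have hbT := (h.hE e heE).1 hb
      refine le_trans ?_ (Finset.single_le_sum (fun a _ => Finset.sum_nonneg fun b _ => hnn a b) haT)
      refine le_trans ?_ (Finset.single_le_sum (fun b _ => hnn a b)
        (Finset.mem_filter.2 ⟨hbT, hab, hD⟩))
      rw [if_pos]
      rw [Finset.insert_subset_iff, Finset.singleton_subset_iff]; exact ⟨ha, hb⟩
    refine (Finset.sum_le_sum this).trans ?_
    refine (Finset.sum_le_sum_of_subset_of_nonneg (t := E)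
      ((Finset.filter_subset _ _).trans Finset.inter_subset_left) ?_).trans ?_
    · intro e _ _
      refine Finset.sum_nonneg fun a _ => Finset.sum_nonneg fun b _ => ?_
      split_ifs; exacts [wt_nonneg h.hx e, le_rfl]
    · rw [Finset.sum_comm]
      refine Finset.sum_le_sum fun a _ => ?_
      rw [Finset.sum_comm]
      refine Finset.sum_le_sum fun b _ => ?_
      rw [Finset.sum_filter]
  have h3 : ∑ a ∈ T, ∑ b ∈ T.filter (fun b => a ≠ b ∧ Dg E x {a,b} ≤ θ), PE (E.filter ({a, b} ⊆ ·)) x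
      ≤ ∑ a ∈ T, ∑ b ∈ T, x a * (x b * θ) := by
    refine Finset.sum_le_sum fun a _ => ?_
    have hnn : ∀ b, 0 ≤ x a * (x b * θ) := fun b =>
      mul_nonneg (h.hx a) (mul_nonneg (h.hx b) h.hθ0)
    refine le_trans (Finset.sum_le_sum ?_)
      (Finset.sum_le_sum_of_subset_of_nonneg (Finset.filter_subset _ _) fun b _ _ => hnn b)
    intro b hb
    rw [Finset.mem_filter] at hb
    rw [PE_through, wt_insert (by simpa using hb.2.1)]
    simp only [wt, Finset.prod_singleton]
    rw [mul_assoc]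
    exact mul_le_mul_of_nonneg_left (mul_le_mul_of_nonneg_left hb.2.2 (h.hx b)) (h.hx a)
  have h4 : ∑ a ∈ T, ∑ b ∈ T, x a * (x b * θ) = θ := by
    simp_rw [← Finset.mul_sum, ← Finset.sum_mul, h.h1]; simp
  have h5 := h.hP
  have h6 := h.hθ
  change PE (Es φ T W E x θ) x + _ = _ at h1
  linarith

/-- the transversal `w` is good -/
def Gd (φ : α → ι) (T : Finset α) (W : Finset (Finset ι)) (E : Finset (Finset α))
    (x : α → ℝ) (θ : ℝ) (w : ι → α) : Prop := ∀ f ∈ W, f.image w ∈ Es φ T W E x θ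

open scoped Classical in
lemma LS.bad_le (h : LS r W T E x φ η θ) :
    Ex (VV φ T) (yy φ T x) (fun w => if ¬ Gd φ T W E x θ w then 1 else 0) ≤ 24^6 * (2 * η) := by
  set M := BF φ T W \ Es φ T W E x θ with hM
  have hEB : Es φ T W E x θ ⊆ BF φ T W := (Finset.filter_subset _ _).trans Finset.inter_subset_right
  have h1 : Ex (VV φ T) (yy φ T x) (fun w => if ¬ Gd φ T W E x θ w then 1 else 0) ≤
      Ex (VV φ T) (yy φ T x) (fun w => ∑ e ∈ M, if ∀ v ∈ e, w (φ v) = v then 1 else 0) := by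
    apply Ex_mono h.y0
    intro w hw
    have hw' : ∀ j, w j ∈ T ∧ φ (w j) = j := fun j => Finset.mem_filter.1 (hw j)
    have hnn : ∀ e ∈ M, (0:ℝ) ≤ if ∀ v ∈ e, w (φ v) = v then 1 else 0 := by
      intro e _; split_ifs <;> norm_num
    split_ifs with hg; swap
    · unfold Gd at hg; push Not at hg
      obtain ⟨f, hf, hf'⟩ := hg
      have hfM : f.image w ∈ M := by
        rw [hM, Finset.mem_sdiff, mem_BF]
        refine ⟨⟨?_, ?_, ?_⟩, hf'⟩
        · intro v hv; obtain ⟨j, _, rfl⟩ := Finset.mem_image.1 hv; exact (hw' j).1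
        · intro u hu v hv huv
          obtain ⟨i, _, rfl⟩ := Finset.mem_image.1 hu
          obtain ⟨j, _, rfl⟩ := Finset.mem_image.1 hv
          rw [(hw' i).2, (hw' j).2] at huv; rw [huv]
        · rw [Finset.image_image]
          have : f.image (φ ∘ w) = f := by
            ext i; simp only [Finset.mem_image, Function.comp]
            constructor
            · rintro ⟨j, hj, rfl⟩; rwa [(hw' j).2]
            · intro hi; exact ⟨i, hi, (hw' i).2⟩
          rw [this]; exact hf
      refine le_trans ?_ (Finset.single_le_sum hnn hfM)
      rw [if_pos]
      intro v hv
      obtain ⟨j, _, rfl⟩ := Finset.mem_image.1 hv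
      rw [(hw' j).2]
    · exact Finset.sum_nonneg hnn
  refine h1.trans ?_
  rw [Ex_sum]
  have h2 : ∀ e ∈ M, Ex (VV φ T) (yy φ T x) (fun w => if ∀ v ∈ e, w (φ v) = v then 1 else 0) ≤
      24^6 * wt x e := by
    intro e he
    have heB := mem_BF.1 (Finset.mem_sdiff.1 he).1
    rw [Ex_marg (V := VV φ T) (fun _ => rfl) h.ysum heB.1 heB.2.1]
    refine (h.wty_le e).trans ?_
    apply mul_le_mul_of_nonneg_right _ (wt_nonneg h.hx e)
    apply pow_le_pow_right₀ (by norm_num)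
    rw [← Finset.card_image_of_injOn heB.2.1, h.hW.ce _ heB.2.2]
    have := h.hr; omega
  refine (Finset.sum_le_sum h2).trans ?_
  rw [← Finset.mul_sum]
  apply mul_le_mul_of_nonneg_left _ (by norm_num)
  change PE M x ≤ _
  have h3 : PE M x + PE (Es φ T W E x θ) x = PE (BF φ T W) x := Finset.sum_sdiff hEB
  have h4 := h.Es_ge
  have h5 : PE (BF φ T W) x ≤ lam r := by
    rw [PE_BF]
    exact pW_le h.hr h.hW (pt_nonneg φ T h.hx) (by rw [pt_sum, h.h1])
  linarith

/-- types of link members consistent with `w` -/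
noncomputable def Ty (φ : α → ι) (L : Finset (Finset α)) (w : ι → α) : Finset (Finset ι) :=
  (L.filter fun s => ∀ v ∈ s, w (φ v) = v).image (·.image φ)

lemma Ty_card (φ : α → ι) (L : Finset (Finset α)) (w : ι → α) :
    (Ty φ L w).card = (L.filter fun s => ∀ v ∈ s, w (φ v) = v).card := by
  unfold Ty
  apply Finset.card_image_of_injOn
  intro s hs t ht hst
  have hs := (Finset.mem_filter.1 hs).2
  have ht := (Finset.mem_filter.1 ht).2
  have e : ∀ s : Finset α, (∀ v ∈ s, w (φ v) = v) → (s.image φ).image w = s := by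
    intro s hs
    rw [Finset.image_image]
    ext v; simp only [Finset.mem_image, Function.comp]
    constructor
    · rintro ⟨u, hu, rfl⟩; rwa [hs u hu]
    · intro hv; exact ⟨v, hv, hs v hv⟩
  dsimp only at hst
  rw [← e s hs, hst, e t ht]

lemma mem_Ty {φ : α → ι} {L : Finset (Finset α)} {w : ι → α} (hw : ∀ j, φ (w j) = j) {S : Finset ι} :
    S ∈ Ty φ L w ↔ S.image w ∈ L := by
  unfold Ty
  rw [Finset.mem_image]
  constructor
  · rintro ⟨s, hs, rfl⟩
    rw [Finset.mem_filter] at hs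
    convert hs.1
    rw [Finset.image_image]
    ext v; simp only [Finset.mem_image, Function.comp]
    constructor
    · rintro ⟨u, hu, rfl⟩; rwa [hs.2 u hu]
    · intro hv; exact ⟨v, hv, hs.2 v hv⟩
  · intro hS
    refine ⟨S.image w, Finset.mem_filter.2 ⟨hS, ?_⟩, ?_⟩
    · intro v hv; obtain ⟨j, _, rfl⟩ := Finset.mem_image.1 hv; rw [hw]
    · rw [Finset.image_image]
      ext i; simp only [Finset.mem_image, Function.comp]
      constructor
      · rintro ⟨j, hj, rfl⟩; rwa [hw]
      · intro hi; exact ⟨i, hi, hw i⟩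

/-- non-neighbour colours -/
noncomputable def Zz (T : Finset α) (E : Finset (Finset α)) (x : α → ℝ) (θ : ℝ) (u : α) (w : ι → α) :
    Finset ι := Finset.univ.filter fun j => w j ∉ Nb T E x θ u

lemma w_inj {w : ι → α} (hw : ∀ j, φ (w j) = j) : Function.Injective w := fun i j hij => by
  rw [← hw i, hij, hw]

/-- structure of consistent types for a good `w` -/
lemma LS.ty (h : LS r W T E x φ η θ) {u : α} {w : ι → α} (hw : ∀ j, φ (w j) = j)
    (hg : Gd φ T W E x θ w) {S : Finset ι} (hS : S ∈ Ty φ (Lm φ T E x θ u) w) :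
    S.card = r - 1 ∧ S ⊆ (Zz T E x θ u w)ᶜ ∧
      ∀ i, i ∉ S → insert i S ∈ W → i ∈ Zz T E x θ u w := by
  rw [mem_Ty hw] at hS
  unfold Lm at hS
  rw [Finset.mem_filter, mem_lk] at hS
  obtain ⟨⟨huS, hSE⟩, _, hSN⟩ := hS
  have hinj := w_inj hw
  refine ⟨?_, ?_, ?_⟩
  · have := (h.hE _ hSE).2
    rw [Finset.card_insert_of_notMem huS, Finset.card_image_of_injective _ hinj] at this
    omega
  · intro j hj
    simp only [Zz, Finset.mem_compl, Finset.mem_filter, Finset.mem_univ, true_and, not_not]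
    exact hSN (Finset.mem_image_of_mem _ hj)
  · intro i hi hiW
    simp only [Zz, Finset.mem_filter, Finset.mem_univ, true_and]
    intro hN
    have hN := Finset.mem_filter.1 hN
    have h1 := hg _ hiW
    rw [Finset.image_insert] at h1
    have h2 : insert (w i) (S.image w) ∈ E :=
      (Finset.mem_inter.1 (Finset.mem_filter.1 h1).1).1
    have h3 : w i ∉ S.image w := by
      intro hh; obtain ⟨j, hj, hji⟩ := Finset.mem_image.1 hh
      exact hi (hinj hji ▸ hj)
    have := h.ap.P1 (S.image w) u (w i) hN.2.1.symm huS h3 hSE h2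
    linarith [hN.2.2]

lemma LS.ty_pst (h : LS r W T E x φ η θ) {u : α} {w : ι → α} (hw : ∀ j, φ (w j) = j)
    (hg : Gd φ T W E x θ w) : PSt (r-2) (Ty φ (Lm φ T E x θ u) w) := by
  have hr := h.hr
  have hinj := w_inj hw
  intro S hS S' hS' hc
  by_contra hne
  obtain ⟨hSc, hSZ, _⟩ := h.ty hw hg hS
  obtain ⟨hSc', hSZ', _⟩ := h.ty hw hg hS'
  rw [mem_Ty hw] at hS hS'
  have hS := mem_lk.1 (Finset.mem_filter.1 hS).1
  have hS' := mem_lk.1 (Finset.mem_filter.1 hS').1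
  obtain ⟨R, hR, hRc⟩ := Finset.exists_subset_card_eq hc
  have hRS := hR.trans Finset.inter_subset_left
  have hRS' := hR.trans Finset.inter_subset_right
  have e1 : (S \ R).card = 1 := by rw [Finset.card_sdiff_of_subset hRS]; omega
  have e2 : (S' \ R).card = 1 := by rw [Finset.card_sdiff_of_subset hRS']; omega
  obtain ⟨p, hp⟩ := Finset.card_eq_one.1 e1
  obtain ⟨q, hq⟩ := Finset.card_eq_one.1 e2
  have hpR : p ∉ R := (Finset.mem_sdiff.1 (by rw [hp]; simp : p ∈ S \ R)).2
  have hqR : q ∉ R := (Finset.mem_sdiff.1 (by rw [hq]; simp : q ∈ S' \ R)).2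
  have hSe : S = insert p R := by
    rw [Finset.insert_eq, ← hp, Finset.sdiff_union_of_subset hRS]
  have hSe' : S' = insert q R := by
    rw [Finset.insert_eq, ← hq, Finset.sdiff_union_of_subset hRS']
  have hpq : p ≠ q := by rintro rfl; exact hne (hSe.trans hSe'.symm)
  subst hSe hSe'
  rw [Finset.image_insert] at hS hS'
  rw [Finset.mem_insert, not_or] at hS hS'
  have hwp : w p ∉ R.image w := by
    intro hh; obtain ⟨j, hj, hji⟩ := Finset.mem_image.1 hh; exact hpR (hinj hji ▸ hj)
  have hwq : w q ∉ R.image w := by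
    intro hh; obtain ⟨j, hj, hji⟩ := Finset.mem_image.1 hh; exact hqR (hinj hji ▸ hj)
  have hD := h.ap.P1 (insert u (R.image w)) (w p) (w q) (fun hh => hpq (hinj hh))
    (by rw [Finset.mem_insert, not_or]; exact ⟨fun hh => hS.1.1 hh.symm, hwp⟩)
    (by rw [Finset.mem_insert, not_or]; exact ⟨fun hh => hS'.1.1 hh.symm, hwq⟩)
    (by rw [Finset.insert_comm]; exact hS.2) (by rw [Finset.insert_comm]; exact hS'.2)
  obtain ⟨Q, hQ, hQc⟩ : ∃ Q : Finset ι, {p, q} ⊆ Q ∧ Q.card = r - 1 := by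
    obtain ⟨Q, h1, _, h3⟩ := Finset.exists_subsuperset_card_eq (Finset.subset_univ ({p, q} : Finset ι))
      (n := r - 1) (by rw [Finset.card_pair hpq]; omega) (by rw [Finset.card_univ, h.hW.ci]; omega)
    exact ⟨Q, h1, h3⟩
  obtain ⟨f, ⟨hf, hQf⟩, _⟩ := h.hW.ex Q hQc
  have hfE := (Finset.mem_filter.1 (hg f hf)).2
  have hpf : p ∈ f := hQf (hQ (by simp))
  have hqf : q ∈ f := hQf (hQ (by simp))
  have := hfE (w p) (Finset.mem_image_of_mem _ hpf) (w q) (Finset.mem_image_of_mem _ hqf)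
    (fun hh => hpq (hinj hh))
  linarith

lemma LS.ty_card (h : LS r W T E x φ η θ) {u : α} {w : ι → α} (hw : ∀ j, φ (w j) = j)
    (hg : Gd φ T W E x θ w) : (Ty φ (Lm φ T E x θ u) w).card +
      (if (Zz T E x θ u w).card ≠ 1 then 1 else 0) ≤ dW r := by
  set Z := Zz T E x θ u w
  obtain ⟨k, hk⟩ : ∃ k, r = k + 2 := ⟨r - 2, by have := h.hr; omega⟩
  have hci := h.hW.ci
  have hun : Unif (k+1) Zᶜ (Ty φ (Lm φ T E x θ u) w) := by
    intro S hS
    have := h.ty hw hg hS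
    exact ⟨this.2.1, by omega⟩
  have hps : PSt k (Ty φ (Lm φ T E x θ u) w) := by
    have := h.ty_pst (u := u) hw hg
    rw [hk] at this; exact this
  have h1 := card_shd hun hps
  have h2 := Finset.card_le_card (shd_sub (k := k) hun)
  rw [h1, Finset.card_powersetCard, Finset.card_compl, hci] at h2
  rcases Nat.lt_or_ge Z.card 2 with hZ | hZ
  · rcases Nat.lt_or_ge Z.card 1 with hZ0 | hZ1
    · have hZe : Z = ∅ := Finset.card_eq_zero.1 (by omega)
      have : Ty φ (Lm φ T E x θ u) w = ∅ := by
        rw [Finset.eq_empty_iff_forall_notMem]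
        intro S hS
        obtain ⟨hc, _, hh⟩ := h.ty hw hg hS
        obtain ⟨i, hi, hiW⟩ := h.hW.compl (by omega) hc
        have := hh i hi hiW
        change i ∈ Z at this
        rw [hZe] at this; simp at this
      rw [this]
      simp only [Finset.card_empty, hZe, dW]
      split_ifs <;> simp
    · have hZe : Z.card = 1 := by omega
      rw [hZe] at h2 ⊢
      rcases h.hr with rfl | rfl
      · have : k = 3 := by omega
        subst this; norm_num [Nat.choose, dW] at h2 ⊢; omega
      · have : k = 4 := by omega
        subst this; norm_num [Nat.choose, dW] at h2 ⊢; omega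
  · have h3 : (r + 6 - Z.card).choose k ≤ (r + 4).choose k := Nat.choose_le_choose _ (by omega)
    rw [if_pos (by omega)]
    have h4 := h2.trans h3
    rcases h.hr with rfl | rfl
    · have : k = 3 := by omega
      subst this; norm_num [Nat.choose, dW] at h4 ⊢; omega
    · have : k = 4 := by omega
      subst this; norm_num [Nat.choose, dW] at h4 ⊢; omega

lemma LS.ty_any (h : LS r W T E x φ η θ) (L : Finset (Finset α)) (w : ι → α) :
    (Ty φ L w).card ≤ 2^12 := by
  refine (Finset.card_le_univ _).trans ?_
  rw [Fintype.card_finset, h.hW.ci]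
  apply Nat.pow_le_pow_right (by norm_num)
  have := h.hr; omega

end Setup
end DensityCH
end

section
namespace DensityCH
open Finset
set_option linter.all false

section Link
variable {α ι : Type*} [DecidableEq α] [DecidableEq ι] [Fintype ι]
variable {r : ℕ} {W : Finset (Finset ι)} {T : Finset α} {E : Finset (Finset α)} {x : α → ℝ}
    {φ : α → ι} {η θ : ℝ}

lemma LS.Lm_PE (h : LS r W T E x φ η θ) {u : α} {L : Finset (Finset α)} (hL : L ⊆ Lm φ T E x θ u) :
    PE L (yy φ T x) = Ex (VV φ T) (yy φ T x) (fun w => ((Ty φ L w).card : ℝ)) := by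
  have h1 : ∀ w, ((Ty φ L w).card : ℝ) = ∑ s ∈ L, if ∀ v ∈ s, w (φ v) = v then (1:ℝ) else 0 := by
    intro w; rw [Ty_card, Finset.sum_boole]
  simp only [h1]
  rw [Ex_sum]
  unfold PE
  refine Finset.sum_congr rfl fun s hs => ?_
  have hs' := Finset.mem_filter.1 (hL hs)
  rw [Ex_marg (V := VV φ T) (φ := φ) (T := T) (fun j => rfl) h.ysum]
  · exact hs'.2.2.trans (Finset.filter_subset _ _)
  · exact Finset.card_image_iff.1 hs'.2.1

lemma dW_bd (hr : r = 5 ∨ r = 6) : 1 ≤ dW r ∧ dW r ≤ 66 := by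
  rcases hr with rfl | rfl <;> simp [dW]

/-- probability that the set of missed colours is not a singleton -/
noncomputable def p2 (φ : α → ι) (T : Finset α) (E : Finset (Finset α)) (x : α → ℝ) (θ : ℝ) (u : α) : ℝ :=
  Ex (VV φ T) (yy φ T x) (fun w => if (Zz T E x θ u w).card ≠ 1 then 1 else 0)

lemma LS.p2_bd (h : LS r W T E x φ η θ) (u : α) : 0 ≤ p2 φ T E x θ u ∧ p2 φ T E x θ u ≤ 1 := by
  constructor
  · rw [← Ex_const h.ysum 0]
    exact Ex_mono h.y0 fun w _ => by split_ifs <;> norm_num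
  · rw [← Ex_const h.ysum 1]
    exact Ex_mono h.y0 fun w _ => by split_ifs <;> norm_num

open scoped Classical in
lemma LS.Y_le (h : LS r W T E x φ η θ) (u : α) :
    PE (Lm φ T E x θ u) (yy φ T x) ≤ dW r - p2 φ T E x θ u + 2^12 * (24^6 * (2 * η)) := by
  rw [h.Lm_PE subset_rfl]
  have hb := h.bad_le
  have h1 : Ex (VV φ T) (yy φ T x) (fun w => ((Ty φ (Lm φ T E x θ u) w).card : ℝ)) ≤
      Ex (VV φ T) (yy φ T x) (fun w => ((dW r : ℝ) - (if (Zz T E x θ u w).card ≠ 1 then 1 else 0)) +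
        2^12 * (if ¬ Gd φ T W E x θ w then 1 else 0)) := by
    apply Ex_mono h.y0
    intro w hw
    have hw' : ∀ j, φ (w j) = j := fun j => (Finset.mem_filter.1 (hw j)).2
    by_cases hg : Gd φ T W E x θ w
    · have := h.ty_card (u := u) hw' hg
      rw [if_neg (not_not.2 hg)]
      have h2 : ((Ty φ (Lm φ T E x θ u) w).card : ℝ) +
        (if (Zz T E x θ u w).card ≠ 1 then 1 else 0) ≤ dW r := by exact_mod_cast this
      linarith
    · rw [if_pos hg]
      have h2 : ((Ty φ (Lm φ T E x θ u) w).card : ℝ) ≤ 2^12 := by exact_mod_cast h.ty_any _ w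
      have h3 : (1:ℝ) ≤ dW r := by exact_mod_cast (dW_bd h.hr).1
      split_ifs <;> linarith
  rw [Ex_add, Ex_sub, Ex_const h.ysum, Ex_cmul] at h1
  refine h1.trans ?_
  unfold p2
  nlinarith

lemma LS.Lm_x (h : LS r W T E x φ η θ) (u : α) :
    PE (Lm φ T E x θ u) x ≤ ((1/((r:ℝ)+6))^(r-1) + ((r-1:ℕ):ℝ) * η) * PE (Lm φ T E x θ u) (yy φ T x) := by
  unfold PE
  rw [Finset.mul_sum]
  refine Finset.sum_le_sum fun s hs => ?_
  have hs' := (Finset.mem_filter.1 hs).1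
  rw [mem_lk] at hs'
  have hc : s.card = r - 1 := by
    have := (h.hE _ hs'.2).2
    rw [Finset.card_insert_of_notMem hs'.1] at this; omega
  have := h.wtx_le s
  rwa [hc] at this

lemma LS.D_p2 (h : LS r W T E x φ η θ) {u : α} (hu : u ∈ T) :
    Dg E x {u} ≤ rlam r - p2 φ T E x θ u / 12^5 + 10^13 * η := by
  have h1 := h.D_le hu
  have h2 := h.Lm_x u
  have h3 := h.Y_le u
  have h4 := h.p2_bd u
  have h5 := rlam_dW h.hr
  have h0 := h.hη0
  have hη := h.hη
  set P := p2 φ T E x θ u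
  set c : ℝ := (1/((r:ℝ)+6))^(r-1) with hc
  have hc1 : 1/12^5 ≤ c ∧ c ≤ 1/2 := by
    rw [hc]; rcases h.hr with rfl | rfl <;> norm_num
  have hr1 : ((r-1:ℕ):ℝ) ≤ 5 := by
    rcases h.hr with rfl | rfl <;> norm_num
  have hr0 : (0:ℝ) ≤ ((r-1:ℕ):ℝ) := by positivity
  obtain ⟨hd1, hd2⟩ := dW_bd h.hr
  have hd1' : (1:ℝ) ≤ dW r := by exact_mod_cast hd1
  have hd2' : (dW r : ℝ) ≤ 66 := by exact_mod_cast hd2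
  have hk : ((r-1:ℕ):ℝ) * η ≤ 5 * η := by nlinarith
  have hk0 : 0 ≤ ((r-1:ℕ):ℝ) * η := by positivity
  set k := ((r-1:ℕ):ℝ) * η
  have h6 : (c + k) * PE (Lm φ T E x θ u) (yy φ T x) ≤
      (c + k) * (dW r - P + 2^12 * (24^6 * (2 * η))) :=
    mul_le_mul_of_nonneg_left h3 (by linarith [hc1.1, (by positivity : (0:ℝ) ≤ 1/12^5)])
  have hck : c + k ≤ 1 := by linarith [hc1.2]
  have h7 : (c + k) * (2^12 * (24^6 * (2 * η))) ≤ 1 * (2^12 * (24^6 * (2 * η))) :=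
    mul_le_mul_of_nonneg_right hck (by positivity)
  have h8 : k * (dW r - P) ≤ 5 * η * 66 := mul_le_mul hk (by linarith) (by linarith) (by positivity)
  have h9 : P / 12^5 ≤ c * P := by
    rw [div_eq_mul_one_div, mul_comm]; exact mul_le_mul_of_nonneg_right hc1.1 h4.1
  have h10 : c * dW r = rlam r := by rw [h5, hc]; ring
  nlinarith

lemma LS.D_up (h : LS r W T E x φ η θ) {u : α} (hu : u ∈ T) :
    Dg E x {u} ≤ rlam r + 10^13 * η := by
  have h1 := h.D_p2 hu
  have h2 := (h.p2_bd u).1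
  have : 0 ≤ p2 φ T E x θ u / 12^5 := by positivity
  linarith

/-- the missed mass in colour `j` -/
noncomputable def nj (φ : α → ι) (T : Finset α) (E : Finset (Finset α)) (x : α → ℝ) (θ : ℝ) (u : α) (j : ι) : ℝ :=
  ∑ v ∈ VV φ T j with v ∉ Nb T E x θ u, yy φ T x v

lemma LS.nj_mul (h : LS r W T E x φ η θ) (u : α) {i j : ι} (hij : i ≠ j) :
    nj φ T E x θ u i * nj φ T E x θ u j ≤ p2 φ T E x θ u := by
  have := Ex_avoid h.ysum {i, j} (fun _ v => v ∉ Nb T E x θ u)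
  rw [Finset.prod_pair hij] at this
  unfold nj p2
  rw [← this]
  apply Ex_mono h.y0
  intro w _
  split_ifs with h1 h2 <;> norm_num
  apply h2
  intro hc
  obtain ⟨a, ha⟩ := Finset.card_eq_one.1 hc
  have hi : i ∈ Zz T E x θ u w := by
    simp only [Zz, Finset.mem_filter, Finset.mem_univ, true_and]; exact h1 i (by simp)
  have hj : j ∈ Zz T E x θ u w := by
    simp only [Zz, Finset.mem_filter, Finset.mem_univ, true_and]; exact h1 j (by simp)
  rw [ha, Finset.mem_singleton] at hi hj
  exact hij (hi.trans hj.symm)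

lemma LS.nj_prod (h : LS r W T E x φ η θ) (u : α) :
    ∏ j, (1 - nj φ T E x θ u j) ≤ p2 φ T E x θ u := by
  have := Ex_avoid h.ysum Finset.univ (fun _ v => v ∈ Nb T E x θ u)
  have h1 : ∀ j, 1 - nj φ T E x θ u j = ∑ v ∈ VV φ T j with v ∈ Nb T E x θ u, yy φ T x v := by
    intro j
    have := h.ysum j
    rw [← Finset.sum_filter_add_sum_filter_not _ (· ∈ Nb T E x θ u)] at this
    unfold nj; linarith
  simp only [h1]
  rw [← this]
  unfold p2
  apply Ex_mono h.y0
  intro w _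
  split_ifs with h1 h2 <;> norm_num
  apply h2
  have : Zz T E x θ u w = ∅ := by
    ext j; simp [Zz]; exact h1 j (Finset.mem_univ j)
  rw [this]; simp

lemma LS.nj0 (h : LS r W T E x φ η θ) (u : α) (j : ι) : 0 ≤ nj φ T E x θ u j :=
  Finset.sum_nonneg fun v _ => h.y0 v

open scoped Classical in
lemma LS.off_le (h : LS r W T E x φ η θ) (u : α) (i : ι) :
    PE (Lm φ T E x θ u \ Lc φ T W E u i) x ≤ 2^12 * (24^6 * (2 * η) + (p2 φ T E x θ u +
      ∑ j ∈ Finset.univ.erase i, nj φ T E x θ u j)) := by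
  have h0 : PE (Lm φ T E x θ u \ Lc φ T W E u i) x ≤ PE (Lm φ T E x θ u \ Lc φ T W E u i) (yy φ T x) :=
    Finset.sum_le_sum fun s _ => h.wtx_le_y s
  refine h0.trans ?_
  rw [h.Lm_PE (u := u) Finset.sdiff_subset]
  have hb := h.bad_le
  have hn : ∀ j, nj φ T E x θ u j = Ex (VV φ T) (yy φ T x)
      (fun w => if w j ∉ Nb T E x θ u then 1 else 0) := by
    intro j
    have := Ex_avoid h.ysum {j} (fun _ v => v ∉ Nb T E x θ u)
    simp only [Finset.mem_singleton, forall_eq, Finset.prod_singleton] at this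
    unfold nj; rw [← this]
  have h1 : Ex (VV φ T) (yy φ T x)
        (fun w => ((Ty φ (Lm φ T E x θ u \ Lc φ T W E u i) w).card : ℝ)) ≤
      Ex (VV φ T) (yy φ T x) (fun w => 2^12 * ((if ¬ Gd φ T W E x θ w then 1 else 0) +
        ((if (Zz T E x θ u w).card ≠ 1 then 1 else 0) +
         ∑ j ∈ Finset.univ.erase i, if w j ∉ Nb T E x θ u then 1 else 0))) := by
    apply Ex_mono h.y0
    intro w hw
    have hw' : ∀ j, φ (w j) = j := fun j => (Finset.mem_filter.1 (hw j)).2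
    have hwT : ∀ j, w j ∈ T := fun j => (Finset.mem_filter.1 (hw j)).1
    have h2 : ((Ty φ (Lm φ T E x θ u \ Lc φ T W E u i) w).card : ℝ) ≤ 2^12 := by
      exact_mod_cast h.ty_any _ w
    have hnn : ∀ j ∈ Finset.univ.erase i, (0:ℝ) ≤ if w j ∉ Nb T E x θ u then 1 else 0 := by
      intro j _; split_ifs <;> norm_num
    have hs0 := Finset.sum_nonneg hnn
    by_cases hg : Gd φ T W E x θ w
    swap
    · rw [if_pos hg]
      have : (0:ℝ) ≤ if (Zz T E x θ u w).card ≠ 1 then 1 else 0 := by split_ifs <;> norm_num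
      linarith
    rw [if_neg (not_not.2 hg)]
    by_cases hZ : (Zz T E x θ u w).card = 1
    swap
    · rw [if_pos hZ]; linarith
    rw [if_neg (not_not.2 hZ)]
    obtain ⟨j, hj⟩ := Finset.card_eq_one.1 hZ
    by_cases hij : j = i
    · subst hij
      have : Ty φ (Lm φ T E x θ u \ Lc φ T W E u j) w = ∅ := by
        rw [Finset.eq_empty_iff_forall_notMem]
        intro S hS
        rw [mem_Ty hw', Finset.mem_sdiff] at hS
        obtain ⟨hS1, hS2⟩ := hS
        obtain ⟨hc, -, ht⟩ := h.ty hw' hg ((mem_Ty hw').2 hS1)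
        obtain ⟨i', hi', hiW⟩ := h.hW.compl (by have := h.hr; omega) hc
        have := ht i' hi' hiW
        rw [hj, Finset.mem_singleton] at this
        subst this
        apply hS2
        unfold Lc
        rw [Finset.mem_inter, mem_BF]
        refine ⟨(Finset.mem_filter.1 hS1).1, ?_, ?_, ?_⟩
        · intro v hv; obtain ⟨k, _, rfl⟩ := Finset.mem_image.1 hv; exact hwT k
        · intro a ha b hb hab
          obtain ⟨k, _, rfl⟩ := Finset.mem_image.1 ha
          obtain ⟨l, _, rfl⟩ := Finset.mem_image.1 hb
          rw [hw' k, hw' l] at hab; rw [hab]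
        · have : (S.image w).image φ = S := by
            rw [Finset.image_image]
            ext k; simp only [Finset.mem_image, Function.comp]
            constructor
            · rintro ⟨l, hl, rfl⟩; rwa [hw' l]
            · intro hk; exact ⟨k, hk, hw' k⟩
          rw [this, mem_lk]; exact ⟨hi', hiW⟩
      rw [this]; simp only [Finset.card_empty, Nat.cast_zero]; positivity
    · have hjZ : j ∈ Zz T E x θ u w := by rw [hj]; simp
      have hjN : w j ∉ Nb T E x θ u := by
        simpa [Zz] using hjZ
      have := Finset.single_le_sum hnn (Finset.mem_erase.2 ⟨hij, Finset.mem_univ j⟩)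
      rw [if_pos hjN] at this
      linarith
  rw [Ex_cmul, Ex_add, Ex_add, Ex_sum] at h1
  refine h1.trans ?_
  simp only [← hn]
  unfold p2
  gcongr

/-- **Link lemma** -/
lemma LS.link (h : LS r W T E x φ η θ) (hη : η ≤ 1/10^30) {u : α} (hu : u ∈ T)
    (hD : rlam r - η ≤ Dg E x {u}) : ∃ i, (∀ j, j ≠ i →
      ∑ v ∈ VV φ T j with v ∉ Nb T E x θ u, x v ≤ 10^20 * η) ∧
      rlam r - 10^25 * η ≤ PE (Lc φ T W E u i) x := by
  have h0 := h.hη0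
  have h1 := h.D_p2 hu
  have hp : p2 φ T E x θ u ≤ 10^19 * η := by
    have : p2 φ T E x θ u / 12^5 ≤ (10^13 + 1) * η := by linarith
    rw [div_le_iff₀ (by norm_num)] at this
    nlinarith
  have hp0 := (h.p2_bd u).1
  set P := p2 φ T E x θ u with hP
  have hex : ∃ i, 1/2 ≤ nj φ T E x θ u i := by
    by_contra hcon
    push Not at hcon
    have h2 := h.nj_prod u
    have h3 : ∏ j : ι, (1/2:ℝ) ≤ ∏ j, (1 - nj φ T E x θ u j) :=
      Finset.prod_le_prod (fun _ _ => by norm_num) fun j _ => by linarith [hcon j]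
    rw [Finset.prod_const, Finset.card_univ, h.hW.ci] at h3
    have h4 : (1/2:ℝ)^12 ≤ (1/2)^(r+6) :=
      pow_le_pow_of_le_one (by norm_num) (by norm_num) (by have := h.hr; omega)
    have : (10:ℝ)^19 * η < (1/2)^12 := by norm_num at hη ⊢; linarith
    linarith
  obtain ⟨i, hi⟩ := hex
  have hj : ∀ j, j ≠ i → nj φ T E x θ u j ≤ 2 * P := by
    intro j hji
    have h2 := h.nj_mul u hji
    have := h.nj0 u j
    nlinarith
  refine ⟨i, ?_, ?_⟩
  · intro j hji
    have h2 : ∑ v ∈ VV φ T j with v ∉ Nb T E x θ u, x v ≤ nj φ T E x θ u j := by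
      unfold nj
      refine Finset.sum_le_sum fun v _ => ?_
      rw [h.xy v]
      have := h.y0 v
      have := pt_le φ h.hx h.h1 (φ v)
      nlinarith
    have := hj j hji
    nlinarith
  · have h2 := h.off_le u i
    have h3 : ∑ j ∈ Finset.univ.erase i, nj φ T E x θ u j ≤ 11 * (2 * P) := by
      have := Finset.sum_le_card_nsmul (Finset.univ.erase i) (nj φ T E x θ u) (2*P)
        (fun j hj' => hj j (Finset.ne_of_mem_erase hj'))
      rw [Finset.card_erase_of_mem (Finset.mem_univ _), Finset.card_univ, h.hW.ci, nsmul_eq_mul] at this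
      refine this.trans (mul_le_mul_of_nonneg_right ?_ (by linarith))
      rcases h.hr with rfl | rfl <;> norm_num
    have h4 := h.D_le hu
    have h5 : PE (Lm φ T E x θ u) x ≤ PE (Lm φ T E x θ u \ Lc φ T W E u i) x + PE (Lc φ T W E u i) x := by
      refine le_trans (PE_mono h.hx ?_) (PE_union_le h.hx _ _)
      intro s hs; rw [Finset.mem_union, Finset.mem_sdiff]; tauto
    nlinarith

end Link
end DensityCH
end

section
namespace DensityCH
open Finset
set_option linter.all false

section LemR
variable {α ι : Type*} [DecidableEq α] [DecidableEq ι] [Fintype ι]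
variable {r : ℕ} {W : Finset (Finset ι)} {T : Finset α} {E : Finset (Finset α)} {x : α → ℝ}
    {φ : α → ι} {η θ : ℝ}

lemma sum_shadow {k : ℕ} {M : Finset (Finset α)} (hM : Unif (k+1) T M) (x : α → ℝ) :
    ∑ R ∈ T.powersetCard k, wt x R * Dg M x R = (k+1) * PE M x := by
  have h1 : ∀ R ∈ T.powersetCard k, wt x R * Dg M x R = ∑ e ∈ M.filter (R ⊆ ·), wt x e := by
    intro R _; rw [← PE_through]; rfl
  rw [Finset.sum_congr rfl h1]
  rw [Finset.sum_comm' (t' := M) (s' := fun e => e.powersetCard k) (by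
    intro R e
    simp only [Finset.mem_filter, Finset.mem_powersetCard]
    constructor
    · rintro ⟨⟨_, h⟩, h2, h3⟩; exact ⟨⟨h3, h⟩, h2⟩
    · rintro ⟨⟨h3, h⟩, h2⟩; exact ⟨⟨h3.trans (hM e h2).1, h⟩, h2, h3⟩)]
  unfold PE
  rw [Finset.mul_sum]
  refine Finset.sum_congr rfl fun e he => ?_
  rw [Finset.sum_const, Finset.card_powersetCard, (hM e he).2, Nat.choose_succ_self_right, nsmul_eq_mul]
  push_cast; ring

lemma LS.typ (h : LS r W T E x φ η θ) {v : α} (hv : v ∈ T) (hn : v ∉ Aty r φ T W E x) :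
    2/3 * rlam r ≤ PE (Lc φ T W E v (φ v)) x := by
  by_contra hc
  exact hn (Finset.mem_filter.2 ⟨hv, not_le.1 hc⟩)

lemma LS.Lc_disj (h : LS r W T E x φ η θ) (v : α) {i j : ι} (hij : i ≠ j) :
    PE (Lc φ T W E v i) x + PE (Lc φ T W E v j) x ≤ Dg E x {v} := by
  have hd : Disjoint (Lc φ T W E v i) (Lc φ T W E v j) := by
    rw [Finset.disjoint_left]
    intro s hs hs'
    have h1 := (mem_BF.1 (Finset.mem_inter.1 hs).2).2.2
    have h2 := (mem_BF.1 (Finset.mem_inter.1 hs').2).2.2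
    rw [mem_lk] at h1 h2
    exact hij (h.hW.eq_of (by have := h.hr; omega) h1.1 h2.1 h1.2 h2.2)
  have : PE (Lc φ T W E v i ∪ Lc φ T W E v j) x = _ := Finset.sum_union hd
  rw [Dg_lk]
  change _ = PE _ x + PE _ x at this
  rw [← this]
  exact PE_mono h.hx (Finset.union_subset Finset.inter_subset_left Finset.inter_subset_left)

lemma LS.P_up (h : LS r W T E x φ η θ) : PE E x ≤ lam r + 10^13 * η := by
  have h1 := sum_x_Dg h.hE x
  have h2 : ∑ v ∈ T, x v * Dg E x {v} ≤ ∑ v ∈ T, x v * (rlam r + 10^13*η) :=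
    Finset.sum_le_sum fun v hv => mul_le_mul_of_nonneg_left (h.D_up hv) (h.hx v)
  rw [← Finset.sum_mul, h.h1, h1, ← r_lam h.hr] at h2
  have hr : (5:ℝ) ≤ r := by rcases h.hr with h | h <;> rw [h] <;> norm_num
  have := h.hη0
  have h3 : (r:ℝ) * PE E x ≤ r * (lam r + 10^13*η) := by nlinarith
  exact le_of_mul_le_mul_left h3 (by linarith)

/-- **Lemma R** -/
theorem LS.lemR (h : LS r W T E x φ η θ) (hη : η ≤ 1/10^40)
    (hD : ∀ v ∈ T, rlam r - η ≤ Dg E x {v}) :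
    ∃ ψ : α → ι, PE (E \ BF ψ T W) x ≤ 1/2 * PE (BF ψ T W \ E) x := by
  have h0 := h.hη0
  have hr1 : 0 < r := by have := h.hr; omega
  have hrl := rlam_lb h.hr
  have hch : ∀ v : α, ∃ i, v ∈ T → (∀ j, j ≠ i →
      ∑ b ∈ VV φ T j with b ∉ Nb T E x θ v, x b ≤ 10^20 * η) ∧
      rlam r - 10^25 * η ≤ PE (Lc φ T W E v i) x := by
    intro v
    by_cases hv : v ∈ T
    · obtain ⟨i, hi⟩ := h.link (by norm_num at hη ⊢; linarith) hv (hD v hv)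
      exact ⟨i, fun _ => hi⟩
    · exact ⟨φ v, fun hh => absurd hh hv⟩
  choose ψ hψ using hch
  have hbig : ∀ v ∈ T, 2/3 * rlam r ≤ PE (Lc φ T W E v (ψ v)) x := by
    intro v hv
    have := (hψ v hv).2
    norm_num at hη; linarith
  have hagree : ∀ v ∈ T, v ∉ Aty r φ T W E x → ψ v = φ v := by
    intro v hv hn
    by_contra hne
    have h1 := h.Lc_disj v hne
    have h2 := h.typ hv hn
    have h3 := (hψ v hv).2
    have h4 := h.D_up hv
    norm_num at hη; linarith
  have hinj : ∀ e ∈ E, Set.InjOn ψ (e : Set α) := by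
    intro e he b hb c hc hbc
    by_contra hne
    have hbT := (h.hE e he).1 hb
    have hcT := (h.hE e he).1 hc
    exact h.two_col hne he hb hc (hbig b hbT) (by rw [hbc]; exact hbig c hcT)
  refine ⟨ψ, ?_⟩
  obtain ⟨k, hk⟩ : ∃ k, r = k + 1 := ⟨r - 1, by omega⟩
  set B := E \ BF ψ T W with hB
  set M := BF ψ T W \ E with hM
  have hBu : Unif (k+1) T B := by rw [← hk]; exact unif_mono h.hE Finset.sdiff_subset
  have hMu : Unif (k+1) T M := by
    intro e he
    have := mem_BF.1 (Finset.mem_sdiff.1 he).1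
    refine ⟨this.1, ?_⟩
    rw [← Finset.card_image_iff.2 this.2.1, ← hk]
    exact h.hW.ce _ this.2.2
  -- shadow estimate
  have hsh : ∀ R ∈ shd k B, 1/30 ≤ Dg M x R := by
    intro R hR
    obtain ⟨e, he, hRe, hRc⟩ := mem_shd.1 hR
    have heE := (Finset.mem_sdiff.1 he).1
    have heT := (h.hE e heE).1
    have hec : e.card = k + 1 := (hBu e he).2
    have hie := hinj e heE
    obtain ⟨v, hvR, hve⟩ : ∃ v, v ∉ R ∧ insert v R = e := by
      have h1 : (e \ R).card = 1 := by rw [Finset.card_sdiff_of_subset hRe]; omega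
      obtain ⟨v, hv⟩ := Finset.card_eq_one.1 h1
      have hv' : v ∈ e \ R := by rw [hv]; simp
      rw [Finset.mem_sdiff] at hv'
      refine ⟨v, hv'.2, Finset.eq_of_subset_of_card_le (Finset.insert_subset hv'.1 hRe) ?_⟩
      rw [Finset.card_insert_of_notMem hv'.2]; omega
    have hvT : v ∈ T := heT (by rw [← hve]; simp)
    have hRi : Set.InjOn ψ (R : Set α) := hie.mono (by exact_mod_cast hRe)
    have hSc : (R.image ψ).card = r - 1 := by rw [Finset.card_image_iff.2 hRi]; omega
    obtain ⟨j, hj, hjW⟩ := h.hW.compl hr1 hSc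
    have hjv : j ≠ ψ v := by
      rintro rfl
      apply (Finset.mem_sdiff.1 he).2
      rw [mem_BF]
      refine ⟨heT, hie, ?_⟩
      rw [← hve, Finset.image_insert]; exact hjW
    set A := (VV φ T j).filter fun w => w ∈ Nb T E x θ v ∧ w ∉ Aty r φ T W E x with hA
    have hAx : 1/30 ≤ ∑ w ∈ A, x w := by
      have h1 : pt φ T x j ≤ ∑ w ∈ A, x w + (∑ b ∈ VV φ T j with b ∉ Nb T E x θ v, x b +
          ∑ b ∈ Aty r φ T W E x, x b) := by
        have hs : VV φ T j ⊆ A ∪ ((VV φ T j).filter (fun b => b ∉ Nb T E x θ v) ∪ Aty r φ T W E x) := by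
          intro w hw
          simp only [hA, Finset.mem_union, Finset.mem_filter]
          tauto
        have hsu : ∀ X Y : Finset α, ∑ w ∈ X ∪ Y, x w ≤ ∑ w ∈ X, x w + ∑ w ∈ Y, x w := by
          intro X Y
          rw [← Finset.sum_union_inter]
          linarith [Finset.sum_nonneg (s := X ∩ Y) (fun v _ => h.hx v)]
        calc pt φ T x j = ∑ w ∈ VV φ T j, x w := rfl
          _ ≤ _ := Finset.sum_le_sum_of_subset_of_nonneg hs fun v _ _ => h.hx v
          _ ≤ _ := hsu _ _
          _ ≤ _ := by linarith [hsu ((VV φ T j).filter (fun b => b ∉ Nb T E x θ v)) (Aty r φ T W E x)]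
      have h2 := h.pt_lb j
      have h3 := (hψ v hvT).1 j hjv
      have h4 := h.Aty_le
      norm_num at hη; linarith
    have hins : ∀ w ∈ A, w ∉ R ∧ insert w R ∈ M := by
      intro w hw
      obtain ⟨hwV, hwN, hwA⟩ := Finset.mem_filter.1 hw
      obtain ⟨hwT, hwφ⟩ := Finset.mem_filter.1 hwV
      have hψw : ψ w = j := by rw [hagree w hwT hwA, hwφ]
      have hwR : w ∉ R := fun hh => hj (by rw [← hψw]; exact Finset.mem_image_of_mem _ hh)
      refine ⟨hwR, ?_⟩
      rw [hM, Finset.mem_sdiff]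
      constructor
      · rw [mem_BF]
        refine ⟨Finset.insert_subset hwT (hRe.trans heT), ?_, ?_⟩
        · rw [Finset.coe_insert, Set.injOn_insert (by exact_mod_cast hwR)]
          refine ⟨hRi, ?_⟩
          rw [hψw]
          intro hh
          apply hj
          obtain ⟨z, hz, hz'⟩ := hh
          exact Finset.mem_image.2 ⟨z, hz, hz'⟩
        · rw [Finset.image_insert, hψw]; exact hjW
      · intro hwE
        obtain ⟨-, hwv, hlt⟩ := Finset.mem_filter.1 hwN
        have := h.ap.P1 R v w (Ne.symm hwv) hvR hwR (by rw [hve]; exact heE) hwE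
        linarith
    refine hAx.trans ?_
    unfold Dg
    have hinjA : Set.InjOn (fun w => insert w R) (A : Set α) := by
      intro a ha b hb hab
      have h1 := (hins a ha).1
      have : a ∈ insert b R := by
        rw [← (show insert a R = insert b R from hab)]; simp
      rw [Finset.mem_insert] at this
      tauto
    have h5 : ∑ w ∈ A, x w = ∑ f ∈ A.image (fun w => insert w R), wt x (f \ R) := by
      rw [Finset.sum_image hinjA]
      refine Finset.sum_congr rfl fun w hw => ?_
      have : insert w R \ R = {w} := by
        ext z; simp only [Finset.mem_sdiff, Finset.mem_insert, Finset.mem_singleton]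
        have := (hins w hw).1
        constructor
        · rintro ⟨h1 | h1, h2⟩
          · exact h1
          · exact absurd h1 h2
        · rintro rfl; exact ⟨Or.inl rfl, this⟩
      rw [this]; simp [wt]
    rw [h5]
    apply Finset.sum_le_sum_of_subset_of_nonneg
    · intro f hf
      obtain ⟨w, hw, rfl⟩ := Finset.mem_image.1 hf
      exact Finset.mem_filter.2 ⟨(hins w hw).2, Finset.subset_insert _ _⟩
    · intro f _ _; exact wt_nonneg h.hx _
  have h6 : PE (shd k B) x * (1/30) ≤ (k+1) * PE M x := by
    rw [← sum_shadow hMu]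
    unfold PE
    rw [Finset.sum_mul]
    calc ∑ R ∈ shd k B, wt x R * (1/30) ≤ ∑ R ∈ shd k B, wt x R * Dg M x R :=
          Finset.sum_le_sum fun R hR => mul_le_mul_of_nonneg_left (hsh R hR) (wt_nonneg h.hx _)
      _ ≤ _ := Finset.sum_le_sum_of_subset_of_nonneg (shd_sub hBu) fun R _ _ =>
          mul_nonneg (wt_nonneg h.hx _) (Dg_nonneg h.hx _ _)
  -- smallness of B
  have h7 : PE (E ∩ BF φ T W) x ≤ PE (E ∩ BF ψ T W) x + 10^7 * η := by
    have hs : E ∩ BF φ T W ⊆ (E ∩ BF ψ T W) ∪ (E.filter fun s => ∃ a ∈ Aty r φ T W E x, a ∈ s) := by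
      intro e he
      obtain ⟨he1, he2⟩ := Finset.mem_inter.1 he
      rw [Finset.mem_union, Finset.mem_inter, Finset.mem_filter]
      by_cases hh : ∃ a ∈ Aty r φ T W E x, a ∈ e
      · exact Or.inr ⟨he1, hh⟩
      · left
        refine ⟨he1, ?_⟩
        push Not at hh
        rw [mem_BF] at he2 ⊢
        have : ∀ v ∈ e, ψ v = φ v := fun v hv => hagree v (he2.1 hv) (fun hc => hh v hc hv)
        refine ⟨he2.1, hinj e he1, ?_⟩
        rw [Finset.image_congr (g := φ) (fun v hv => this v hv)]
        exact he2.2.2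
    have h8 := PE_meet h.hx (L := E) (A := Aty r φ T W E x) (c := 1) (by
      intro a _
      rw [Dg_lk]
      have hE' := h.hE
      rw [hk] at hE'
      exact Dg_le_one h.hx h.h1 (unif_sup (Finset.erase_subset _ _) (unif_lk hE' a)))
    have h9 := (PE_mono h.hx hs).trans (PE_union_le h.hx _ _)
    have := h.Aty_le
    linarith
  have h8 : PE B x + PE (E ∩ BF ψ T W) x = PE E x := by
    rw [hB]
    unfold PE
    rw [add_comm]
    exact Finset.sum_inter_add_sum_sdiff _ _ _
  have h9 := h.P_up
  have h10 := h.hP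
  have hBs : PE B x ≤ 10^14 * η := by linarith
  have hr6 : k + 1 ≤ 6 := by have := h.hr; omega
  have h11 := small_shd h.hx (η := 1/360) (by norm_num) hBu (by
    have : (1/360:ℝ)^6/720 ≤ (1/360)^(k+1)/(k+1).factorial := by
      apply div_le_div₀ (by positivity)
      · exact pow_le_pow_of_le_one (by norm_num) (by norm_num) hr6
      · positivity
      · have := Nat.factorial_le hr6
        exact_mod_cast this
    refine lt_of_lt_of_le ?_ this
    norm_num at hη ⊢; linarith)
  have hk6 : (k:ℝ) + 1 ≤ 6 := by exact_mod_cast hr6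
  have h12 := PE_nonneg h.hx M
  nlinarith

/-- consequence : the weight identity -/
lemma PE_swap (E F : Finset (Finset α)) (x : α → ℝ) :
    PE E x = PE F x - PE (F \ E) x + PE (E \ F) x := by
  have h1 : PE (E ∩ F) x + PE (E \ F) x = PE E x := Finset.sum_inter_add_sum_sdiff _ _ _
  have h2 : PE (F ∩ E) x + PE (F \ E) x = PE F x := Finset.sum_inter_add_sum_sdiff _ _ _
  rw [Finset.inter_comm] at h2
  linarith

end LemR
end DensityCH
end

section
namespace DensityCH
open Finset
set_option linter.all false

section Search

/-- search data -/
def q5 : List ℕ := [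
  135, 263, 519, 75, 267, 523, 83, 147, 531, 547, 195, 45, 77, 141, 269, 525,
  53, 85, 149, 277, 533, 165, 293, 549, 197, 325, 581, 57, 89, 153, 281, 537,
  105, 297, 553, 201, 393, 649, 113, 177, 337, 401, 785, 225, 353, 417, 705, 833,
  897, 46, 78, 142, 270, 526, 54, 86, 150, 278, 534, 166, 294, 198, 326, 582,
  58, 90, 154, 282, 538, 106, 298, 202, 394, 650, 114, 178, 338, 402, 786, 226,
  354, 418, 706, 834, 898, 60, 92, 156, 284, 108, 172, 332, 396, 780, 116, 308,
  212, 404, 660, 228, 356, 612, 676, 804, 452, 900, 184, 312, 216, 344, 600, 232,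
  616, 424, 680, 808, 456, 840, 240, 368, 624, 432, 688, 816, 464, 720]
/-- search data -/
def w5 : List ℕ := [
  31, 103, 122, 171, 188, 205, 214, 241, 301, 307, 334, 345, 372, 405, 410, 422,
  451, 488, 558, 565, 595, 604, 617, 647, 665, 690, 714, 740, 779, 790, 824, 837,
  866, 908, 929, 976, 1078, 1081, 1099, 1109, 1132, 1166, 1171, 1189, 1240, 1250, 1287, 1308,
  1322, 1362, 1377, 1417, 1456, 1476, 1549, 1562, 1571, 1606, 1648, 1684, 1704, 1729, 1809, 1828,
  1864, 1922]
/-- search data -/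
def q6 : List ℕ := [
  94, 158, 286, 110, 174, 1070, 590, 398, 118, 182, 566, 214, 1302, 230, 806, 454,
  838, 1670, 122, 314, 570, 346, 666, 618, 426, 458, 1226, 1802, 370, 1202, 466, 1618,
  914, 738, 1378, 930, 124, 188, 316, 220, 1564, 236, 812, 716, 1356, 908, 372, 692,
  1236, 852, 916, 484, 1636, 1444, 1144, 440, 728, 856, 1432, 488, 872, 1704, 496, 752,
  1840, 1984]
/-- search data -/
def w6 : List ℕ := [
  250, 366, 438, 476, 636, 686, 726, 798, 882, 952, 970, 996, 1142, 1182, 1260, 1340,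
  1370, 1450, 1478, 1520, 1594, 1614, 1716, 1752, 1762, 1830, 1876, 1896, 1932, 1938, 2142, 2236,
  2278, 2362, 2420, 2446, 2514, 2536, 2614, 2666, 2714, 2764, 2800, 2860, 2886, 2904, 2964, 2978,
  3118, 3192, 3250, 3274, 3284, 3350, 3404, 3426, 3480, 3492, 3612, 3666, 3684, 3718, 3752, 3850,
  3888, 4032]
/-- search data -/
def prm : List (List ℕ) := [
  [0, 1, 2, 3, 4, 5, 6, 7, 8, 9, 10],
  [0, 1, 2, 3, 4, 8, 10, 9, 5, 7, 6],
  [0, 1, 2, 3, 4, 7, 9, 5, 10, 6, 8],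
  [0, 1, 2, 3, 4, 10, 8, 6, 7, 5, 9],
  [0, 1, 2, 3, 4, 9, 7, 8, 6, 10, 5],
  [0, 1, 2, 3, 4, 6, 5, 10, 9, 8, 7],
  [0, 1, 2, 3, 4, 8, 9, 10, 5, 7, 6],
  [0, 1, 2, 3, 4, 5, 6, 7, 8, 10, 9],
  [0, 1, 2, 3, 4, 10, 7, 8, 6, 9, 5],
  [0, 1, 2, 3, 4, 6, 5, 9, 10, 8, 7],
  [0, 1, 2, 3, 4, 7, 10, 5, 9, 6, 8],
  [0, 1, 2, 3, 4, 9, 8, 6, 7, 5, 10]]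

/-- points of a mask -/
def ms (m b : ℕ) : Finset (Fin m) := Finset.univ.filter fun i => b.testBit i
/-- popcount -/
def pc (b : ℕ) : ℕ → ℕ
  | 0 => 0
  | n+1 => pc b n + (b.testBit n).toNat
/-- covering test -/
def cov (q b : ℕ) : Bool := Nat.beq (Nat.land q b) q
/-- at most two bits -/
def z2 (z : ℕ) : Bool :=
  Nat.beq (Nat.land (Nat.land z (Nat.sub z 1)) (Nat.sub (Nat.land z (Nat.sub z 1)) 1)) 0
/-- the search -/
def go (ps : List ℕ) (leaf : List ℕ → Bool) : List ℕ → List ℕ → Bool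
  | [], bs => leaf bs
  | q :: qs, bs => bif bs.any (cov q) then go ps leaf qs bs else
      ps.all fun p => (!(Nat.beq (Nat.land q p) 0)) ||
        (bs.any (fun b => z2 (Nat.xor (Nat.lor q p) b)) || go ps leaf qs (Nat.lor q p :: bs))
/-- apply a permutation to a mask -/
def ap (l : List ℕ) (b : ℕ) : ℕ → ℕ
  | 0 => 0
  | n+1 => bif b.testBit n then Nat.lor (ap l b n) (2^(l.getD n 0)) else ap l b n
/-- leaf test -/
def leaf5 (bs : List ℕ) : Bool :=
  prm.any fun l => w5.all fun b => bs.any fun c => Nat.beq c (ap l b 11)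
/-- leaf test -/
def leaf6 (bs : List ℕ) : Bool := w6.all fun b => bs.any fun c => Nat.beq c b

set_option maxRecDepth 100000

lemma go5 : go [1,2,4,8,16,32,64,128,256,512,1024] leaf5 q5 [31, 103, 171, 307] = true := by
  decide +kernel
lemma go6 : go [1,2,4,8,16,32,64,128,256,512,1024,2048] leaf6 q6 (w5.map fun b => 2*b+1) = true := by
  decide +kernel
lemma z2_spec : ∀ z < 4096, z2 z = true → pc z 12 ≤ 2 := by decide +kernel
lemma q5_spec : ∀ q ∈ q5, q < 2048 ∧ pc q 11 = 4 := by decide +kernel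
lemma q6_spec : ∀ q ∈ q6, q < 4096 ∧ pc q 12 = 5 := by decide +kernel
lemma prm_spec : ∀ l ∈ prm, l.length = 11 ∧ l.Nodup ∧ ∀ a ∈ l, a < 11 := by decide +kernel
lemma w5_spec : w5.Nodup ∧ w5.length = 66 ∧ ∀ q ∈ w5, q < 2048 := by decide +kernel
lemma w6_spec : ((w5.map fun b => 2*b+1) ++ w6).Nodup ∧ w6.length = 66 ∧ ∀ q ∈ w6, q < 4096 := by
  decide +kernel

lemma mem_ms {m b : ℕ} {i : Fin m} : i ∈ ms m b ↔ b.testBit i = true := by simp [ms]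

lemma ms_card (m b : ℕ) : (ms m b).card = pc b m := by
  unfold ms
  rw [Finset.card_filter]
  induction m with
  | zero => simp [pc]
  | succ m ih =>
    rw [Fin.sum_univ_castSucc, pc]
    simp only [Fin.val_castSucc, Fin.val_last]
    rw [ih]
    by_cases hb : b.testBit m = true <;> simp [hb]

lemma pc_mono (b : ℕ) {m n : ℕ} (h : m ≤ n) : pc b m ≤ pc b n := by
  induction h with
  | refl => rfl
  | step _ ih => rw [pc]; omega

lemma ms_inj {m a b : ℕ} (ha : a < 2^m) (hb : b < 2^m) (h : ms m a = ms m b) : a = b := by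
  apply Nat.eq_of_testBit_eq
  intro i
  by_cases hi : i < m
  · have : (⟨i, hi⟩ : Fin m) ∈ ms m a ↔ (⟨i, hi⟩ : Fin m) ∈ ms m b := by rw [h]
    rw [mem_ms, mem_ms] at this
    exact Bool.eq_iff_iff.2 this
  · push Not at hi
    have hp : 2^m ≤ 2^i := Nat.pow_le_pow_right (by norm_num) hi
    rw [Nat.testBit_lt_two_pow (by omega), Nat.testBit_lt_two_pow (by omega)]

lemma cov_of {m q b : ℕ} (hq : q < 2^m) (h : ms m q ⊆ ms m b) : cov q b = true := by
  unfold cov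
  rw [Nat.beq_eq]
  change q &&& b = q
  apply ms_inj (m := m) (lt_of_le_of_lt Nat.and_le_left hq) hq
  ext i
  rw [mem_ms, Nat.testBit_and, mem_ms, Bool.and_eq_true]
  constructor
  · exact fun h => h.1
  · exact fun hi => ⟨hi, mem_ms.1 (h (mem_ms.2 hi))⟩

lemma cov_imp {m q b : ℕ} (h : cov q b = true) : ms m q ⊆ ms m b := by
  unfold cov at h
  rw [Nat.beq_eq] at h
  change q &&& b = q at h
  intro i hi
  rw [mem_ms] at hi ⊢
  rw [← h, Nat.testBit_and, Bool.and_eq_true] at hi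
  exact hi.2

lemma ms_lor (m q x : ℕ) (hx : x < m) : ms m (Nat.lor q (2^x)) = insert ⟨x, hx⟩ (ms m q) := by
  ext i
  rw [Finset.mem_insert, mem_ms, mem_ms]
  change (q ||| 2^x).testBit i = true ↔ _
  rw [Nat.testBit_or, Nat.testBit_two_pow, Bool.or_eq_true, decide_eq_true_eq, Fin.ext_iff]
  simp only; tauto

lemma conf_spec {m r a b : ℕ} (hm : m ≤ 12) (ha : a < 2^m) (hb : b < 2^m) (hac : (ms m a).card = r)
    (hbc : (ms m b).card = r) (h : z2 (Nat.xor a b) = true) : r ≤ (ms m a ∩ ms m b).card + 1 := by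
  have h1 : Nat.xor a b < 2^m := Nat.xor_lt_two_pow ha hb
  have h2 : (2:ℕ)^m ≤ 2^12 := Nat.pow_le_pow_right (by norm_num) hm
  have h3 := z2_spec _ (by norm_num at h2; omega) h
  have h4 := (ms_card m (Nat.xor a b)).trans_le (pc_mono _ hm)
  have h5 : ms m a \ ms m b ∪ ms m b \ ms m a ⊆ ms m (Nat.xor a b) := by
    intro i hi
    rw [mem_ms]
    change (a ^^^ b).testBit i = true
    rw [Nat.testBit_xor]
    simp only [Finset.mem_union, Finset.mem_sdiff, mem_ms] at hi
    rcases hi with ⟨h1, h2⟩ | ⟨h1, h2⟩ <;> simp [h1, h2]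
  have h6 := Finset.card_le_card h5
  rw [Finset.card_union_of_disjoint (by
    rw [Finset.disjoint_left]; intro i hi hi'; simp only [Finset.mem_sdiff] at hi hi'; tauto)] at h6
  have h7 := Finset.card_sdiff_add_card_inter (ms m a) (ms m b)
  have h8 := Finset.card_sdiff_add_card_inter (ms m b) (ms m a)
  rw [Finset.inter_comm] at h8
  omega

variable {ι : Type*} [DecidableEq ι] [Fintype ι] {r : ℕ} {W : Finset (Finset ι)}

lemma go_sound (hr : 0 < r) (hW : St r W) {m : ℕ} (hm : m ≤ 12) (g : Fin m → ι) (hg : Function.Bijective g)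
    (ps : List ℕ) (hps : ∀ x < m, 2^x ∈ ps) (leaf : List ℕ → Bool) : ∀ (qs bs : List ℕ),
    (∀ q ∈ qs, q < 2^m ∧ pc q m = r - 1) → (∀ b ∈ bs, b < 2^m ∧ (ms m b).image g ∈ W) →
    go ps leaf qs bs = true → ∃ bs', leaf bs' = true ∧ ∀ b ∈ bs', b < 2^m ∧ (ms m b).image g ∈ W := by
  intro qs
  induction qs with
  | nil => intro bs _ hb h; exact ⟨bs, h, hb⟩
  | cons q qs ih =>
    intro bs hq hb h
    rw [go] at h
    have hq' : ∀ q ∈ qs, q < 2^m ∧ pc q m = r - 1 := fun q h => hq q (List.mem_cons_of_mem _ h)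
    by_cases hc : bs.any (cov q) = true
    · rw [hc, cond_true] at h
      exact ih bs hq' hb h
    · rw [Bool.not_eq_true] at hc
      rw [hc, cond_false, List.all_eq_true] at h
      obtain ⟨hq1, hq2⟩ := hq q List.mem_cons_self
      have hqc : (ms m q).card = r - 1 := by rw [ms_card, hq2]
      obtain ⟨i, hi, hiW⟩ := hW.compl hr (S := (ms m q).image g) (by
        rw [Finset.card_image_of_injective _ hg.1, hqc])
      obtain ⟨x, rfl⟩ := hg.2 i
      have hxq : x ∉ ms m q := fun hh => hi (Finset.mem_image_of_mem _ hh)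
      have hnb : ms m (Nat.lor q (2^x.1)) = insert x (ms m q) := ms_lor m q x x.2
      have hnW : (ms m (Nat.lor q (2^x.1))).image g ∈ W := by
        rw [hnb, Finset.image_insert]; exact hiW
      have hx2 : (2:ℕ)^x.1 < 2^m := Nat.pow_lt_pow_right (by norm_num) x.2
      have hnlt : Nat.lor q (2^x.1) < 2^m := Nat.or_lt_two_pow hq1 hx2
      have h1 := h _ (hps x x.2)
      rw [Bool.or_eq_true, Bool.or_eq_true] at h1
      rcases h1 with h1 | h1 | h1
      · exfalso
        have : Nat.land q (2^x.1) = 0 := by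
          change q &&& 2^x.1 = 0
          apply Nat.eq_of_testBit_eq
          intro j
          rw [Nat.testBit_and, Nat.testBit_two_pow, Nat.zero_testBit]
          by_cases hj : x.1 = j
          · subst hj; rw [mem_ms, Bool.not_eq_true] at hxq; simp [hxq]
          · simp [hj]
        rw [this] at h1; simp at h1
      · exfalso
        rw [List.any_eq_true] at h1
        obtain ⟨b, hbm, hbz⟩ := h1
        obtain ⟨hb1, hb2⟩ := hb b hbm
        have hcard : ∀ c, (ms m c).image g ∈ W → (ms m c).card = r := by
          intro c hcW
          rw [← Finset.card_image_of_injective _ hg.1]; exact hW.ce _ hcW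
        have h2 := conf_spec hm hnlt hb1 (hcard _ hnW) (hcard _ hb2) hbz
        have h3 : (ms m (Nat.lor q (2^x.1))).image g = (ms m b).image g := by
          apply hW.pst _ hnW _ hb2
          rw [← Finset.image_inter _ _ hg.1, Finset.card_image_of_injective _ hg.1]; omega
        have h4 := Finset.image_injective hg.1 h3
        have h5 : cov q b = true := cov_of hq1 (by rw [← h4, hnb]; exact Finset.subset_insert _ _)
        rw [List.any_eq_false] at hc
        exact hc b hbm h5
      · apply ih _ hq' _ h1
        intro b hbm
        rcases List.mem_cons.1 hbm with rfl | hbm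
        · exact ⟨hnlt, hnW⟩
        · exact hb b hbm

lemma ap_spec (l : List ℕ) (b n y : ℕ) :
    (ap l b n).testBit y = true ↔ ∃ i < n, b.testBit i = true ∧ l.getD i 0 = y := by
  induction n with
  | zero => simp [ap]
  | succ n ih =>
    rw [ap]
    cases hb : b.testBit n
    · rw [cond_false, ih]
      constructor
      · rintro ⟨i, hi, h⟩; exact ⟨i, by omega, h⟩
      · rintro ⟨i, hi, h⟩
        refine ⟨i, ?_, h⟩
        rcases Nat.lt_succ_iff_lt_or_eq.1 hi with h1 | rfl
        · exact h1
        · rw [hb] at h; simp at h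
    · rw [cond_true]
      change (ap l b n ||| 2^(l.getD n 0)).testBit y = true ↔ _
      rw [Nat.testBit_or, Nat.testBit_two_pow, Bool.or_eq_true, ih, decide_eq_true_eq]
      constructor
      · rintro (⟨i, hi, h⟩ | h)
        · exact ⟨i, by omega, h⟩
        · exact ⟨n, by omega, hb, h⟩
      · rintro ⟨i, hi, h⟩
        rcases Nat.lt_succ_iff_lt_or_eq.1 hi with h1 | rfl
        · exact Or.inl ⟨i, h1, h⟩
        · exact Or.inr h.2

end Search
end DensityCH
end

section
namespace DensityCH
open Finset
set_option linter.all false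

section Uniq
variable {ι : Type*} [DecidableEq ι] [Fintype ι] {r : ℕ} {W : Finset (Finset ι)}

lemma St.card (hW : St r W) (hr : 0 < r) : W.card * r = (r+6).choose (r-1) := by
  obtain ⟨k, rfl⟩ : ∃ k, r = k + 1 := ⟨r - 1, by omega⟩
  have h1 := card_shd hW.unif hW.pst
  have h2 : shd k W = (Finset.univ : Finset ι).powersetCard k := by
    apply Finset.Subset.antisymm (shd_sub hW.unif)
    intro S hS
    rw [Finset.mem_powersetCard] at hS
    obtain ⟨e, ⟨he, hSe⟩, _⟩ := hW.ex S (by omega)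
    exact mem_shd.2 ⟨e, he, hSe, hS.2⟩
  rw [h2, Finset.card_powersetCard, Finset.card_univ, hW.ci] at h1
  simpa using h1.symm

lemma canon_eq {m : ℕ} {g : Fin m → ι} (hg : Function.Injective g) {L : List ℕ} (hn : L.Nodup)
    (hlt : ∀ b ∈ L, b < 2^m) (hc : W.card ≤ L.length) (hL : ∀ b ∈ L, (ms m b).image g ∈ W)
    (e : Finset ι) : e ∈ W ↔ ∃ b ∈ L, e = (ms m b).image g := by
  have h1 : L.toFinset.image (fun b => (ms m b).image g) = W := by
    apply Finset.eq_of_subset_of_card_le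
    · intro e he
      obtain ⟨b, hb, rfl⟩ := Finset.mem_image.1 he
      exact hL b (List.mem_toFinset.1 hb)
    · rw [Finset.card_image_of_injOn, List.toFinset_card_of_nodup hn]
      · exact hc
      · intro a ha b hb hab
        exact ms_inj (hlt a (List.mem_toFinset.1 ha)) (hlt b (List.mem_toFinset.1 hb))
          (Finset.image_injective hg hab)
  rw [← h1, Finset.mem_image]
  simp only [List.mem_toFinset]
  constructor
  · rintro ⟨b, hb, h⟩; exact ⟨b, hb, h.symm⟩
  · rintro ⟨b, hb, h⟩; exact ⟨b, hb, h.symm⟩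

lemma list_bij (L : List ι) (hL : L.Nodup) {m : ℕ} (hlen : L.length = m) (hc : Fintype.card ι = m) :
    Function.Bijective (fun i : Fin m => L.get (i.cast hlen.symm)) := by
  rw [Fintype.bijective_iff_injective_and_card]
  refine ⟨?_, by simp [hc]⟩
  intro i j hij
  have := List.nodup_iff_injective_get.1 hL hij
  simpa using this

set_option maxHeartbeats 4000000 in
lemma frame5 (hW : St 5 W) : ∃ g : Fin 11 → ι, Function.Bijective g ∧
    ∀ b ∈ [31, 103, 171, 307], b < 2^11 ∧ (ms 11 b).image g ∈ W := by
  let f := (Fintype.equivFinOfCardEq (show Fintype.card ι = 11 from hW.ci)).symm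
  obtain ⟨p0, p1, p2, p3, h01, h02, h03, h12, h13, h23⟩ : ∃ p0 p1 p2 p3 : ι, p0 ≠ p1 ∧ p0 ≠ p2 ∧ p0 ≠ p3 ∧
      p1 ≠ p2 ∧ p1 ≠ p3 ∧ p2 ≠ p3 := by
    refine ⟨f 0, f 1, f 2, f 3, ?_, ?_, ?_, ?_, ?_, ?_⟩ <;> simp
  have c4 : ∀ a b c d : ι, a ≠ b → a ≠ c → a ≠ d → b ≠ c → b ≠ d → c ≠ d →
      ({a, b, c, d} : Finset ι).card = 5 - 1 := by
    intro a b c d h1 h2 h3 h4 h5 h6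
    rw [Finset.card_insert_of_notMem (by simp [*]), Finset.card_insert_of_notMem (by simp [*]),
      Finset.card_insert_of_notMem (by simp [*]), Finset.card_singleton]
  have key : ∀ a b c d z : ι, ∀ A ∈ W, ∀ B ∈ W, a ≠ b → a ≠ c → a ≠ d → b ≠ c → b ≠ d → c ≠ d →
      a ∈ A → b ∈ A → c ∈ A → d ∈ A → a ∈ B → b ∈ B → c ∈ B → d ∈ B → z ∈ A → z ∈ B := by
    intro a b c d z A hA B hB h1 h2 h3 h4 h5 h6 a1 a2 a3 a4 b1 b2 b3 b4 hz
    have : A = B := by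
      apply hW.pst A hA B hB
      rw [← c4 a b c d h1 h2 h3 h4 h5 h6]
      apply Finset.card_le_card
      intro y hy
      simp only [Finset.mem_insert, Finset.mem_singleton] at hy
      rw [Finset.mem_inter]
      rcases hy with rfl | rfl | rfl | rfl <;> exact ⟨by assumption, by assumption⟩
    rw [← this]; exact hz
  obtain ⟨p4, n4, B0⟩ := hW.compl (by norm_num) (c4 p0 p1 p2 p3 h01 h02 h03 h12 h13 h23)
  obtain ⟨p5, n5⟩ : ∃ p5, p5 ∉ ({p0, p1, p2, p3, p4} : Finset ι) := by
    by_contra hcon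
    push Not at hcon
    have h1 : (Finset.univ : Finset ι) ⊆ {p0, p1, p2, p3, p4} := fun i _ => hcon i
    have := Finset.card_le_card h1
    rw [Finset.card_univ, hW.ci] at this
    have h2 := Finset.card_le_five (a := p0) (b := p1) (c := p2) (d := p3) (e := p4)
    omega
  simp only [Finset.mem_insert, Finset.mem_singleton, not_or] at n4 n5
  obtain ⟨h40, h41, h42, h43⟩ := n4
  obtain ⟨h50, h51, h52, h53, h54⟩ := n5
  obtain ⟨p6, n6, B1⟩ := hW.compl (by norm_num) (c4 p0 p1 p2 p5 h01 h02 (Ne.symm h50) h12 (Ne.symm h51) (Ne.symm h52))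
  obtain ⟨p7, n7, B2⟩ := hW.compl (by norm_num) (c4 p0 p1 p3 p5 h01 h03 (Ne.symm h50) h13 (Ne.symm h51) (Ne.symm h53))
  obtain ⟨p8, n8, B3⟩ := hW.compl (by norm_num) (c4 p0 p1 p4 p5 h01 (Ne.symm h40) (Ne.symm h50) (Ne.symm h41) (Ne.symm h51) (Ne.symm h54))
  simp only [Finset.mem_insert, Finset.mem_singleton, not_or] at n6 n7 n8
  obtain ⟨h60, h61, h62, h65⟩ := n6
  obtain ⟨h70, h71, h73, h75⟩ := n7
  obtain ⟨h80, h81, h84, h85⟩ := n8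
  have h63 : p6 ≠ p3 := by
    intro hh
    have := key p0 p1 p2 p6 p5 _ B1 _ B0 h01 (by grind) (by grind) (by grind) (by grind) (by grind)
      (by simp) (by simp) (by simp) (by simp [hh]) (by simp) (by simp) (by simp) (by simp [hh]) (by simp)
    simp only [Finset.mem_insert, Finset.mem_singleton] at this
    grind
  have h64 : p6 ≠ p4 := by
    intro hh
    have := key p0 p1 p2 p6 p5 _ B1 _ B0 h01 (by grind) (by grind) (by grind) (by grind) (by grind)
      (by simp) (by simp) (by simp) (by simp [hh]) (by simp) (by simp) (by simp) (by simp [hh]) (by simp)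
    simp only [Finset.mem_insert, Finset.mem_singleton] at this
    grind
  have h72 : p7 ≠ p2 := by
    intro hh
    have := key p0 p1 p3 p7 p5 _ B2 _ B0 h01 (by grind) (by grind) (by grind) (by grind) (by grind)
      (by simp) (by simp) (by simp) (by simp [hh]) (by simp) (by simp) (by simp) (by simp [hh]) (by simp)
    simp only [Finset.mem_insert, Finset.mem_singleton] at this
    grind
  have h74 : p7 ≠ p4 := by
    intro hh
    have := key p0 p1 p3 p7 p5 _ B2 _ B0 h01 (by grind) (by grind) (by grind) (by grind) (by grind)
      (by simp) (by simp) (by simp) (by simp [hh]) (by simp) (by simp) (by simp) (by simp [hh]) (by simp)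
    simp only [Finset.mem_insert, Finset.mem_singleton] at this
    grind
  have h76 : p7 ≠ p6 := by
    intro hh
    have := key p0 p1 p5 p7 p2 _ B1 _ B2 h01 (by grind) (by grind) (by grind) (by grind) (by grind)
      (by simp) (by simp) (by simp) (by simp [hh]) (by simp) (by simp) (by simp) (by simp [hh]) (by simp)
    simp only [Finset.mem_insert, Finset.mem_singleton] at this
    grind
  have h82 : p8 ≠ p2 := by
    intro hh
    have := key p0 p1 p4 p8 p5 _ B3 _ B0 h01 (by grind) (by grind) (by grind) (by grind) (by grind)
      (by simp) (by simp) (by simp) (by simp [hh]) (by simp) (by simp) (by simp) (by simp [hh]) (by simp)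
    simp only [Finset.mem_insert, Finset.mem_singleton] at this
    grind
  have h83 : p8 ≠ p3 := by
    intro hh
    have := key p0 p1 p4 p8 p5 _ B3 _ B0 h01 (by grind) (by grind) (by grind) (by grind) (by grind)
      (by simp) (by simp) (by simp) (by simp [hh]) (by simp) (by simp) (by simp) (by simp [hh]) (by simp)
    simp only [Finset.mem_insert, Finset.mem_singleton] at this
    grind
  have h86 : p8 ≠ p6 := by
    intro hh
    have := key p0 p1 p5 p8 p4 _ B3 _ B1 h01 (by grind) (by grind) (by grind) (by grind) (by grind)
      (by simp) (by simp) (by simp) (by simp [hh]) (by simp) (by simp) (by simp) (by simp [hh]) (by simp)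
    simp only [Finset.mem_insert, Finset.mem_singleton] at this
    grind
  have h87 : p8 ≠ p7 := by
    intro hh
    have := key p0 p1 p5 p8 p4 _ B3 _ B2 h01 (by grind) (by grind) (by grind) (by grind) (by grind)
      (by simp) (by simp) (by simp) (by simp [hh]) (by simp) (by simp) (by simp) (by simp [hh]) (by simp)
    simp only [Finset.mem_insert, Finset.mem_singleton] at this
    grind
  have nd9 : [p8, p7, p6, p5, p4, p3, p2, p1, p0].Nodup := by
    simp only [List.nodup_cons, List.mem_cons, List.not_mem_nil, not_or, List.nodup_nil, not_false_eq_true, and_true,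
      or_false]
    grind
  have hc : ((Finset.univ : Finset ι) \ [p8, p7, p6, p5, p4, p3, p2, p1, p0].toFinset).card = 2 := by
    rw [Finset.card_sdiff_of_subset (Finset.subset_univ _), List.toFinset_card_of_nodup nd9,
      Finset.card_univ, hW.ci]; rfl
  obtain ⟨p9, p10, h9, hs⟩ := Finset.card_eq_two.1 hc
  have m9 : p9 ∉ [p8, p7, p6, p5, p4, p3, p2, p1, p0] := by
    have : p9 ∈ (Finset.univ : Finset ι) \ [p8, p7, p6, p5, p4, p3, p2, p1, p0].toFinset := by rw [hs]; simp
    rw [Finset.mem_sdiff, List.mem_toFinset] at this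
    exact this.2
  have m10 : p10 ∉ [p8, p7, p6, p5, p4, p3, p2, p1, p0] := by
    have : p10 ∈ (Finset.univ : Finset ι) \ [p8, p7, p6, p5, p4, p3, p2, p1, p0].toFinset := by rw [hs]; simp
    rw [Finset.mem_sdiff, List.mem_toFinset] at this
    exact this.2
  have nd11 : [p10, p9, p8, p7, p6, p5, p4, p3, p2, p1, p0].Nodup := by
    rw [List.nodup_cons, List.nodup_cons, List.mem_cons, not_or]
    exact ⟨⟨h9.symm, m10⟩, m9, nd9⟩
  have nd : [p0, p1, p2, p3, p4, p5, p6, p7, p8, p9, p10].Nodup := by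
    have := List.nodup_reverse.2 nd11
    simpa using this
  refine ⟨_, list_bij _ nd rfl hW.ci, ?_⟩
  intro b hb
  simp only [List.mem_cons, List.not_mem_nil, or_false] at hb
  have e1 : ms 11 31 = {0, 1, 2, 3, 4} := by decide
  have e2 : ms 11 103 = {0, 1, 2, 5, 6} := by decide
  have e3 : ms 11 171 = {0, 1, 3, 5, 7} := by decide
  have e4 : ms 11 307 = {0, 1, 4, 5, 8} := by decide
  rcases hb with rfl | rfl | rfl | rfl
  · refine ⟨by norm_num, ?_⟩
    rw [e1]; convert B0 using 1
    ext z; simp [Finset.image_insert]; tauto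
  · refine ⟨by norm_num, ?_⟩
    rw [e2]; convert B1 using 1
    ext z; simp [Finset.image_insert]; tauto
  · refine ⟨by norm_num, ?_⟩
    rw [e3]; convert B2 using 1
    ext z; simp [Finset.image_insert]; tauto
  · refine ⟨by norm_num, ?_⟩
    rw [e4]; convert B3 using 1
    ext z; simp [Finset.image_insert]; tauto

lemma canon5 (hW : St 5 W) : ∃ g : Fin 11 → ι, Function.Bijective g ∧
    ∀ b ∈ w5, (ms 11 b).image g ∈ W := by
  obtain ⟨g, hg, hb⟩ := frame5 hW
  obtain ⟨bs, hl, hbs⟩ := go_sound (by norm_num) hW (by norm_num) g hg _ (by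
    intro x hx; interval_cases x <;> simp) leaf5 q5 _ q5_spec hb go5
  unfold leaf5 at hl
  rw [List.any_eq_true] at hl
  obtain ⟨l, hl1, hl2⟩ := hl
  rw [List.all_eq_true] at hl2
  obtain ⟨hlen, hnd, hlt⟩ := prm_spec l hl1
  let σ : Fin 11 → Fin 11 := fun i => ⟨l.get (i.cast hlen.symm), hlt _ (List.get_mem _ _)⟩
  have hσ : Function.Injective σ := by
    intro i j hij
    have h1 : l.get (i.cast hlen.symm) = l.get (j.cast hlen.symm) := congrArg Fin.val hij
    have := List.nodup_iff_injective_get.1 hnd h1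
    simpa using this
  refine ⟨g ∘ σ, hg.comp (Finite.injective_iff_bijective.1 hσ), ?_⟩
  intro b hb
  have h1 := hl2 b hb
  rw [List.any_eq_true] at h1
  obtain ⟨c, hc, hcb⟩ := h1
  rw [Nat.beq_eq] at hcb
  have h2 := (hbs c hc).2
  rw [hcb] at h2
  rw [← Finset.image_image]
  convert h2 using 2
  ext y
  rw [Finset.mem_image, mem_ms, ap_spec]
  constructor
  · rintro ⟨i, hi, rfl⟩
    refine ⟨i, i.2, mem_ms.1 hi, ?_⟩
    simp only [σ]
    rw [List.getD_eq_getElem _ _ (by omega)]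
    rfl
  · rintro ⟨i, hi, hib, hy⟩
    refine ⟨⟨i, hi⟩, mem_ms.2 hib, ?_⟩
    ext
    rw [← hy, List.getD_eq_getElem _ _ (by omega)]
    rfl

lemma St.derive (hW : St 6 W) (p : ι) :
    St 5 (Finset.univ.filter fun s : Finset {i // i ≠ p} => insert p (s.map (Function.Embedding.subtype _)) ∈ W) := by
  have hpn : ∀ s : Finset {i // i ≠ p}, p ∉ s.map (Function.Embedding.subtype _) := by
    intro s hs
    obtain ⟨k, _, hk⟩ := Finset.mem_map.1 hs
    exact k.2 hk
  refine ⟨?_, ?_, ?_⟩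
  · have := hW.ci
    rw [Fintype.card_subtype_compl]; simp [this]
  · intro s hs
    have := hW.ce _ (Finset.mem_filter.1 hs).2
    rw [Finset.card_insert_of_notMem (hpn s), Finset.card_map] at this
    omega
  · intro S hS
    obtain ⟨e, ⟨heW, heS⟩, hu⟩ := hW.ex (insert p (S.map (Function.Embedding.subtype _))) (by
      rw [Finset.card_insert_of_notMem (hpn S), Finset.card_map, hS])
    have hpe : p ∈ e := heS (Finset.mem_insert_self _ _)
    have he : insert p ((Finset.univ.filter fun k : {i // i ≠ p} => k.1 ∈ e).map (Function.Embedding.subtype _)) = e := by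
      ext i
      simp only [Finset.mem_insert, Finset.mem_map, Finset.mem_filter, Finset.mem_univ, true_and,
        Function.Embedding.subtype_apply, Subtype.exists, exists_and_left, exists_prop, exists_eq_right_right]
      by_cases hi : i = p
      · subst hi; simp [hpe]
      · simp [hi]
    refine ⟨Finset.univ.filter fun k : {i // i ≠ p} => k.1 ∈ e, ⟨?_, ?_⟩, ?_⟩
    · rw [Finset.mem_filter]; exact ⟨Finset.mem_univ _, by rw [he]; exact heW⟩
    · intro k hk
      rw [Finset.mem_filter]
      exact ⟨Finset.mem_univ _, heS (Finset.mem_insert_of_mem (Finset.mem_map_of_mem _ hk))⟩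
    · rintro s ⟨hs, hSs⟩
      have h1 := hu _ ⟨(Finset.mem_filter.1 hs).2, Finset.insert_subset_insert _ (Finset.map_subset_map.2 hSs)⟩
      ext k
      rw [Finset.mem_filter, ← h1]
      simp only [Finset.mem_univ, true_and, Finset.mem_insert, k.2, false_or]
      exact (Finset.mem_map' (Function.Embedding.subtype _) (a := k)).symm

lemma canon6 (hW : St 6 W) : ∃ g : Fin 12 → ι, Function.Bijective g ∧
    ∀ b ∈ (w5.map fun b => 2*b+1) ++ w6, (ms 12 b).image g ∈ W := by
  obtain ⟨p⟩ : Nonempty ι := Fintype.card_pos_iff.1 (by rw [hW.ci]; norm_num)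
  obtain ⟨g5, hg5, hb5⟩ := canon5 (hW.derive p)
  let g : Fin 12 → ι := Fin.cons p (fun i => (g5 i).1)
  have hgi : Function.Injective g := by
    rw [Fin.cons_injective_iff]
    refine ⟨?_, ?_⟩
    · rintro ⟨i, hi⟩; exact (g5 i).2 hi
    · exact Subtype.val_injective.comp hg5.1
  have hg : Function.Bijective g := by
    rw [Fintype.bijective_iff_injective_and_card]
    exact ⟨hgi, by rw [hW.ci]; simp⟩
  have h5 : ∀ b ∈ (w5.map fun b => 2*b+1), b < 2^12 ∧ (ms 12 b).image g ∈ W := by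
    intro b hb
    obtain ⟨c, hc, rfl⟩ := List.mem_map.1 hb
    have h1 := w5_spec.2.2 c hc
    refine ⟨by norm_num; omega, ?_⟩
    have h2 := (Finset.mem_filter.1 (hb5 c hc)).2
    convert h2 using 1
    ext i
    simp only [Finset.mem_image, Finset.mem_insert, Finset.mem_map, mem_ms]
    constructor
    · rintro ⟨j, hj, rfl⟩
      induction j using Fin.cases with
      | zero => left; rfl
      | succ j =>
        right
        rw [Fin.val_succ, Nat.testBit_succ, show (2*c+1)/2 = c by omega] at hj
        exact ⟨g5 j, ⟨j, hj, rfl⟩, rfl⟩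
    · rintro (rfl | ⟨k, ⟨j, hj, rfl⟩, rfl⟩)
      · exact ⟨0, by simp, rfl⟩
      · refine ⟨j.succ, ?_, rfl⟩
        rw [Fin.val_succ, Nat.testBit_succ, show (2*c+1)/2 = c by omega]; exact hj
  obtain ⟨bs, hl, hbs⟩ := go_sound (by norm_num) hW (by norm_num) g hg _ (by
    intro x hx; interval_cases x <;> simp) leaf6 q6 _ q6_spec h5 go6
  refine ⟨g, hg, ?_⟩
  intro b hb
  rcases List.mem_append.1 hb with hb | hb
  · exact (h5 b hb).2
  · unfold leaf6 at hl
    rw [List.all_eq_true] at hl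
    have h1 := hl b hb
    rw [List.any_eq_true] at h1
    obtain ⟨c, hc, hcb⟩ := h1
    rw [Nat.beq_eq] at hcb
    rw [← hcb]; exact (hbs c hc).2

/-- **Uniqueness of the Steiner systems** -/
theorem uniq {κ : Type*} [DecidableEq κ] [Fintype κ] (hr : r = 5 ∨ r = 6) {W' : Finset (Finset κ)}
    (hW : St r W) (hW' : St r W') : ∃ f : ι → κ, Function.Bijective f ∧ ∀ e, e ∈ W ↔ e.image f ∈ W' := by
  have main : ∃ (m : ℕ) (g : Fin m → ι) (g' : Fin m → κ) (L : List ℕ), Function.Bijective g ∧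
      Function.Bijective g' ∧ (∀ e, e ∈ W ↔ ∃ b ∈ L, e = (ms m b).image g) ∧
      (∀ e, e ∈ W' ↔ ∃ b ∈ L, e = (ms m b).image g') := by
    have hc := hW.card (by omega)
    have hc' := hW'.card (by omega)
    rcases hr with rfl | rfl
    · obtain ⟨g, hg, h⟩ := canon5 hW
      obtain ⟨g', hg', h'⟩ := canon5 hW'
      have e : Nat.choose (5+6) (5-1) = 330 := by decide
      rw [e] at hc hc'
      exact ⟨11, g, g', w5, hg, hg',
        canon_eq hg.1 w5_spec.1 w5_spec.2.2 (by rw [w5_spec.2.1]; omega) h,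
        canon_eq hg'.1 w5_spec.1 w5_spec.2.2 (by rw [w5_spec.2.1]; omega) h'⟩
    · obtain ⟨g, hg, h⟩ := canon6 hW
      obtain ⟨g', hg', h'⟩ := canon6 hW'
      have e : Nat.choose (6+6) (6-1) = 792 := by decide
      rw [e] at hc hc'
      have hlen : ((w5.map fun b => 2*b+1) ++ w6).length = 132 := by
        rw [List.length_append, List.length_map, w5_spec.2.1, w6_spec.2.1]
      have hlt : ∀ b ∈ (w5.map fun b => 2*b+1) ++ w6, b < 2^12 := by
        intro b hb
        rcases List.mem_append.1 hb with hb | hb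
        · obtain ⟨c, hc, rfl⟩ := List.mem_map.1 hb
          have h1 := w5_spec.2.2 c hc
          norm_num; omega
        · exact w6_spec.2.2 b hb
      exact ⟨12, g, g', _, hg, hg',
        canon_eq hg.1 w6_spec.1 hlt (by rw [hlen]; omega) h,
        canon_eq hg'.1 w6_spec.1 hlt (by rw [hlen]; omega) h'⟩
  obtain ⟨m, g, g', L, hg, hg', h, h'⟩ := main
  let G := Equiv.ofBijective g hg
  have hGg : (g' ∘ G.symm) ∘ g = g' := by
    ext i
    have : G.symm (g i) = i := G.symm_apply_apply i
    simp [this]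
  have hb : Function.Bijective (g' ∘ G.symm) := hg'.comp G.symm.bijective
  refine ⟨g' ∘ G.symm, hb, ?_⟩
  intro e
  rw [h, h']
  constructor
  · rintro ⟨b, hb, rfl⟩
    exact ⟨b, hb, by rw [Finset.image_image, hGg]⟩
  · rintro ⟨b, hbL, he⟩
    refine ⟨b, hbL, Finset.image_injective hb.1 ?_⟩
    rw [he, Finset.image_image, hGg]

end Uniq
end DensityCH
end

section
namespace DensityCH
open Finset
set_option linter.all false
set_option exponentiation.threshold 3000

section Stab
variable {α ι : Type*} [DecidableEq α] [DecidableEq ι] [Fintype ι] {r : ℕ} {W : Finset (Finset ι)}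

noncomputable def g1 : ℝ := 1 / 10^210
noncomputable def e0 : ℝ := 1 / 10^1100

lemma g1_pos : 0 < g1 := by unfold g1; positivity
lemma e0_pos : 0 < e0 := by unfold e0; positivity

lemma SF.apx {E : Finset (Finset α)} (h : SF E) (x : α → ℝ) : Apx E x 0 := by
  constructor
  · intro S a b hab ha hb hA hB
    exact le_of_eq (Dg_pair_zero x (fun C hC h1 h2 => h S a b hab ha hb hA hB C hC h1 h2))
  · intro a b hab e he hae hbe
    have : lk E a ∩ lk E b = ∅ := by
      ext S
      simp only [Finset.mem_inter, mem_lk, Finset.notMem_empty, iff_false]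
      rintro ⟨⟨h1, h2⟩, h3, h4⟩
      exact h S a b hab h1 h3 h2 h4 e he hae hbe
    rw [this]; simp [PE]

lemma mkLS (hr : r = 5 ∨ r = 6) (hW : St r W) {T : Finset α} {E : Finset (Finset α)} (hE : Unif r T E)
    {x : α → ℝ} (hx : ∀ v, 0 ≤ x v) (h1 : ∑ v ∈ T, x v = 1) {φ : α → ι} {η θ : ℝ} (hη0 : 0 < η)
    (hη : η ≤ 1/10^8) (hP : lam r - (η^2/6000)^2/10^8 ≤ PE (E ∩ BF φ T W) x) (ap : Apx E x θ)
    (h0 : 0 ≤ θ) (hθ : θ ≤ η) : LS r W T E x φ η θ where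
  hr := hr
  hW := hW
  hE := hE
  hx := hx
  h1 := h1
  hn := by
    apply hW.near hr (pt_nonneg φ T hx) (by rw [pt_sum, h1]) hη0 (by linarith [show (1:ℝ)/10^8 ≤ 1 by norm_num])
    rw [← PE_BF]
    exact hP.trans (PE_mono hx Finset.inter_subset_right)
  hP := by
    refine le_trans ?_ hP
    have h2 : η^2 ≤ η := by nlinarith [show (1:ℝ)/10^8 ≤ 1 by norm_num]
    have h3 : (η^2/6000)^2 ≤ η := by nlinarith [show (1:ℝ)/10^8 ≤ 1 by norm_num]
    linarith
  ap := ap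
  hθ0 := h0
  hθ := hθ
  hη := hη

def StabP (r : ℕ) (W : Finset (Finset ι)) (T : Finset α) (E : Finset (Finset α)) (x : α → ℝ) : Prop :=
  ∃ φ : α → ι, lam r - (lam r - PE E x) / g1 ≤ PE (E ∩ BF φ T W) x

lemma stab_low (hr : r = 5 ∨ r = 6) {T : Finset α} {E : Finset (Finset α)} (hE : Unif r T E) (hS : SF E)
    {x : α → ℝ} (hx : ∀ v, 0 ≤ x v) (h1 : ∑ v ∈ T, x v = 1) (hP : lam r - e0 ≤ PE E x) {u : α} (hu : u ∈ T)
    (hD : Dg E x {u} ≤ rlam r - g1)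
    (IH : ∀ (E' : Finset (Finset α)) (x' : α → ℝ), Unif r (T.erase u) E' → SF E' → (∀ v, 0 ≤ x' v) →
      ∑ v ∈ T.erase u, x' v = 1 → lam r - e0 ≤ PE E' x' → StabP r W (T.erase u) E' x') : StabP r W T E x := by
  have hg := g1_pos
  have he := e0_pos
  have hg1 : g1 < 1 := by unfold g1; norm_num
  have hlo := low hr hE hS hx h1 (δ := lam r - PE E x) (γ := g1) (by linarith) hu hD hg hg1 (by
    have : e0 < g1^2/60 := by unfold e0 g1; norm_num
    linarith)
  have hPl := lagr_le hr hE hS hx h1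
  set ε := lam r - PE E x with hε
  set s := x u with hs
  have hs0 : 0 ≤ s := hx u
  have hs1 : s ≤ g1 := by
    have h2 : 2 * e0 ≤ g1 * g1 := by unfold e0 g1; norm_num
    by_contra hc
    push Not at hc
    nlinarith
  have hs2 : s < 1 := by linarith
  have hr6 : (r:ℝ) ≤ 6 := by rcases hr with rfl | rfl <;> norm_num
  have hr0 : (0:ℝ) ≤ r := by positivity
  set Q := (1 - s)^r with hQ
  have hQ0 : 0 < Q := by rw [hQ]; apply pow_pos; linarith
  have hQ1 : Q ≤ 1 - r * s + 15 * s^2 := pow_bern hr hs0 hs2.le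
  have hQ2 : 1 - r * s ≤ Q := by
    have := one_add_mul_le_pow (a := -s) (by linarith) r
    rw [hQ]
    have h3 : (1 + -s) = 1 - s := by ring
    rw [h3] at this
    linarith
  set E' := E.filter (u ∉ ·) with hE'
  have hE'u : Unif r (T.erase u) E' := unif_filter_notMem hE u
  have hS' : SF E' := SF_mono hS (Finset.filter_subset _ _)
  set x' : α → ℝ := fun v => (1 - s)⁻¹ * x v with hx'
  have hx'0 : ∀ v, 0 ≤ x' v := fun v => mul_nonneg (inv_nonneg.2 (by linarith)) (hx v)
  have h1' : ∑ v ∈ T.erase u, x' v = 1 := by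
    rw [← Finset.mul_sum, Finset.sum_erase_eq_sub hu, h1]
    exact inv_mul_cancel₀ (by linarith)
  have hQe : ∀ F : Finset (Finset α), Unif r (T.erase u) F → PE F x = Q * PE F x' := by
    intro F hF
    rw [hx', PE_smul hF, hQ, inv_pow, ← mul_assoc, mul_inv_cancel₀ hQ0.ne', one_mul]
  have hPE' : Q * PE E' x' = PE E x - s * Dg E x {u} := by
    rw [← hQe E' hE'u, PE_split E x u]; ring
  have hlam := lam_le hr
  have hlp := lam_pos hr
  have hrl := r_lam hr
  set ε' := lam r - PE E' x' with hε'
  have hg6 : 6 * e0 ≤ g1 / 2 := by unfold e0 g1; norm_num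
  have k1 : Q * ε' ≤ ε - s * g1 / 2 := by
    have : Q * ε' = Q * lam r - PE E x + s * Dg E x {u} := by
      rw [hε', mul_sub, hPE']; ring
    rw [this]
    have a1 : s * Dg E x {u} ≤ s * (rlam r - g1) := mul_le_mul_of_nonneg_left hD hs0
    have a2 : Q * lam r ≤ (1 - r * s + 15 * s^2) * lam r := mul_le_mul_of_nonneg_right hQ1 hlp.le
    have a3 : s^2 * lam r ≤ s * g1 * (1/100) := by
      have : s^2 ≤ s * g1 := by nlinarith
      exact mul_le_mul this hlam hlp.le (by positivity)
    have a4 : r * s * lam r = s * rlam r := by rw [← hrl]; ring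
    have a5 : 0 ≤ s * g1 := by positivity
    nlinarith
  have hε0 : ε ≤ e0 := by linarith
  have k2 : ε' ≤ ε := by
    by_contra hc
    push Not at hc
    have b1 : 0 < ε' := by linarith
    have b2 : (1 - r * s) * ε' ≤ Q * ε' := mul_le_mul_of_nonneg_right hQ2 b1.le
    have hrs : 0 < 1 - r * s := by
      have : (r:ℝ) * s ≤ 6 * g1 := mul_le_mul hr6 hs1 hs0 (by norm_num)
      have : 6 * g1 < 1 := by unfold g1; norm_num
      linarith
    have b3 : (1 - r * s) * ε < (1 - r * s) * ε' := mul_lt_mul_of_pos_left hc hrs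
    have b4 : s * g1 / 2 < s * (r * ε) := by linarith
    have b5 : r * ε ≤ g1 / 2 := by nlinarith
    nlinarith
  obtain ⟨φ, hφ⟩ := IH E' x' hE'u hS' hx'0 h1' (by linarith)
  refine ⟨φ, ?_⟩
  have hsub : E' ∩ BF φ (T.erase u) W ⊆ E ∩ BF φ T W := by
    intro e he
    rw [Finset.mem_inter, mem_BF] at he ⊢
    exact ⟨(Finset.mem_filter.1 he.1).1, he.2.1.trans (Finset.erase_subset _ _), he.2.2⟩
  have c1 := PE_mono hx hsub
  rw [hQe _ (unif_mono hE'u Finset.inter_subset_left)] at c1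
  refine le_trans ?_ c1
  have c2 : Q * (lam r - ε' / g1) ≤ Q * PE (E' ∩ BF φ (T.erase u) W) x' := mul_le_mul_of_nonneg_left hφ hQ0.le
  refine le_trans ?_ c2
  have c3 : Q * (ε' / g1) ≤ ε / g1 - s / 2 := by
    have : Q * (ε' / g1) = (Q * ε') / g1 := by ring
    rw [this]
    have : ε / g1 - s/2 = (ε - s * g1/2) / g1 := by field_simp
    rw [this]
    exact div_le_div_of_nonneg_right k1 hg.le
  have c4 : (1 - r * s) * lam r ≤ Q * lam r := mul_le_mul_of_nonneg_right hQ2 hlp.le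
  have c5 : r * s * lam r = s * rlam r := by rw [← hrl]; ring
  have c6 := rlam_lt hr
  nlinarith

end Stab
end DensityCH
end

section
namespace DensityCH
open Finset
set_option linter.all false
set_option exponentiation.threshold 3000

section Stab
variable {α ι : Type*} [DecidableEq α] [DecidableEq ι] [Fintype ι] {r : ℕ} {W : Finset (Finset ι)}

lemma PE_inter_add (E F : Finset (Finset α)) (x : α → ℝ) : PE E x = PE (E ∩ F) x + PE (E \ F) x := by
  have := PE_swap E (E ∩ F) x
  have h1 : (E ∩ F) \ E = ∅ := by ext; simp; tauto
  have h2 : E \ (E ∩ F) = E \ F := by ext; simp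
  rw [h1, h2] at this
  simpa [PE] using this

lemma BF_le (hr : r = 5 ∨ r = 6) (hW : St r W) {T : Finset α} {x : α → ℝ} (hx : ∀ v, 0 ≤ x v)
    (h1 : ∑ v ∈ T, x v = 1) (φ : α → ι) : PE (BF φ T W) x ≤ lam r := by
  rw [PE_BF]
  exact pW_le hr hW (pt_nonneg φ T hx) (by rw [pt_sum, h1])

lemma stab_fin {T : Finset α} {E : Finset (Finset α)} {x : α → ℝ} {φ : α → ι} {η θ : ℝ}
    (h : LS r W T E x φ η θ) (hη : η ≤ 1/10^40) (hD : ∀ v ∈ T, rlam r - η ≤ Dg E x {v}) :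
    ∃ ψ : α → ι, lam r - 2 * (lam r - PE E x) ≤ PE (E ∩ BF ψ T W) x := by
  obtain ⟨ψ, hψ⟩ := h.lemR hη hD
  refine ⟨ψ, ?_⟩
  have h1 := BF_le h.hr h.hW h.hx h.h1 ψ
  have h2 := PE_swap E (BF ψ T W) x
  have h3 := PE_inter_add E (BF ψ T W) x
  linarith

lemma stab_merge (hr : r = 5 ∨ r = 6) (hW : St r W) {T : Finset α} {E : Finset (Finset α)} (hE : Unif r T E)
    (hS : SF E) {x : α → ℝ} (hx : ∀ v, 0 ≤ x v) (h1 : ∑ v ∈ T, x v = 1) (hP : lam r - e0 ≤ PE E x)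
    (hD : ∀ v ∈ T, rlam r - g1 ≤ Dg E x {v})
    {u v : α} (hu : u ∈ T) (hv : v ∈ T) (huv : u ≠ v) (hno : ∀ e ∈ E, u ∈ e → v ∈ e → False)
    (hle : Dg E x {u} ≤ Dg E x {v})
    (IH : ∀ (E' : Finset (Finset α)) (x' : α → ℝ), Unif r (T.erase u) E' → SF E' → (∀ v, 0 ≤ x' v) →
      ∑ v ∈ T.erase u, x' v = 1 → lam r - e0 ≤ PE E' x' → StabP r W (T.erase u) E' x') : StabP r W T E x := by
  have hg := g1_pos
  have he := e0_pos
  set x' := shf x u v (x u) with hx'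
  have hx'0 : ∀ w, 0 ≤ x' w := shf_nonneg hx (hx u) le_rfl
  have xu : x' u = 0 := by rw [hx', shf_u]; ring
  have xv : x' v = x v + x u := by rw [hx', shf_v _ huv]
  have xo : ∀ w, w ≠ u → w ≠ v → x w = x' w := fun w a b => (shf_o x a b _).symm
  have hsT : ∑ w ∈ T, x' w = 1 := by rw [hx', sum_shf x huv _ hu hv, h1]
  have hs' : ∑ w ∈ T.erase u, x' w = 1 := by rw [Finset.sum_erase _ xu, hsT]
  have hPx : PE E x ≤ PE E x' := by
    rw [hx', PE_shf E x huv, Dg_pair_zero x hno]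
    nlinarith [hx u]
  set E' := E.filter (u ∉ ·) with hE'
  have hE'u : Unif r (T.erase u) E' := unif_filter_notMem hE u
  obtain ⟨φ', hφ'⟩ := IH E' x' hE'u (SF_mono hS (Finset.filter_subset _ _)) hx'0 hs' (by
    rw [hE', ← PE_zero_at E xu]; linarith)
  rw [hE', ← PE_zero_at E xu, ← hE'] at hφ'
  set G := E' ∩ BF φ' (T.erase u) W with hG
  have hGl : lam r - e0 / g1 ≤ PE G x' := by
    refine le_trans ?_ hφ'
    have : (lam r - PE E x') / g1 ≤ e0 / g1 := div_le_div_of_nonneg_right (by linarith) hg.le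
    linarith
  have hGE : G ⊆ E ∩ BF φ' T W := by
    intro e he
    rw [hG, Finset.mem_inter, mem_BF] at he
    rw [Finset.mem_inter, mem_BF]
    exact ⟨(Finset.mem_filter.1 he.1).1, he.2.1.trans (Finset.erase_subset _ _), he.2.2⟩
  have hL : LS r W T E x' φ' g1 0 := by
    apply mkLS hr hW hE hx'0 hsT hg (by unfold g1; norm_num) _ (hS.apx x') le_rfl hg.le
    have h2 : e0 / g1 ≤ (g1^2/6000)^2/10^8 := by unfold e0 g1; norm_num
    linarith [PE_mono hx'0 hGE]
  have hDu : Dg E x' {u} = Dg E x {u} := by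
    apply Dg_congr
    intro e he hue w hw hwu
    rw [Finset.singleton_subset_iff] at hue
    rw [Finset.mem_singleton] at hwu
    refine (xo w hwu ?_).symm
    rintro rfl
    exact hno e he hue hw
  obtain ⟨i, -, hi⟩ := hL.link (by unfold g1; norm_num) hu (by rw [hDu]; exact hD u hu)
  have hup := hL.D_up hv
  set φ := Function.update φ' u i with hφ
  have φu : φ u = i := by rw [hφ]; simp
  have φo : ∀ w, w ≠ u → φ w = φ' w := fun w hw => by rw [hφ]; simp [hw]
  have c1 : PE (Lc φ' T W E u i) x' ≤ Dg (E ∩ BF φ T W) x {u} := by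
    have : PE (Lc φ' T W E u i) x' = PE (Lc φ' T W E u i) x := by
      apply PE_congr
      intro S hSm w hw
      have hSl := (Finset.mem_inter.1 hSm).1
      rw [mem_lk] at hSl
      refine (xo w ?_ ?_).symm
      · rintro rfl; exact hSl.1 hw
      · rintro rfl; exact hno _ hSl.2 (Finset.mem_insert_self _ _) (Finset.mem_insert_of_mem hw)
    rw [this, Dg_lk]
    apply PE_mono hx
    intro S hSm
    unfold Lc at hSm
    rw [Finset.mem_inter, mem_lk, mem_BF, mem_lk] at hSm
    obtain ⟨⟨a1, a2⟩, a3, a4, a5, a6⟩ := hSm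
    have im : S.image φ = S.image φ' := Finset.image_congr (fun w hw => φo w (by rintro rfl; exact a1 hw))
    rw [mem_lk, Finset.mem_inter, mem_BF]
    refine ⟨a1, a2, Finset.insert_subset hu a3, ?_, ?_⟩
    · rw [Finset.coe_insert, Set.injOn_insert (by simpa using a1)]
      constructor
      · intro p hp q hq hpq
        rw [φo p (by rintro rfl; exact a1 hp), φo q (by rintro rfl; exact a1 hq)] at hpq
        exact a4 hp hq hpq
      · rw [φu, ← Finset.coe_image, im]; simpa using a5
    · rw [Finset.image_insert, φu, im]; exact a6
  have c2 : G ⊆ (E ∩ BF φ T W).filter (u ∉ ·) := by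
    intro e he
    have h2 := hGE he
    rw [Finset.mem_inter, mem_BF] at h2
    have hue : u ∉ e := by
      have := (Finset.mem_inter.1 he).1
      exact (Finset.mem_filter.1 this).2
    rw [Finset.mem_filter, Finset.mem_inter, mem_BF]
    have im : e.image φ = e.image φ' := Finset.image_congr (fun w hw => φo w (by rintro rfl; exact hue hw))
    refine ⟨⟨h2.1, h2.2.1, ?_, by rw [im]; exact h2.2.2.2⟩, hue⟩
    intro p hp q hq hpq
    rw [φo p (by rintro rfl; exact hue hp), φo q (by rintro rfl; exact hue hq)] at hpq
    exact h2.2.2.1 hp hq hpq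
  have hGu : ∀ e ∈ G, u ∉ e := fun e he => (Finset.mem_filter.1 (Finset.mem_inter.1 he).1).2
  have c3 : PE G x = PE G x' - x u * Dg G x' {v} := by
    rw [PE_split G x v, PE_split G x' v, xv]
    have d1 : PE (G.filter (v ∉ ·)) x = PE (G.filter (v ∉ ·)) x' := by
      apply PE_congr
      intro e he w hw
      rw [Finset.mem_filter] at he
      exact xo w (by rintro rfl; exact hGu e he.1 hw) (by rintro rfl; exact he.2 hw)
    have d2 : Dg G x {v} = Dg G x' {v} := by
      apply Dg_congr
      intro e he _ w hw hwv
      exact xo w (by rintro rfl; exact hGu e he hw) (by simpa using hwv)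
    rw [d1, d2]; ring
  have c4 : Dg G x' {v} ≤ Dg E x' {v} := Dg_mono hx'0 (hGE.trans Finset.inter_subset_left) _
  have hxu1 : x u ≤ 1 := by rw [← h1]; exact Finset.single_le_sum (fun w _ => hx w) hu
  have c5 : lam r - e0 / g1 - 10^26 * g1 ≤ PE (E ∩ BF φ T W) x := by
    rw [PE_split _ x u]
    have f1 := PE_mono hx c2
    have f2 : x u * (rlam r - 10^25 * g1) ≤ x u * Dg (E ∩ BF φ T W) x {u} :=
      mul_le_mul_of_nonneg_left (hi.trans c1) (hx u)
    have f3 : x u * Dg G x' {v} ≤ x u * (rlam r + 10^13 * g1) :=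
      mul_le_mul_of_nonneg_left (c4.trans hup) (hx u)
    have f4 : x u * g1 ≤ g1 := by nlinarith
    nlinarith
  have hL2 : LS r W T E x φ (1/10^40) 0 := by
    apply mkLS hr hW hE hx h1 (by norm_num) (by norm_num) _ (hS.apx x) le_rfl (by norm_num)
    have h2 : e0 / g1 + 10^26 * g1 ≤ ((1/10^40)^2/6000)^2/10^8 := by unfold e0 g1; norm_num
    linarith
  obtain ⟨ψ, hψ⟩ := stab_fin hL2 le_rfl (fun w hw => by
    have := hD w hw
    have : g1 ≤ 1/10^40 := by unfold g1; norm_num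
    linarith)
  refine ⟨ψ, le_trans ?_ hψ⟩
  have hPl := lagr_le hr hE hS hx h1
  have : 2 * (lam r - PE E x) ≤ (lam r - PE E x) / g1 := by
    rw [le_div_iff₀ hg]
    have : 2 * g1 ≤ 1 := by unfold g1; norm_num
    nlinarith
  linarith

lemma stab_cov (hr : r = 5 ∨ r = 6) (hW : St r W) {T : Finset α} {E : Finset (Finset α)} (hE : Unif r T E)
    (hS : SF E) {x : α → ℝ} (hx : ∀ v, 0 ≤ x v) (h1 : ∑ v ∈ T, x v = 1)
    (hD : ∀ v ∈ T, rlam r - g1 ≤ Dg E x {v})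
    (hc : ∀ u ∈ T, ∀ v ∈ T, u ≠ v → ∃ e ∈ E, u ∈ e ∧ v ∈ e) : StabP r W T E x := by
  have hg := g1_pos
  have hr1 : r - 1 + 1 = r := by omega
  have hps : PSt (r-1) E := PSt_of_SF (by rw [hr1]; exact hE) hS hc
  have hTn : T.Nonempty := by
    rw [Finset.nonempty_iff_ne_empty]; rintro rfl; simp at h1
  have hT : T.card = r + 6 := by
    by_contra hne
    have h2 := FB hr hE hps hx h1 hne
    have h3 : ∑ v ∈ T, (rlam r - g1) ≤ ∑ v ∈ T, Dg E x {v} := Finset.sum_le_sum hD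
    rw [Finset.sum_const, nsmul_eq_mul] at h3
    have h4 : (0:ℝ) < T.card := by exact_mod_cast hTn.card_pos
    have h5 : g1 < gp := by unfold g1 gp; norm_num
    nlinarith
  obtain ⟨hn, hu⟩ := near_unif_PSt hr hT hE hps hx h1 (ε := 1/100) (γ := g1) (by norm_num) hD
    (by unfold g1; norm_num)
  have hxl : ∀ v ∈ T, 1/20 ≤ x v := by
    intro v hv
    have h2 := (abs_le.1 (hn v hv)).1
    have : (1:ℝ)/12 ≤ 1/((r:ℝ)+6) := by rcases hr with rfl | rfl <;> norm_num
    linarith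
  have hall : ∀ S ⊆ T, S.card = r - 1 → ∃ e ∈ E, S ⊆ e := by
    intro S hST hSc
    by_contra hcon
    push Not at hcon
    have hm : S ∈ Finset.powersetCard (r-1) T \ shd (r-1) E := by
      rw [Finset.mem_sdiff, Finset.mem_powersetCard, mem_shd]
      refine ⟨⟨hST, hSc⟩, ?_⟩
      rintro ⟨e, he, h2, -⟩
      exact hcon e he h2
    have h2 : wt x S ≤ PE (Finset.powersetCard (r-1) T \ shd (r-1) E) x :=
      Finset.single_le_sum (f := fun e => wt x e) (fun e _ => wt_nonneg hx e) hm
    have h3 : (1/20:ℝ)^S.card ≤ wt x S := by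
      unfold wt
      rw [← Finset.prod_const]
      exact Finset.prod_le_prod (fun _ _ => by norm_num) (fun v hv => hxl v (hST hv))
    have h4 : (1/20:ℝ)^6 ≤ (1/20:ℝ)^S.card := by
      apply pow_le_pow_of_le_one (by norm_num) (by norm_num); omega
    have h5 : 12 * g1 < (1/20:ℝ)^6 := by unfold g1; norm_num
    linarith
  classical
  let W' : Finset (Finset ↥T) := Finset.univ.filter (fun e => e.image Subtype.val ∈ E)
  have hW'm : ∀ e : Finset ↥T, e ∈ W' ↔ e.image Subtype.val ∈ E := fun e => by simp [W']
  have hsub : ∀ e : Finset α, e ⊆ T → (e.subtype (· ∈ T)).image Subtype.val = e := by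
    intro e he
    ext y
    simp only [Finset.mem_image, Finset.mem_subtype, Subtype.exists, exists_and_left, exists_prop, exists_eq_right_right]
    constructor
    · rintro ⟨h2, h3⟩; exact h2
    · intro h2; exact ⟨h2, he h2⟩
  have hci : ∀ S : Finset ↥T, (S.image Subtype.val).card = S.card := fun S =>
    Finset.card_image_of_injective _ Subtype.val_injective
  have hSt : St r W' := by
    refine ⟨by rw [Fintype.card_coe, hT], ?_, ?_⟩
    · intro e he
      rw [← hci e]
      exact (hE _ ((hW'm e).1 he)).2
    · intro S hSc
      have hST : S.image Subtype.val ⊆ T := by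
        intro y hy; obtain ⟨z, -, rfl⟩ := Finset.mem_image.1 hy; exact z.2
      obtain ⟨e, he, hSe⟩ := hall _ hST (by rw [hci, hSc])
      refine ⟨e.subtype (· ∈ T), ⟨(hW'm _).2 (by rw [hsub e (hE e he).1]; exact he), ?_⟩, ?_⟩
      · intro z hz
        rw [Finset.mem_subtype]
        exact hSe (Finset.mem_image_of_mem _ hz)
      · rintro f ⟨hf, hSf⟩
        have h2 := (hW'm f).1 hf
        have h3 : f.image Subtype.val = e := by
          apply hps _ h2 _ he
          rw [← hSc, ← hci S]
          apply Finset.card_le_card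
          exact Finset.subset_inter (Finset.image_subset_image hSf) hSe
        apply Finset.image_injective (Subtype.val_injective : Function.Injective (Subtype.val : ↥T → α))
        rw [h3]
        exact (hsub e (hE e he).1).symm
  obtain ⟨f, hf, hfe⟩ := uniq hr hSt hW
  obtain ⟨t0, ht0⟩ := hTn
  let φ : α → ι := fun v => if h : v ∈ T then f ⟨v, h⟩ else f ⟨t0, ht0⟩
  have φv : ∀ z : ↥T, φ z.1 = f z := fun z => by simp [φ, z.2]
  refine ⟨φ, ?_⟩
  have : E ∩ BF φ T W = E := by
    rw [Finset.inter_eq_left]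
    intro e he
    have heT := (hE e he).1
    rw [mem_BF]
    refine ⟨heT, ?_, ?_⟩
    · intro p hp q hq hpq
      have := φv ⟨p, heT hp⟩
      have h3 := φv ⟨q, heT hq⟩
      simp only at this h3
      rw [this, h3] at hpq
      exact congrArg Subtype.val (hf.1 hpq)
    · have h2 := (hfe (e.subtype (· ∈ T))).1 ((hW'm _).2 (by rw [hsub e heT]; exact he))
      have h3 : e.image φ = (e.subtype (· ∈ T)).image f := by
        conv_lhs => rw [← hsub e heT]
        rw [Finset.image_image]
        exact Finset.image_congr (fun z _ => φv z)
      rw [h3]; exact h2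
  rw [this]
  have hPl := lagr_le hr hE hS hx h1
  have : (lam r - PE E x) ≤ (lam r - PE E x) / g1 := by
    rw [le_div_iff₀ hg]
    have : g1 ≤ 1 := by unfold g1; norm_num
    nlinarith
  linarith

theorem stability (hr : r = 5 ∨ r = 6) (hW : St r W) (n : ℕ) : ∀ (T : Finset α), T.card = n →
    ∀ (E : Finset (Finset α)) (x : α → ℝ), Unif r T E → SF E → (∀ v, 0 ≤ x v) →
      ∑ v ∈ T, x v = 1 → lam r - e0 ≤ PE E x → StabP r W T E x := by
  induction n with
  | zero =>
    intro T hT E x _ _ _ h1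
    rw [Finset.card_eq_zero] at hT
    subst hT
    simp at h1
  | succ n ih =>
    intro T hT E x hE hS hx h1 hP
    have IH : ∀ u ∈ T, ∀ (E' : Finset (Finset α)) (x' : α → ℝ), Unif r (T.erase u) E' → SF E' →
        (∀ v, 0 ≤ x' v) →
      ∑ v ∈ T.erase u, x' v = 1 → lam r - e0 ≤ PE E' x' → StabP r W (T.erase u) E' x' := by
      intro u hu
      exact ih (T.erase u) (by rw [Finset.card_erase_of_mem hu, hT]; rfl)
    by_cases hlow : ∃ u ∈ T, Dg E x {u} ≤ rlam r - g1
    · obtain ⟨u, hu, hD⟩ := hlow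
      exact stab_low hr hE hS hx h1 hP hu hD (IH u hu)
    push Not at hlow
    have hD : ∀ v ∈ T, rlam r - g1 ≤ Dg E x {v} := fun v hv => (hlow v hv).le
    by_cases hc : ∀ u ∈ T, ∀ v ∈ T, u ≠ v → ∃ e ∈ E, u ∈ e ∧ v ∈ e
    · exact stab_cov hr hW hE hS hx h1 hD hc
    push Not at hc
    obtain ⟨u, hu, v, hv, huv, hno⟩ := hc
    rcases le_total (Dg E x {u}) (Dg E x {v}) with h | h
    · exact stab_merge hr hW hE hS hx h1 hP hD hu hv huv (fun e he a b => hno e he a b) h (IH u hu)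
    · exact stab_merge hr hW hE hS hx h1 hP hD hv hu huv.symm (fun e he a b => hno e he b a) h (IH v hv)

end Stab
end DensityCH
end

section
namespace DensityCH
open Finset
set_option linter.all false
set_option exponentiation.threshold 3000

section WN
variable {α ι : Type*} [DecidableEq α] [DecidableEq ι] [Fintype ι] {r : ℕ} {W : Finset (Finset ι)}

def pN (W : Finset (Finset ι)) (a : ι → ℕ) : ℕ := ∑ e ∈ W, ∏ i ∈ e, a i

def wB (W : Finset (Finset ι)) (n : ℕ) : ℕ := (Finset.piAntidiag (Finset.univ : Finset ι) n).sup (pN W)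

lemma pN_cast (W : Finset (Finset ι)) (a : ι → ℕ) : (pN W a : ℝ) = PE W (fun i => (a i : ℝ)) := by
  unfold pN PE wt
  push_cast
  rfl

lemma wB_ge {a : ι → ℕ} {n : ℕ} (h : ∑ i, a i = n) : pN W a ≤ wB W n :=
  Finset.le_sup (f := pN W) (by rw [Finset.mem_piAntidiag]; exact ⟨h, fun i _ => Finset.mem_univ i⟩)

lemma wB_ex [Nonempty ι] (W : Finset (Finset ι)) (n : ℕ) : ∃ a : ι → ℕ, ∑ i, a i = n ∧ pN W a = wB W n := by
  have hne : (Finset.piAntidiag (Finset.univ : Finset ι) n).Nonempty := by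
    obtain ⟨i⟩ := (inferInstance : Nonempty ι)
    refine ⟨Pi.single i n, ?_⟩
    rw [Finset.mem_piAntidiag]
    exact ⟨by simp, fun i _ => Finset.mem_univ i⟩
  obtain ⟨a, ha, h⟩ := Finset.exists_mem_eq_sup _ hne (pN W)
  rw [Finset.mem_piAntidiag] at ha
  exact ⟨a, ha.1, h.symm⟩

lemma card_BF (φ : α → ι) (T : Finset α) (W : Finset (Finset ι)) :
    (BF φ T W).card = pN W (fun i => (T.filter (φ · = i)).card) := by
  have h1 := PE_BF φ T W (fun _ => (1:ℝ))
  have h2 : PE (BF φ T W) (fun _ => (1:ℝ)) = ((BF φ T W).card : ℝ) := by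
    unfold PE wt; simp
  have h3 : pt φ T (fun _ => (1:ℝ)) = fun i => ((T.filter (φ · = i)).card : ℝ) := by
    funext i; unfold pt; simp
  rw [h2, h3, ← pN_cast] at h1
  exact_mod_cast h1

lemma sum_fib (φ : α → ι) (T : Finset α) : ∑ i, (T.filter (φ · = i)).card = T.card :=
  (Finset.card_eq_sum_card_fiberwise (fun v _ => Finset.mem_univ (φ v))).symm

lemma card_BF_le (φ : α → ι) (T : Finset α) (W : Finset (Finset ι)) : (BF φ T W).card ≤ wB W T.card := by
  rw [card_BF]; exact wB_ge (sum_fib φ T)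

lemma ex_phi [Nonempty ι] (T : Finset α) (a : ι → ℕ) (h : ∑ i, a i = T.card) :
    ∃ φ : α → ι, ∀ i, (T.filter (φ · = i)).card = a i := by
  have hc : Fintype.card ↥T = Fintype.card (Σ i, Fin (a i)) := by
    rw [Fintype.card_coe, Fintype.card_sigma]; simp [h]
  let e := Fintype.equivOfCardEq hc
  let i0 : ι := Classical.arbitrary ι
  let φ : α → ι := fun v => if h : v ∈ T then (e ⟨v, h⟩).1 else i0
  refine ⟨φ, fun i => ?_⟩
  have : T.filter (φ · = i) = (Finset.univ : Finset (Fin (a i))).image (fun k => (e.symm ⟨i, k⟩).1) := by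
    ext v
    simp only [Finset.mem_filter, Finset.mem_image, Finset.mem_univ, true_and]
    constructor
    · rintro ⟨hv, hφ⟩
      simp only [φ, hv, dite_true] at hφ
      subst hφ
      exact ⟨(e ⟨v, hv⟩).2, by simp⟩
    · rintro ⟨k, rfl⟩
      refine ⟨(e.symm ⟨i, k⟩).2, ?_⟩
      simp [φ]
  rw [this, Finset.card_image_of_injective]
  · simp
  · intro k l hkl
    have := e.symm.injective (Subtype.ext hkl)
    simpa using this

lemma ex_BF [Nonempty ι] (T : Finset α) (W : Finset (Finset ι)) : ∃ φ : α → ι, (BF φ T W).card = wB W T.card := by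
  obtain ⟨a, ha, h⟩ := wB_ex W T.card
  obtain ⟨φ, hφ⟩ := ex_phi T a ha
  refine ⟨φ, ?_⟩
  rw [card_BF, ← h]
  congr 1
  funext i
  exact hφ i

lemma pN_mono {a b : ι → ℕ} (h : ∀ i, a i ≤ b i) : pN W a ≤ pN W b :=
  Finset.sum_le_sum fun e _ => Finset.prod_le_prod' fun i _ => h i

lemma St.ne (hW : St r W) : Nonempty ι := by
  rw [← Fintype.card_pos_iff, hW.ci]; omega

lemma pE_up (W : Finset (Finset ι)) (a : ι → ℕ) (i : ι) :
    (pN W (Function.update a i (a i + 1)) : ℝ) = pN W a + Dg W (fun i => (a i : ℝ)) {i} := by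
  rw [pN_cast, pN_cast, PE_split _ _ i, PE_split W (fun i => (a i : ℝ)) i]
  have h1 : PE (W.filter (i ∉ ·)) (fun j => ((Function.update a i (a i + 1) j : ℕ) : ℝ))
      = PE (W.filter (i ∉ ·)) (fun j => (a j : ℝ)) := by
    apply PE_congr
    intro e he j hj
    have : j ≠ i := by rintro rfl; exact (Finset.mem_filter.1 he).2 hj
    simp [this]
  have h2 : Dg W (fun j => ((Function.update a i (a i + 1) j : ℕ) : ℝ)) {i} = Dg W (fun j => (a j : ℝ)) {i} := by
    apply Dg_congr
    intro e he _ j hj hji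
    have : j ≠ i := by simpa using hji
    simp [this]
  rw [h1, h2]
  simp only [Function.update_self]
  push_cast
  ring

lemma sum_up (a : ι → ℕ) (i : ι) : ∑ j, Function.update a i (a i + 1) j = ∑ j, a j + 1 := by
  rw [Finset.sum_update_of_mem (Finset.mem_univ i), ← Finset.sum_sdiff (Finset.subset_univ {i})]
  simp; omega

lemma wB_inc_lb (hW : St r W) (s : ℕ) : (r:ℝ) * wB W s ≤ s * ((wB W (s+1) : ℝ) - wB W s) := by
  haveI := hW.ne
  obtain ⟨a, ha, h⟩ := wB_ex W s
  have h1 := sum_x_Dg hW.unif (fun i => (a i : ℝ))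
  rw [← pN_cast, h] at h1
  rw [← h1]
  have h2 : ((s:ℕ):ℝ) = ∑ i, (a i : ℝ) := by rw [← ha]; push_cast; rfl
  rw [h2, Finset.sum_mul]
  apply Finset.sum_le_sum
  intro i _
  apply mul_le_mul_of_nonneg_left _ (Nat.cast_nonneg _)
  have h3 := pE_up W a i
  have h4 : pN W (Function.update a i (a i + 1)) ≤ wB W (s+1) := wB_ge (by rw [sum_up, ha])
  have h5 : (pN W (Function.update a i (a i + 1)) : ℝ) ≤ wB W (s+1) := by exact_mod_cast h4
  rw [h] at h3
  linarith

lemma wB_inc_ub (hW : St r W) (s : ℕ) : ((s:ℝ)+1) * ((wB W (s+1) : ℝ) - wB W s) ≤ r * wB W (s+1) := by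
  haveI := hW.ne
  obtain ⟨a, ha, h⟩ := wB_ex W (s+1)
  have h1 := sum_x_Dg hW.unif (fun i => (a i : ℝ))
  rw [← pN_cast, h] at h1
  rw [← h1]
  have h2 : ((s:ℝ)+1) = ∑ i, (a i : ℝ) := by
    have : ((s+1:ℕ):ℝ) = ∑ i, (a i : ℝ) := by rw [← ha]; push_cast; rfl
    rw [← this]; push_cast; rfl
  rw [h2, Finset.sum_mul]
  apply Finset.sum_le_sum
  intro i _
  rcases Nat.eq_zero_or_pos (a i) with h0 | h0
  · simp [h0]
  apply mul_le_mul_of_nonneg_left _ (Nat.cast_nonneg _)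
  set b := Function.update a i (a i - 1) with hb
  have hba : Function.update b i (b i + 1) = a := by
    rw [hb]; simp [Nat.sub_add_cancel h0]
  have h3 := pE_up W b i
  rw [hba, h] at h3
  have hsb := sum_up b i
  rw [hba, ha] at hsb
  have h4 : pN W b ≤ wB W s := wB_ge (by omega)
  have h5 : (pN W b : ℝ) ≤ wB W s := by exact_mod_cast h4
  have h6 : Dg W (fun j => (b j : ℝ)) {i} = Dg W (fun j => (a j : ℝ)) {i} := by
    apply Dg_congr
    intro e he _ j hj hji
    have : j ≠ i := by simpa using hji
    simp [hb, this]
  rw [h6] at h3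
  linarith

lemma wB_mono (hW : St r W) {s t : ℕ} (h : s ≤ t) : wB W s ≤ wB W t := by
  haveI := hW.ne
  induction h with
  | refl => exact le_rfl
  | step _ ih =>
    refine ih.trans ?_
    rename_i m _
    obtain ⟨a, ha, h⟩ := wB_ex W m
    obtain ⟨i⟩ := hW.ne
    rw [← h]
    refine (pN_mono (b := Function.update a i (a i + 1)) ?_).trans (wB_ge (by rw [sum_up, ha]))
    intro j
    by_cases hj : j = i
    · subst hj; simp
    · simp [hj]

lemma wB_le (hr : r = 5 ∨ r = 6) (hW : St r W) (n : ℕ) : (wB W n : ℝ) ≤ lam r * n^r := by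
  haveI := hW.ne
  obtain ⟨a, ha, h⟩ := wB_ex W n
  rcases Nat.eq_zero_or_pos n with h0 | h0
  · subst h0
    have : wB W 0 = 0 := by
      rw [← h]; unfold pN
      apply Finset.sum_eq_zero
      intro e he
      have hc := hW.ce e he
      obtain ⟨i, hi⟩ : e.Nonempty := by rw [← Finset.card_pos]; omega
      apply Finset.prod_eq_zero hi
      exact Finset.sum_eq_zero_iff.1 ha i (Finset.mem_univ i)
    rw [this]
    have : r ≠ 0 := by omega
    simp [this]
  have hn : (0:ℝ) < n := by exact_mod_cast h0
  have h1 := pW_le hr hW (a := fun i => (n:ℝ)⁻¹ * a i) (fun i => by positivity) (by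
    rw [← Finset.mul_sum]
    have : ((n:ℕ):ℝ) = ∑ i, (a i : ℝ) := by rw [← ha]; push_cast; rfl
    rw [← this]; exact inv_mul_cancel₀ hn.ne')
  rw [PE_smul hW.unif, ← pN_cast, h, inv_pow] at h1
  rw [inv_mul_le_iff₀ (by positivity)] at h1
  linarith

lemma lam_W (hr : r = 5 ∨ r = 6) (hW : St r W) : lam r * ((r:ℝ)+6)^r = W.card := by
  have h := hW.card (by omega)
  have hl := r_lam hr
  rcases hr with rfl | rfl
  · have h1 : W.card = 66 := by
      have : (5+6).choose (5-1) = 330 := by decide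
      omega
    rw [h1]
    rw [rlam5] at hl
    norm_num at hl ⊢
    linarith
  · have h1 : W.card = 132 := by
      have : (6+6).choose (6-1) = 792 := by decide
      omega
    rw [h1]
    rw [rlam6] at hl
    norm_num at hl ⊢
    linarith

lemma wB_lb (hr : r = 5 ∨ r = 6) (hW : St r W) {n : ℕ} (hn : 12 ≤ n) : lam r * ((n:ℝ) - 12)^r ≤ wB W n := by
  haveI := hW.ne
  have h1 : pN W (fun _ => n / (r+6)) ≤ wB W n := by
    refine le_trans ?_ (wB_mono hW (s := (r+6) * (n/(r+6))) (Nat.mul_div_le n (r+6)))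
    exact wB_ge (by simp [hW.ci])
  have h2 : pN W (fun _ => n / (r+6)) = W.card * (n/(r+6))^r := by
    unfold pN
    rw [← smul_eq_mul, ← Finset.sum_const]
    apply Finset.sum_congr rfl
    intro e he
    rw [Finset.prod_const, hW.ce e he]
  rw [h2] at h1
  have h3 : ((W.card * (n/(r+6))^r : ℕ):ℝ) ≤ wB W n := by exact_mod_cast h1
  refine le_trans ?_ h3
  push_cast
  rw [← lam_W hr hW, mul_assoc, ← mul_pow]
  apply mul_le_mul_of_nonneg_left _ (lam_pos hr).le
  apply pow_le_pow_left₀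
  · have : (12:ℝ) ≤ n := by exact_mod_cast hn
    linarith
  · have h4 : n ≤ (r+6) * (n/(r+6)) + 12 := by
      have := Nat.div_add_mod n (r+6)
      have h5 := Nat.mod_lt n (show r+6 > 0 by omega)
      omega
    have h5 : (n:ℝ) ≤ ((r:ℝ)+6) * ((n/(r+6) : ℕ):ℝ) + 12 := by exact_mod_cast h4
    linarith

end WN
end DensityCH
end

section
namespace DensityCH
open Finset
set_option linter.all false
set_option exponentiation.threshold 3000

section TFree
variable {α ι : Type*} [DecidableEq α] [DecidableEq ι] [Fintype ι] {r : ℕ} {W : Finset (Finset ι)}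

/-- `𝕋_r`-freeness in terms of edge sets -/
def TF (E : Finset (Finset α)) : Prop :=
  ∀ S a b, a ≠ b → a ∉ S → b ∉ S → insert a S ∈ E → insert b S ∈ E →
    ∀ C ∈ E, a ∈ C → b ∈ C → ¬ Disjoint S C

lemma TF_mono {E F : Finset (Finset α)} (h : TF E) (hF : F ⊆ E) : TF F :=
  fun S a b hab ha hb hA hB C hC h1 h2 => h S a b hab ha hb (hF hA) (hF hB) C (hF hC) h1 h2

/-- uniform weights -/
noncomputable def cst (T : Finset α) : α → ℝ := fun _ => (T.card : ℝ)⁻¹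

lemma cst_nonneg (T : Finset α) (v : α) : 0 ≤ cst T v := by unfold cst; positivity

lemma cst_sum {T : Finset α} (h : 0 < T.card) : ∑ v ∈ T, cst T v = 1 := by
  unfold cst
  rw [Finset.sum_const, nsmul_eq_mul]
  exact mul_inv_cancel₀ (by positivity)

lemma PE_cst {T : Finset α} {E : Finset (Finset α)} (hE : Unif r T E) :
    PE E (cst T) = E.card * (T.card : ℝ)⁻¹^r := by
  unfold PE cst
  rw [← nsmul_eq_mul, ← Finset.sum_const]
  exact Finset.sum_congr rfl fun e he => by rw [wt_const, (hE e he).2]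

lemma Dg_cst {T : Finset α} {E : Finset (Finset α)} (hE : Unif r T E) (v : α) :
    Dg E (cst T) {v} = (E.filter (v ∈ ·)).card * (T.card : ℝ)⁻¹^(r-1) := by
  unfold Dg cst
  rw [← nsmul_eq_mul, ← Finset.sum_const]
  apply Finset.sum_congr (by simp)
  intro e he
  rw [Finset.mem_filter] at he
  rw [wt_const, Finset.card_sdiff_of_subset (Finset.singleton_subset_iff.2 he.2), (hE e he.1).2]; simp

lemma meet_le {x : α → ℝ} (hx : ∀ v, 0 ≤ x v) {T : Finset α} (h1 : ∑ v ∈ T, x v = 1) {k : ℕ}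
    {L : Finset (Finset α)} (hL : Unif (k+1) T L) {A : Finset α} (hA : ∀ s ∈ L, ¬ Disjoint A s) :
    PE L x ≤ ∑ a ∈ A, x a := by
  have h2 := PE_meet hx (L := L) (A := A) (c := 1) (by
    intro a _
    rw [Dg_lk]
    exact Dg_le_one hx h1 (unif_sup (Finset.erase_subset _ _) (unif_lk hL a)))
  rw [one_mul] at h2
  convert h2 using 2
  symm
  rw [Finset.filter_eq_self]
  intro s hs
  have := hA s hs
  rw [Finset.not_disjoint_iff] at this
  exact this

lemma tf_pair {T : Finset α} {E : Finset (Finset α)} (hr : 3 ≤ r) (hE : Unif r T E) (hT : TF E) (h0 : 0 < T.card)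
    {E' : Finset (Finset α)} (hE' : E' ⊆ E)
    {S : Finset α} {a b : α} (hab : a ≠ b) (ha : a ∉ S) (hb : b ∉ S) (hA : insert a S ∈ E) (hB : insert b S ∈ E) :
    Dg E' (cst T) {a, b} ≤ ((r:ℝ) - 1) / T.card := by
  obtain ⟨k, rfl⟩ : ∃ k, r = k + 3 := ⟨r - 3, by omega⟩
  rw [Dg_insert E' (cst T) (by simpa using hab), Dg_lk]
  have hE'u : Unif (k+3) T E' := unif_mono hE hE'
  have hu : Unif (k+1) T (lk (lk E' a) b) :=
    unif_sup ((Finset.erase_subset _ _).trans (Finset.erase_subset _ _)) (unif_lk (unif_lk hE'u a) b)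
  refine (meet_le (cst_nonneg T) (cst_sum h0) hu (A := S) ?_).trans ?_
  · intro s hs hd
    rw [mem_lk, mem_lk] at hs
    refine hT S a b hab ha hb hA hB _ (hE' hs.2.2) (by simp) (by simp) ?_
    rw [Finset.disjoint_insert_right, Finset.disjoint_insert_right]
    exact ⟨ha, hb, hd⟩
  · have hc := (hE _ hA).2
    rw [Finset.card_insert_of_notMem ha] at hc
    unfold cst
    rw [Finset.sum_const, nsmul_eq_mul, div_eq_mul_inv]
    have : (S.card : ℝ) = ((k+3:ℕ):ℝ) - 1 := by
      have : S.card = k + 2 := by omega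
      rw [this]; push_cast; ring
    rw [this]

lemma tf_apx {T : Finset α} {E : Finset (Finset α)} (hr : 3 ≤ r) (hE : Unif r T E) (hT : TF E) (h0 : 0 < T.card) :
    Apx E (cst T) (r / T.card) := by
  have hn : (0:ℝ) < T.card := by exact_mod_cast h0
  constructor
  · intro S a b hab ha hb hA hB
    refine (tf_pair hr hE hT h0 subset_rfl hab ha hb hA hB).trans ?_
    apply div_le_div_of_nonneg_right _ hn.le
    linarith
  · intro a b hab e he hae hbe
    obtain ⟨k, rfl⟩ : ∃ k, r = k + 2 := ⟨r - 2, by omega⟩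
    have hu : Unif (k+1) T (lk E a ∩ lk E b) :=
      unif_sup (Finset.erase_subset _ _) (unif_mono (unif_lk hE a) Finset.inter_subset_left)
    refine (meet_le (cst_nonneg T) (cst_sum h0) hu (A := e) ?_).trans ?_
    · intro s hs hd
      rw [Finset.mem_inter, mem_lk, mem_lk] at hs
      exact hT s a b hab hs.1.1 hs.2.1 hs.1.2 hs.2.2 e he hae hbe hd.symm
    · unfold cst
      rw [Finset.sum_const, nsmul_eq_mul, div_eq_mul_inv, (hE e he).2]

lemma tf_clean {T : Finset α} {E : Finset (Finset α)} (hr : 3 ≤ r) (hE : Unif r T E) (hT : TF E) (h0 : 0 < T.card) :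
    ∃ E' ⊆ E, SF E' ∧ PE E (cst T) - r / T.card ≤ PE E' (cst T) := by
  have hn : (0:ℝ) < T.card := by exact_mod_cast h0
  have hr0 : (0:ℝ) < r := by exact_mod_cast (show 0 < r by omega)
  obtain ⟨E', hE', h1, h2⟩ := cleaning (cst_nonneg T) (η := r / T.card) (by positivity) 2 _ E rfl
  refine ⟨E', hE', ?_, ?_⟩
  · intro S a b hab ha hb hA hB C hC haC hbC
    have h3 := h1 C hC {a, b} (by
      intro z hz
      rw [Finset.mem_insert, Finset.mem_singleton] at hz
      rcases hz with rfl | rfl <;> assumption) (Finset.card_pair hab)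
    have h4 := tf_pair hr hE hT h0 hE' hab ha hb (hE' hA) (hE' hB)
    have h5 : ((r:ℝ) - 1) / T.card < r / T.card := div_lt_div_of_pos_right (by linarith) hn
    linarith
  · have h3 := PE_inter_add E E' (cst T)
    rw [Finset.inter_eq_right.2 hE'] at h3
    have h4 : PE (shd 2 E) (cst T) ≤ 1 := by
      apply Dg_le_one (cst_nonneg T) (cst_sum h0) (k := 2)
      intro q hq
      rw [mem_shd] at hq
      obtain ⟨e, he, hqe, hc⟩ := hq
      exact ⟨hqe.trans (hE e he).1, hc⟩
    have h5 : (r:ℝ) / T.card * PE (shd 2 E) (cst T) ≤ r / T.card := by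
      have : 0 ≤ (r:ℝ) / T.card := by positivity
      nlinarith
    linarith

lemma tf_LS (hr : r = 5 ∨ r = 6) (hW : St r W) {T : Finset α} {E : Finset (Finset α)} (hE : Unif r T E)
    (hT : TF E) (h0 : 0 < T.card) {η δ : ℝ} (hη0 : 0 < η) (hη : η ≤ 1/10^8) (hP : lam r - δ ≤ PE E (cst T))
    (hδ0 : 0 ≤ δ) (hδ : δ + r / T.card ≤ e0) (hδ' : δ + r / T.card ≤ g1 * ((η^2/6000)^2/10^8)) :
    ∃ φ : α → ι, LS r W T E (cst T) φ η (r / T.card) := by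
  have hn : (0:ℝ) < T.card := by exact_mod_cast h0
  obtain ⟨E', hE', hS, hP'⟩ := tf_clean (by omega) hE hT h0
  obtain ⟨φ, hφ⟩ := stability hr hW _ T rfl E' (cst T) (unif_mono hE hE') hS (cst_nonneg T) (cst_sum h0) (by linarith)
  refine ⟨φ, ?_⟩
  have hg := g1_pos
  have hth : 0 ≤ (r:ℝ) / T.card := by positivity
  apply mkLS hr hW hE (cst_nonneg T) (cst_sum h0) hη0 hη _ (tf_apx (by omega) hE hT h0) hth
  · have hg1 : g1 ≤ 1 := by unfold g1; norm_num
    have h2 : η^2 ≤ η := by nlinarith [show (1:ℝ)/10^8 ≤ 1 by norm_num]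
    have h3 : (η^2/6000)^2 ≤ η := by nlinarith [show (1:ℝ)/10^8 ≤ 1 by norm_num]
    have h4 : g1 * ((η^2/6000)^2/10^8) ≤ 1 * ((η^2/6000)^2/10^8) :=
      mul_le_mul_of_nonneg_right hg1 (by positivity)
    have h5 : (η^2/6000)^2/10^8 ≤ η := by
      have : 0 ≤ (η^2/6000)^2 := by positivity
      linarith
    linarith
  · have h2 : (lam r - PE E' (cst T)) / g1 ≤ (η^2/6000)^2/10^8 := by
      rw [div_le_iff₀ hg]; linarith
    have h3 : E' ∩ BF φ T W ⊆ E ∩ BF φ T W := Finset.inter_subset_inter_right hE'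
    have h4 := PE_mono (cst_nonneg T) h3
    linarith

/-- the core: large minimum degree -/
lemma core (hr : r = 5 ∨ r = 6) (hW : St r W) {T : Finset α} {E : Finset (Finset α)} (hE : Unif r T E)
    (hT : TF E) (h0 : 12 / e0 ≤ T.card) (hD : ∀ v ∈ T, rlam r - e0/2 ≤ Dg E (cst T) {v}) :
    E.card ≤ wB W T.card ∧ (E.card = wB W T.card → ∃ φ : α → ι, E = BF φ T W) := by
  have he := e0_pos
  have hn : (0:ℝ) < T.card := lt_of_lt_of_le (by positivity) h0
  have h0' : 0 < T.card := by exact_mod_cast hn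
  have hr6 : (r:ℝ) ≤ 6 := by rcases hr with rfl | rfl <;> norm_num
  have hr5 : (5:ℝ) ≤ r := by rcases hr with rfl | rfl <;> norm_num
  have hrn : (r:ℝ) / T.card ≤ e0 / 2 := by
    rw [div_le_iff₀ hn]
    rw [div_le_iff₀ he] at h0
    linarith
  have hP : lam r - e0/2 ≤ PE E (cst T) := by
    have h1 := sum_x_Dg hE (cst T)
    have h2 : ∑ v ∈ T, cst T v * (rlam r - e0/2) ≤ ∑ v ∈ T, cst T v * Dg E (cst T) {v} :=
      Finset.sum_le_sum fun v hv => mul_le_mul_of_nonneg_left (hD v hv) (cst_nonneg T v)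
    rw [← Finset.sum_mul, cst_sum h0', one_mul, h1, ← r_lam hr] at h2
    by_contra hc
    push Not at hc
    nlinarith
  obtain ⟨φ, hφ⟩ := tf_LS hr hW hE hT h0' (η := 1/10^40) (δ := e0/2) (by norm_num) (by norm_num) hP (by positivity)
    (by linarith) (by
      have : e0 ≤ g1 * (((1/10^40)^2/6000)^2/10^8) := by unfold e0 g1; norm_num
      linarith)
  obtain ⟨ψ, hψ⟩ := hφ.lemR le_rfl (fun v hv => by
    have := hD v hv
    have : e0 / 2 ≤ 1/10^40 := by unfold e0; norm_num
    linarith)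
  have hBu : Unif r T (BF ψ T W) := by
    intro e he
    rw [mem_BF] at he
    refine ⟨he.1, ?_⟩
    rw [← Finset.card_image_of_injOn he.2.1]
    exact hW.ce _ he.2.2
  have hsw := PE_swap E (BF ψ T W) (cst T)
  have hM := PE_nonneg (cst_nonneg T) (BF ψ T W \ E)
  have hle : PE E (cst T) ≤ PE (BF ψ T W) (cst T) := by linarith
  have hc := card_BF_le ψ T W
  rw [PE_cst hE, PE_cst hBu] at hle
  have hpos : (0:ℝ) < (T.card : ℝ)⁻¹^r := by positivity
  have hle2 : E.card ≤ (BF ψ T W).card := by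
    have := le_of_mul_le_mul_right hle hpos
    exact_mod_cast this
  refine ⟨hle2.trans hc, ?_⟩
  intro heq
  refine ⟨ψ, ?_⟩
  have hceq : E.card = (BF ψ T W).card := by omega
  rw [PE_cst hE, PE_cst hBu, hceq] at hsw
  have hM0 : PE (BF ψ T W \ E) (cst T) = 0 := by linarith
  rw [PE_cst (unif_mono hBu Finset.sdiff_subset)] at hM0
  have h3 : ((BF ψ T W \ E).card : ℝ) = 0 := by
    rcases mul_eq_zero.1 hM0 with h | h
    · exact h
    · exact absurd h hpos.ne'
  have h4 : BF ψ T W \ E = ∅ := by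
    rw [← Finset.card_eq_zero]; exact_mod_cast h3
  rw [Finset.sdiff_eq_empty_iff_subset] at h4
  exact (Finset.eq_of_subset_of_card_le h4 hceq.le).symm

lemma rlam_pos' (hr : r = 5 ∨ r = 6) : 0 < rlam r := rlam_pos hr

lemma wB_inc (hr : r = 5 ∨ r = 6) (hW : St r W) {s : ℕ} (hs : 400 / e0 ≤ s) :
    (rlam r - e0/2) * ((s:ℝ)+1)^(r-1) + 1 ≤ (wB W (s+1) : ℝ) - wB W s := by
  have he := e0_pos
  have he1 : e0 ≤ 1 := by unfold e0; norm_num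
  have hs4 : (400:ℝ) ≤ s := by
    refine le_trans ?_ hs
    rw [le_div_iff₀ he]; linarith
  have hsn : 12 ≤ s := by
    have : (12:ℝ) ≤ s := by linarith
    exact_mod_cast this
  have h1 := wB_inc_lb hW s
  have h2 := wB_lb hr hW hsn
  have hr6 : (r:ℝ) ≤ 6 := by rcases hr with rfl | rfl <;> norm_num
  have hr0 : (0:ℝ) ≤ r := by positivity
  set u : ℝ := (s:ℝ) + 1 with hu
  have hu0 : 0 < u := by rw [hu]; linarith
  have hrl := r_lam hr
  have hrp := rlam_pos hr
  have hrlt := rlam_lt hr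
  -- Bernoulli
  have h3 : u^r * (1 - 78/u) ≤ ((s:ℝ) - 12)^r := by
    have hb := one_add_mul_le_pow (a := -(13/u)) (by
      have : 13/u ≤ 2 := by rw [div_le_iff₀ hu0]; rw [hu]; linarith
      linarith) r
    have e1 : (s:ℝ) - 12 = u * (1 + -(13/u)) := by rw [hu]; field_simp; ring
    rw [e1, mul_pow]
    apply mul_le_mul_of_nonneg_left _ (by positivity)
    refine le_trans ?_ hb
    have : (r:ℝ) * (13/u) ≤ 6 * (13/u) := mul_le_mul_of_nonneg_right hr6 (by positivity)
    have e2 : 78/u = 6 * (13/u) := by ring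
    rw [e2]; linarith
  have h4 : rlam r * (u^r * (1 - 78/u)) ≤ s * ((wB W (s+1) : ℝ) - wB W s) := by
    calc rlam r * (u^r * (1 - 78/u)) ≤ rlam r * ((s:ℝ) - 12)^r := mul_le_mul_of_nonneg_left h3 hrp.le
      _ = r * (lam r * ((s:ℝ) - 12)^r) := by rw [← hrl]; ring
      _ ≤ r * wB W s := mul_le_mul_of_nonneg_left h2 hr0
      _ ≤ _ := h1
  have h5 : (0:ℝ) ≤ (wB W (s+1) : ℝ) - wB W s := by
    have : wB W s ≤ wB W (s+1) := wB_mono hW (by omega)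
    have : (wB W s : ℝ) ≤ wB W (s+1) := by exact_mod_cast this
    linarith
  have h6 : rlam r * (u^r * (1 - 78/u)) ≤ u * ((wB W (s+1) : ℝ) - wB W s) := by
    refine h4.trans (mul_le_mul_of_nonneg_right (by rw [hu]; linarith) h5)
  have hur : u^r = u * u^(r-1) := by rw [← pow_succ']; congr 1; omega
  rw [hur] at h6
  have h7 : rlam r * (u^(r-1) * (1 - 78/u)) ≤ (wB W (s+1) : ℝ) - wB W s := by
    apply le_of_mul_le_mul_left _ hu0
    linarith
  refine le_trans ?_ h7
  have hU : u ≤ u^(r-1) := by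
    apply le_self_pow₀ (by rw [hu]; linarith) (by omega)
  have hsu : 400 ≤ e0 * u := by
    rw [div_le_iff₀ he] at hs
    rw [hu]; nlinarith
  have h8 : rlam r * (78/u) ≤ e0/4 := by
    have : 78/u ≤ e0/4 := by rw [div_le_iff₀ hu0]; linarith
    have h9 : 0 ≤ 78/u := by positivity
    nlinarith
  have h9 : 1 ≤ e0/4 * u^(r-1) := by nlinarith
  have h10 : rlam r * (78/u) * u^(r-1) ≤ e0/4 * u^(r-1) := mul_le_mul_of_nonneg_right h8 (by positivity)
  nlinarith

noncomputable def n1 : ℕ := ⌈400 / e0⌉₊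

lemma n1_le {s : ℕ} (h : n1 ≤ s) : 400 / e0 ≤ s := (Nat.le_ceil _).trans (by exact_mod_cast h)

lemma turan_step (hr : r = 5 ∨ r = 6) (hW : St r W) {s : ℕ} (hs : n1 ≤ s) {T : Finset α} (hc : T.card = s + 1)
    {E : Finset (Finset α)} (hE : Unif r T E) (hT : TF E) :
    (E.card ≤ wB W T.card ∧ (E.card = wB W T.card → ∃ φ : α → ι, E = BF φ T W)) ∨
    ∃ v ∈ T, E.card + wB W s + 1 ≤ (E.filter (v ∉ ·)).card + wB W (s+1) := by
  have he := e0_pos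
  have h400 := n1_le hs
  by_cases hD : ∀ v ∈ T, rlam r - e0/2 ≤ Dg E (cst T) {v}
  · left
    apply core hr hW hE hT _ hD
    rw [hc]; push_cast
    have : 12 / e0 ≤ 400 / e0 := div_le_div_of_nonneg_right (by norm_num) he.le
    linarith
  · right
    push Not at hD
    obtain ⟨v, hv, hD⟩ := hD
    refine ⟨v, hv, ?_⟩
    rw [Dg_cst hE, hc] at hD
    have hinc := wB_inc hr hW h400
    have hp : (0:ℝ) < (((s+1:ℕ):ℝ))^(r-1) := by positivity
    rw [inv_pow, ← div_eq_mul_inv, div_lt_iff₀ hp] at hD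
    push_cast at hD
    have hcard : (E.filter (v ∈ ·)).card + (E.filter (v ∉ ·)).card = E.card :=
      Finset.card_filter_add_card_filter_not _
    have hcard' : ((E.filter (v ∈ ·)).card : ℝ) + ((E.filter (v ∉ ·)).card : ℝ) = E.card := by exact_mod_cast hcard
    have : (E.card : ℝ) + wB W s + 1 ≤ ((E.filter (v ∉ ·)).card : ℝ) + wB W (s+1) := by linarith
    exact_mod_cast this

lemma turan_aux (hr : r = 5 ∨ r = 6) (hW : St r W) (k : ℕ) : ∀ (T : Finset α), T.card = n1 + k →
    ∀ E : Finset (Finset α), Unif r T E → TF E → E.card ≤ wB W (n1 + k) + (n1^r - k) := by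
  induction k with
  | zero =>
    intro T hc E hE hT
    have h1 : E ⊆ T.powersetCard r := fun e he => Finset.mem_powersetCard.2 (hE e he)
    have h2 := Finset.card_le_card h1
    rw [Finset.card_powersetCard, hc] at h2
    have h3 := Nat.choose_le_pow (n1 + 0) r
    simp only [Nat.add_zero] at h2 h3 ⊢
    omega
  | succ k ih =>
    intro T hc E hE hT
    rcases turan_step hr hW (s := n1 + k) (by omega) (by omega) hE hT with h | ⟨v, hv, h⟩
    · rw [hc] at h
      exact h.1.trans (by omega)
    · have h2 := ih (T.erase v) (by rw [Finset.card_erase_of_mem hv, hc]; omega) _ (unif_filter_notMem hE v)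
        (TF_mono hT (Finset.filter_subset _ _))
      have e1 : n1 + (k+1) = n1 + k + 1 := by omega
      rw [e1]
      omega

noncomputable def n2 : ℕ := n1 + n1^6 + n1^5 + 1

theorem turan (hr : r = 5 ∨ r = 6) (hW : St r W) {T : Finset α} (hc : n2 ≤ T.card)
    {E : Finset (Finset α)} (hE : Unif r T E) (hT : TF E) :
    E.card ≤ wB W T.card ∧ (E.card = wB W T.card → ∃ φ : α → ι, E = BF φ T W) := by
  have hn : n1 + n1^r + 1 ≤ T.card := by
    unfold n2 at hc
    rcases hr with rfl | rfl <;> omega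
  obtain ⟨k, hk⟩ : ∃ k, T.card = n1 + k + 1 := ⟨T.card - n1 - 1, by omega⟩
  rcases turan_step hr hW (s := n1 + k) (by omega) hk hE hT with h | ⟨v, hv, h⟩
  · exact h
  · have h2 := turan_aux hr hW k (T.erase v) (by rw [Finset.card_erase_of_mem hv, hk]; omega) _
      (unif_filter_notMem hE v) (TF_mono hT (Finset.filter_subset _ _))
    have h3 : n1^r - k = 0 := by omega
    rw [h3] at h2
    rw [hk]
    constructor
    · omega
    · intro h4; omega

/-- boundedness -/
theorem bounded (hr : r = 5 ∨ r = 6) (hW : St r W) {T : Finset α} {E : Finset (Finset α)} (hE : Unif r T E)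
    (hT : TF E) (h0 : 12 / e0 ≤ T.card) (hP : lam r - e0/2 ≤ PE E (cst T)) {u : α} (hu : u ∈ T) :
    Dg E (cst T) {u} ≤ rlam r + 1/10^20 := by
  have he := e0_pos
  have hn : (0:ℝ) < T.card := lt_of_lt_of_le (by positivity) h0
  have h0' : 0 < T.card := by exact_mod_cast hn
  have hr6 : (r:ℝ) ≤ 6 := by rcases hr with rfl | rfl <;> norm_num
  have hrn : (r:ℝ) / T.card ≤ e0 / 2 := by
    rw [div_le_iff₀ hn]
    rw [div_le_iff₀ he] at h0
    linarith
  obtain ⟨φ, hφ⟩ := tf_LS hr hW hE hT h0' (η := 1/10^40) (δ := e0/2) (by norm_num) (by norm_num) hP (by positivity)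
    (by linarith) (by
      have : e0 ≤ g1 * (((1/10^40)^2/6000)^2/10^8) := by unfold e0 g1; norm_num
      linarith)
  refine (hφ.D_up hu).trans ?_
  norm_num

end TFree
end DensityCH
end

section
namespace DensityCH
open Finset
set_option linter.all false
set_option exponentiation.threshold 3000

section Matching
variable {α ι : Type*} [DecidableEq α] [DecidableEq ι] [Fintype ι] {r : ℕ} {W : Finset (Finset ι)}

/-- `M` is a family of disjoint `(2r-1)`-sets each spanning a generalized triangle -/
def Ms (r : ℕ) (E : Finset (Finset α)) (M : Finset (Finset α)) : Prop :=
  (∀ s ∈ M, s.card = 2*r-1 ∧ ¬ TF (E.filter (· ⊆ s))) ∧ ∀ s ∈ M, ∀ s' ∈ M, s ≠ s' → Disjoint s s'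

lemma Ms_sub {E M M' : Finset (Finset α)} (h : Ms r E M) (hs : M' ⊆ M) : Ms r E M' :=
  ⟨fun s hs' => h.1 s (hs hs'), fun s h1 s' h2 => h.2 s (hs h1) s' (hs h2)⟩

lemma not_TF_ex (hr : 1 ≤ r) {T : Finset α} {E : Finset (Finset α)} (hE : Unif r T E) (h : ¬ TF E) :
    ∃ s ⊆ T, s.card = 2*r-1 ∧ ¬ TF (E.filter (· ⊆ s)) := by
  unfold TF at h
  push Not at h
  obtain ⟨S, a, b, hab, ha, hb, hA, hB, C, hC, haC, hbC, hd⟩ := h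
  refine ⟨S ∪ C, Finset.union_subset ((Finset.subset_insert _ _).trans (hE _ hA).1) (hE _ hC).1, ?_, ?_⟩
  · rw [Finset.card_union_of_disjoint hd, (hE _ hC).2]
    have := (hE _ hA).2
    rw [Finset.card_insert_of_notMem ha] at this
    omega
  · intro hT
    refine hT S a b hab ha hb ?_ ?_ C ?_ haC hbC hd
    · rw [Finset.mem_filter]
      exact ⟨hA, Finset.insert_subset (Finset.mem_union_right _ haC) Finset.subset_union_left⟩
    · rw [Finset.mem_filter]
      exact ⟨hB, Finset.insert_subset (Finset.mem_union_right _ hbC) Finset.subset_union_left⟩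
    · rw [Finset.mem_filter]
      exact ⟨hC, Finset.subset_union_right⟩

lemma card_sup_le {T : Finset α} {E : Finset (Finset α)} (hE : Unif r T E) (Q : Finset α) :
    (E.filter (Q ⊆ ·)).card ≤ T.card^(r - Q.card) := by
  refine le_trans ?_ (Nat.choose_le_pow T.card (r - Q.card))
  rw [← Finset.card_powersetCard]
  apply Finset.card_le_card_of_injOn (· \ Q)
  · intro e he
    rw [Finset.mem_coe, Finset.mem_filter] at he
    rw [Finset.mem_coe, Finset.mem_powersetCard, Finset.card_sdiff_of_subset he.2, (hE e he.1).2]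
    exact ⟨Finset.sdiff_subset.trans (hE e he.1).1, rfl⟩
  · intro e he f hf hef
    rw [Finset.mem_coe, Finset.mem_filter] at he hf
    dsimp only at hef
    rw [← Finset.sdiff_union_of_subset he.2, ← Finset.sdiff_union_of_subset hf.2, hef]

lemma card_meet_le {T : Finset α} {E : Finset (Finset α)} (hE : Unif r T E) (X : Finset α) :
    E.card ≤ (E.filter (Disjoint X ·)).card + X.card * T.card^(r-1) := by
  rw [← Finset.card_filter_add_card_filter_not (s := E) (Disjoint X ·)]
  gcongr
  refine le_trans (Finset.card_le_card (t := X.biUnion fun x => E.filter ({x} ⊆ ·)) ?_) ?_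
  · intro e he
    rw [Finset.mem_filter, Finset.not_disjoint_iff] at he
    obtain ⟨h1, x, h2, h3⟩ := he
    rw [Finset.mem_biUnion]
    exact ⟨x, h2, by rw [Finset.mem_filter, Finset.singleton_subset_iff]; exact ⟨h1, h3⟩⟩
  · apply Finset.card_biUnion_le_card_mul
    intro x hx
    simpa using card_sup_le hE {x}

lemma deg_meet_le {T : Finset α} {E : Finset (Finset α)} (hE : Unif r T E) (X : Finset α) {v : α} (hv : v ∉ X) :
    (E.filter (v ∈ ·)).card ≤ ((E.filter (Disjoint X ·)).filter (v ∈ ·)).card + X.card * T.card^(r-2) := by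
  rw [← Finset.card_filter_add_card_filter_not (s := E.filter (v ∈ ·)) (Disjoint X ·), Finset.filter_comm]
  gcongr
  refine le_trans (Finset.card_le_card (t := X.biUnion fun x => E.filter ({v, x} ⊆ ·)) ?_) ?_
  · intro e he
    rw [Finset.mem_filter, Finset.mem_filter, Finset.not_disjoint_iff] at he
    obtain ⟨h1, x, h2, h3⟩ := he
    rw [Finset.mem_biUnion]
    exact ⟨x, h2, by
      rw [Finset.mem_filter, Finset.insert_subset_iff, Finset.singleton_subset_iff]; exact ⟨h1.1, h1.2, h3⟩⟩
  · apply Finset.card_biUnion_le_card_mul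
    intro x hx
    have h := card_sup_le hE {v, x}
    rwa [Finset.card_pair (by rintro rfl; exact hv hx)] at h

lemma unif_disj {T : Finset α} {E : Finset (Finset α)} (hE : Unif r T E) (X : Finset α) :
    Unif r (T \ X) (E.filter (Disjoint X ·)) := by
  intro e he
  rw [Finset.mem_filter] at he
  exact ⟨Finset.subset_sdiff.2 ⟨(hE e he.1).1, he.2.symm⟩, (hE e he.1).2⟩

/-- standing numeric assumption -/
structure Big (n t : ℕ) : Prop where
  hn : 1000 / e0 + n2 ≤ e0 * n
  ht : (t:ℝ) ≤ e0/100 * n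

/-- degree threshold -/
noncomputable def D0 (r n : ℕ) : ℝ := (rlam r + 2/10^10) * (n:ℝ)^(r-1)

lemma e0_le1 : e0 ≤ 1/10^100 := by unfold e0; norm_num

lemma Big.n0 {n t : ℕ} (h : Big n t) : 1000 / e0 + n2 ≤ (n:ℝ) := by
  have := h.hn
  have h1 := e0_le1
  have : e0 * n ≤ n := by
    have : (0:ℝ) ≤ n := Nat.cast_nonneg _
    nlinarith
  linarith

lemma Big.n1000 {n t : ℕ} (h : Big n t) : 1000 ≤ e0 * (n:ℝ) := by
  have := h.hn
  have he := e0_pos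
  have h1 := e0_le1
  have h2 : 1000 ≤ 1000/e0 := by rw [le_div_iff₀ he]; nlinarith
  have : (0:ℝ) ≤ n2 := Nat.cast_nonneg _
  linarith

lemma find (hr : r = 5 ∨ r = 6) (hW : St r W) {T : Finset α} {t : ℕ} (hb : Big T.card t)
    {E : Finset (Finset α)} (hE : Unif r T E) (hc : wB W (T.card - t) ≤ E.card) {X : Finset α} (hXT : X ⊆ T)
    (hX : X.card ≤ 12*(t+1)) {v : α} (hv : v ∈ T) (hvX : v ∉ X) (hd : D0 r T.card ≤ (E.filter (v ∈ ·)).card) :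
    ∃ s ⊆ T \ X, s.card = 2*r-1 ∧ ¬ TF (E.filter (· ⊆ s)) := by
  have he := e0_pos
  have he1 := e0_le1
  have hn0 := hb.n0
  have hn1 := hb.n1000
  have ht := hb.ht
  set n := T.card with hn
  have hu := unif_disj hE X
  by_cases hT : TF (E.filter (Disjoint X ·))
  swap
  · obtain ⟨s, h1, h2, h3⟩ := not_TF_ex (by omega) hu hT
    exact ⟨s, h1, h2, fun h => h3 (TF_mono h (Finset.filter_subset_filter _ (Finset.filter_subset _ _)))⟩
  exfalso
  have hXr : (X.card : ℝ) ≤ 12 * (t+1) := by exact_mod_cast hX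
  have hnp : (0:ℝ) < n := by nlinarith
  have hc' : (T \ X).card = n - X.card := Finset.card_sdiff_of_subset hXT
  have hXn : X.card ≤ n := Finset.card_le_card hXT
  have hcr : ((T \ X).card : ℝ) = n - X.card := by rw [hc', Nat.cast_sub hXn]
  have hX2 : (X.card:ℝ) ≤ e0/4 * n := by nlinarith
  have hp : (0:ℝ) < (T \ X).card := by rw [hcr]; nlinarith
  have hle : ((T \ X).card : ℝ) ≤ n := by rw [hcr]; have : (0:ℝ) ≤ X.card := Nat.cast_nonneg _; linarith
  have hb1 := bounded hr hW hu hT (u := v) (by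
      rw [hcr]
      have h12 : 12 / e0 ≤ n / 2 := by
        have : 1000/e0 = 12/e0 * (1000/12) := by ring
        have h0 : (0:ℝ) ≤ n2 := Nat.cast_nonneg _
        have h1 : 0 < 12/e0 := by positivity
        nlinarith
      nlinarith) ?_ (by rw [Finset.mem_sdiff]; exact ⟨hv, hvX⟩)
  · rw [Dg_cst hu] at hb1
    have h1 := deg_meet_le hE X hvX
    have h1' : ((E.filter (v ∈ ·)).card : ℝ) ≤ ((E.filter (Disjoint X ·)).filter (v ∈ ·)).card + X.card * (n:ℝ)^(r-2) := by
      exact_mod_cast h1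
    have h2 : (((E.filter (Disjoint X ·)).filter (v ∈ ·)).card : ℝ) ≤ (rlam r + 1/10^20) * (n:ℝ)^(r-1) := by
      rw [inv_pow, ← div_eq_mul_inv, div_le_iff₀ (by positivity)] at hb1
      refine hb1.trans ?_
      have := rlam_pos hr
      gcongr
    have h3 : X.card * (n:ℝ)^(r-2) ≤ e0/4 * (n:ℝ)^(r-1) := by
      have : (n:ℝ)^(r-1) = n * (n:ℝ)^(r-2) := by rw [← pow_succ']; congr 1; omega
      rw [this, ← mul_assoc]
      gcongr
    unfold D0 at hd
    have h4 : (rlam r + 2/10^10) * (n:ℝ)^(r-1) ≤ (rlam r + 1/10^20 + e0/4) * (n:ℝ)^(r-1) := by linarith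
    have h5 : (0:ℝ) < (n:ℝ)^(r-1) := by positivity
    have h6 := le_of_mul_le_mul_right h4 h5
    norm_num at h6 he1
    linarith
  · rw [PE_cst hu, inv_pow, ← div_eq_mul_inv, le_div_iff₀ (by positivity)]
    have hl := lam_pos hr
    have hl2 := lam_le hr
    have htn : t + 12 ≤ n := by
      have : (t:ℝ) + 12 ≤ n := by nlinarith
      exact_mod_cast this
    have h1 := wB_lb hr hW (n := n - t) (by omega)
    rw [Nat.cast_sub (by omega)] at h1
    have h2 := card_meet_le hE X
    have h2' : (E.card : ℝ) ≤ (E.filter (Disjoint X ·)).card + X.card * (n:ℝ)^(r-1) := by exact_mod_cast h2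
    have h3 : (wB W (n-t) : ℝ) ≤ E.card := by exact_mod_cast hc
    have h4 : X.card * (n:ℝ)^(r-1) ≤ e0/4 * (n:ℝ)^r := by
      have : (n:ℝ)^r = n * (n:ℝ)^(r-1) := by rw [← pow_succ']; congr 1; omega
      rw [this, ← mul_assoc]
      gcongr
    have h5 : (1 - e0/4) * (n:ℝ)^r ≤ ((n:ℝ) - t - 12)^r := by
      have hB := one_add_mul_le_pow (a := -(((t:ℝ)+12)/n)) (by
        have : ((t:ℝ)+12)/n ≤ 1 := by rw [div_le_one hnp]; exact_mod_cast htn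
        linarith) r
      have h6 : ((n:ℝ) - t - 12) = n * (1 + -(((t:ℝ)+12)/n)) := by field_simp; ring
      rw [h6, mul_pow, mul_comm]
      gcongr
      refine le_trans ?_ hB
      have hr6 : (r:ℝ) ≤ 6 := by rcases hr with rfl | rfl <;> norm_num
      have h7 : ((t:ℝ)+12)/n ≤ e0/24 := by rw [div_le_iff₀ hnp]; nlinarith
      have h8 : 0 ≤ ((t:ℝ)+12)/n := by positivity
      nlinarith
    have h6 : (lam r - e0/2) * ((T \ X).card : ℝ)^r ≤ (lam r - e0/2) * (n:ℝ)^r := by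
      have : 0 ≤ lam r - e0/2 := by
        have : rlam r = lam r * r := by rw [← r_lam hr]; ring
        have h10 : (0:ℝ) ≤ lam r - 1/10^10 := by
          unfold lam
          rcases hr with rfl | rfl
          · rw [rlam5]; norm_num
          · rw [rlam6]; norm_num
        norm_num at h10 he1
        linarith
      gcongr
    have h7 : lam r * ((1 - e0/4) * (n:ℝ)^r) ≤ lam r * ((n:ℝ) - t - 12)^r := by gcongr
    have h8 : (0:ℝ) ≤ (n:ℝ)^r := by positivity
    have h9 : lam r * e0 * (n:ℝ)^r ≤ 1/100 * e0 * (n:ℝ)^r := by gcongr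
    have h10 : 0 ≤ e0 * (n:ℝ)^r := by positivity
    linarith

lemma greedy (hr : r = 5 ∨ r = 6) (hW : St r W) {T : Finset α} {t : ℕ} (hb : Big T.card t)
    {E : Finset (Finset α)} (hE : Unif r T E) (hc : wB W (T.card - t) ≤ E.card) (L : Finset α) :
    L ⊆ T → (∀ v ∈ L, D0 r T.card ≤ (E.filter (v ∈ ·)).card) → ∀ M : Finset (Finset α), Ms r E M →
    (∀ s ∈ M, s ⊆ T \ L) → L.card + M.card ≤ t + 1 → ∃ M', Ms r E M' ∧ (∀ s ∈ M', s ⊆ T) ∧ M'.card = L.card + M.card := by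
  induction L using Finset.induction_on with
  | empty => intro _ _ M hM hs _; exact ⟨M, hM, fun s h => (hs s h).trans Finset.sdiff_subset, by simp⟩
  | insert v L hv ih =>
    intro hLT hD M hM hs hle
    rw [Finset.card_insert_of_notMem hv] at hle ⊢
    have hU : (M.biUnion id).card ≤ M.card * (2*r-1) :=
      Finset.card_biUnion_le_card_mul _ _ _ fun s h => (hM.1 s h).1.le
    have hvT : v ∈ T := hLT (Finset.mem_insert_self _ _)
    obtain ⟨s, h1, h2, h3⟩ := find hr hW hb hE hc (X := L ∪ M.biUnion id) (v := v) (by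
        apply Finset.union_subset ((Finset.subset_insert _ _).trans hLT)
        rw [Finset.biUnion_subset]
        exact fun s h => (hs s h).trans Finset.sdiff_subset) (by
        have := Finset.card_union_le L (M.biUnion id)
        have h11 : M.card * (2*r-1) ≤ M.card * 11 := Nat.mul_le_mul_left _ (by omega)
        omega) hvT (by
        rw [Finset.mem_union, not_or, Finset.mem_biUnion]
        refine ⟨hv, ?_⟩
        rintro ⟨s, h, h'⟩
        have := hs s h h'
        rw [Finset.mem_sdiff] at this
        exact this.2 (Finset.mem_insert_self _ _)) (hD v (Finset.mem_insert_self _ _))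
    have hdis : ∀ s' ∈ M, Disjoint s s' := fun s' h => by
      have := (Finset.subset_sdiff.1 h1).2
      rw [Finset.disjoint_union_right] at this
      exact this.2.mono_right (Finset.subset_biUnion_of_mem id h)
    have hsM : s ∉ M := fun h => by
      have h' := hdis s h
      rw [disjoint_self] at h'
      rw [h'] at h2; simp at h2; omega
    obtain ⟨M', h4, h5, h6⟩ := ih ((Finset.subset_insert _ _).trans hLT) (fun v h => hD v (Finset.mem_insert_of_mem h))
      (insert s M) ⟨by
        intro s' h'
        rw [Finset.mem_insert] at h'
        rcases h' with rfl | h'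
        · exact ⟨h2, h3⟩
        · exact hM.1 s' h', by
        intro a ha b hb hab
        rw [Finset.mem_insert] at ha hb
        rcases ha with rfl | ha <;> rcases hb with rfl | hb
        · exact absurd rfl hab
        · exact hdis b hb
        · exact (hdis a ha).symm
        · exact hM.2 a ha b hb hab⟩ (by
        intro s' h'
        rw [Finset.mem_insert] at h'
        rcases h' with rfl | h'
        · exact h1.trans (Finset.sdiff_subset_sdiff le_rfl Finset.subset_union_left)
        · exact (hs s' h').trans (Finset.sdiff_subset_sdiff le_rfl (Finset.subset_insert _ _))) (by
        rw [Finset.card_insert_of_notMem hsM]; omega)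
    refine ⟨M', h4, h5, ?_⟩
    rw [h6, Finset.card_insert_of_notMem hsM]; omega

end Matching
end DensityCH
end

section
namespace DensityCH
open Finset
set_option linter.all false
set_option exponentiation.threshold 3000

section Matching2
variable {α ι : Type*} [DecidableEq α] [DecidableEq ι] [Fintype ι] {r : ℕ} {W : Finset (Finset ι)}

lemma wB_inc_ub' (hr : r = 5 ∨ r = 6) (hW : St r W) (s : ℕ) :
    (wB W (s+1) : ℝ) - wB W s ≤ rlam r * ((s:ℝ)+1)^(r-1) := by
  have h1 := wB_inc_ub hW s
  have h2 := wB_le hr hW (s+1)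
  have h3 : ((s:ℝ)+1) * ((wB W (s+1) : ℝ) - wB W s) ≤ ((s:ℝ)+1) * (rlam r * ((s:ℝ)+1)^(r-1)) := by
    refine h1.trans ?_
    have h4 : ((s:ℝ)+1)^r = ((s:ℝ)+1) * ((s:ℝ)+1)^(r-1) := by rw [← pow_succ']; congr 1; omega
    push_cast at h2
    calc (r:ℝ) * wB W (s+1) ≤ r * (lam r * ((s:ℝ)+1)^r) := by gcongr
      _ = (r * lam r) * ((s:ℝ)+1)^r := by ring
      _ = _ := by rw [r_lam hr, h4]; ring
  exact le_of_mul_le_mul_left h3 (by positivity)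

lemma choose_lb (hr : r = 5 ∨ r = 6) {n t s : ℕ} (hb : Big n t) (hs : n ≤ s + t) :
    (1 - 5*e0) * (n:ℝ)^(r-1) ≤ ((r-1).factorial : ℝ) * (s.choose (r-1)) := by
  have he := e0_pos
  have he1 : e0 ≤ 1/1000 := e0_le1.trans (by norm_num)
  have hn1 := hb.n1000
  have ht := hb.ht
  have hnp : (0:ℝ) < n := by nlinarith
  have h1 := Nat.pow_sub_le_descFactorial s (r-1)
  rw [Nat.descFactorial_eq_factorial_mul_choose] at h1
  have h2 : (((s + 1 - (r-1) : ℕ) : ℝ))^(r-1) ≤ ((r-1).factorial : ℝ) * (s.choose (r-1)) := by exact_mod_cast h1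
  refine le_trans ?_ h2
  have hsr : (n:ℝ) ≤ s + t := by exact_mod_cast hs
  have h10 : 10 ≤ s := by
    have : (10:ℝ) ≤ s := by nlinarith
    exact_mod_cast this
  have h3 : (1 - e0) * (n:ℝ) ≤ ((s + 1 - (r-1) : ℕ) : ℝ) := by
    have : s ≤ (s + 1 - (r-1)) + 4 := by omega
    have : (s:ℝ) ≤ ((s + 1 - (r-1) : ℕ) : ℝ) + 4 := by exact_mod_cast this
    nlinarith
  refine le_trans ?_ (pow_le_pow_left₀ (by nlinarith) h3 (r-1))
  rw [mul_pow]
  gcongr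
  have hB := one_add_mul_le_pow (a := -e0) (by linarith) (r-1)
  have h5 : (((r-1 : ℕ)):ℝ) ≤ 5 := by rcases hr with rfl | rfl <;> norm_num
  rw [show (1:ℝ) - e0 = 1 + -e0 by ring]
  refine le_trans ?_ hB
  nlinarith

lemma inc (hr : r = 5 ∨ r = 6) (hW : St r W) {n t s : ℕ} (hb : Big n t) (hs : n ≤ s + t) (hsn : s + 1 ≤ n) :
    (wB W (s+1) : ℝ) - wB W s + ((2*(r:ℝ)-1) * D0 r n + 1) ≤ s.choose (r-1) := by
  have he := e0_pos
  have he1 : e0 ≤ 1/1000 := e0_le1.trans (by norm_num)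
  have hn1 := hb.n1000
  have h1 := wB_inc_ub' hr hW s
  have h2 := choose_lb hr hb hs
  have hn : (1000:ℝ) ≤ n := by nlinarith
  have hsn' : (s:ℝ) + 1 ≤ n := by exact_mod_cast hsn
  have h3 : rlam r * ((s:ℝ)+1)^(r-1) ≤ rlam r * (n:ℝ)^(r-1) := by
    have := rlam_pos hr
    gcongr
  have h4 : (1000:ℝ) ≤ (n:ℝ)^(r-1) := hn.trans (le_self_pow₀ (by linarith) (by omega))
  unfold D0
  have h5 : (1 - 5*(1/1000)) * (n:ℝ)^(r-1) ≤ ((r-1).factorial : ℝ) * (s.choose (r-1)) := by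
    refine le_trans ?_ h2
    gcongr
  generalize (n:ℝ)^(r-1) = P at *
  generalize ((s:ℝ)+1)^(r-1) = Q at *
  rcases hr with rfl | rfl
  · rw [rlam5] at *
    norm_num [Nat.factorial] at h5 h3 h1 ⊢
    linarith
  · rw [rlam6] at *
    norm_num [Nat.factorial] at h5 h3 h1 ⊢
    linarith

lemma chain (hr : r = 5 ∨ r = 6) (hW : St r W) {n t : ℕ} (hb : Big n t) (htn : t ≤ n) (d : ℕ) : d ≤ t →
    (((n-t).choose r : ℕ) : ℝ) + wB W (n-t+d) + d * ((2*(r:ℝ)-1) * D0 r n + 1) ≤ ((n-t+d).choose r : ℕ) + wB W (n-t) := by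
  induction d with
  | zero => simp
  | succ d ih =>
    intro hd
    have h1 := ih (by omega)
    have h2 := inc hr hW hb (s := n-t+d) (by omega) (by omega)
    have h3 : (n-t+(d+1)).choose r = (n-t+d).choose (r-1) + (n-t+d).choose r := by
      obtain ⟨q, rfl⟩ : ∃ q, r = q+1 := ⟨r-1, by omega⟩
      rw [← add_assoc, Nat.choose_succ_succ]; simp
    rw [h3]
    push_cast
    rw [← add_assoc]
    linarith

lemma card_meet (T L : Finset α) (hL : L ⊆ T) (r : ℕ) :
    ((T.powersetCard r).filter (¬ Disjoint L ·)).card + (T.card - L.card).choose r = T.card.choose r := by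
  rw [← Finset.card_powersetCard r T, ← Finset.card_filter_add_card_filter_not (s := T.powersetCard r) (Disjoint L ·),
    add_comm, ← Finset.card_sdiff_of_subset hL, ← Finset.card_powersetCard r (T \ L)]
  congr 2
  ext e
  simp only [Finset.mem_powersetCard, Finset.mem_filter, Finset.subset_sdiff]
  constructor
  · rintro ⟨⟨h1, h2⟩, h3⟩; exact ⟨⟨h1, h3⟩, h2.symm⟩
  · rintro ⟨⟨h1, h2⟩, h3⟩; exact ⟨⟨h1, h3.symm⟩, h2⟩

theorem main_abs (hr : r = 5 ∨ r = 6) (hW : St r W) {T : Finset α} {t : ℕ} (hb : Big T.card t)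
    {E : Finset (Finset α)} (hE : Unif r T E)
    (hM : ∀ M, Ms r E M → (∀ s ∈ M, s ⊆ T) → M.card ≠ t + 1) :
    E.card + (T.card - t).choose r ≤ T.card.choose r + wB W (T.card - t) ∧
    (E.card + (T.card - t).choose r = T.card.choose r + wB W (T.card - t) →
      ∃ L ⊆ T, L.card = t ∧ (∀ e ∈ T.powersetCard r, ¬ Disjoint L e → e ∈ E) ∧
        ∃ φ : α → ι, E.filter (Disjoint L ·) = BF φ (T \ L) W) := by
  have he := e0_pos
  have he1 : e0 ≤ 1/1000 := e0_le1.trans (by norm_num)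
  have hn0 := hb.n0
  have hn1 := hb.n1000
  have hn := hb.hn
  have ht := hb.ht
  have hmono := Nat.choose_le_choose r (Nat.sub_le T.card t)
  rcases Nat.lt_or_ge (E.card + (T.card - t).choose r) (T.card.choose r + wB W (T.card - t)) with hlt | hge
  · exact ⟨hlt.le, fun h => absurd h hlt.ne⟩
  have hc : wB W (T.card - t) ≤ E.card := by omega
  set L := T.filter (fun v => D0 r T.card ≤ (E.filter (v ∈ ·)).card) with hL
  have hLT : L ⊆ T := Finset.filter_subset _ _
  have hLD : ∀ v ∈ L, D0 r T.card ≤ (E.filter (v ∈ ·)).card := fun v hv => (Finset.mem_filter.1 hv).2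
  have hLt : L.card ≤ t := by
    by_contra hcon
    push Not at hcon
    obtain ⟨L', h1, h2⟩ := Finset.exists_subset_card_eq (s := L) (n := t+1) hcon
    obtain ⟨M, h3, h4, h5⟩ := greedy hr hW hb hE hc L' (h1.trans hLT) (fun v hv => hLD v (h1 hv)) ∅
      ⟨by simp, by simp⟩ (by simp) (by simp [h2])
    exact hM M h3 h4 (by simp [h5, h2])
  have hLM : ∀ M, Ms r E M → (∀ s ∈ M, s ⊆ T \ L) → L.card + M.card ≤ t := by
    intro M h1 h2
    by_contra hcon
    push Not at hcon
    obtain ⟨M', h3, h4⟩ := Finset.exists_subset_card_eq (s := M) (n := t+1-L.card) (by omega)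
    obtain ⟨M'', h5, h6, h7⟩ := greedy hr hW hb hE hc L hLT hLD M' (Ms_sub h1 h3) (fun s hs => h2 s (h3 hs))
      (by omega)
    exact hM M'' h5 h6 (by omega)
  haveI : DecidablePred (fun M => Ms r E M ∧ ∀ s ∈ M, s ⊆ T \ L) := Classical.decPred _
  obtain ⟨M, hMm, hMmax⟩ := 
    Finset.exists_max_image ((T.powerset.powerset).filter (fun M => Ms r E M ∧ ∀ s ∈ M, s ⊆ T \ L)) Finset.card
      ⟨∅, by rw [Finset.mem_filter]; exact ⟨by simp, ⟨by simp, by simp⟩, by simp⟩⟩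
  rw [Finset.mem_filter] at hMm
  obtain ⟨-, hM1, hM2⟩ := hMm
  have hk := hLM M hM1 hM2
  set U := M.biUnion id with hU
  have hUc : U.card ≤ M.card * (2*r-1) := Finset.card_biUnion_le_card_mul _ _ _ fun s h => (hM1.1 s h).1.le
  have hUT : U ⊆ T \ L := by rw [hU, Finset.biUnion_subset]; exact hM2
  have hu1 := unif_disj hE L
  have hu2 := unif_disj hu1 U
  have hTF : TF ((E.filter (Disjoint L ·)).filter (Disjoint U ·)) := by
    by_contra hcon
    obtain ⟨s, h1, h2, h3⟩ := not_TF_ex (by omega) hu2 hcon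
    have hdis : ∀ s' ∈ M, Disjoint s s' := fun s' h =>
      (Finset.subset_sdiff.1 h1).2.mono_right (Finset.subset_biUnion_of_mem id h)
    have hsM : s ∉ M := fun h => by
      have h' := hdis s h
      rw [disjoint_self] at h'
      rw [h'] at h2; simp at h2; omega
    have hsL : s ⊆ T \ L := h1.trans Finset.sdiff_subset
    have h3' : ¬ TF (E.filter (· ⊆ s)) := fun h => h3 (TF_mono h (Finset.filter_subset_filter _
      ((Finset.filter_subset _ _).trans (Finset.filter_subset _ _))))
    have hall : ∀ s' ∈ insert s M, s' ⊆ T \ L := by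
      intro s' h'
      rw [Finset.mem_insert] at h'
      rcases h' with rfl | h'
      · exact hsL
      · exact hM2 s' h'
    have := hMmax (insert s M) (by
      rw [Finset.mem_filter, Finset.mem_powerset]
      refine ⟨fun s' h' => Finset.mem_powerset.2 ((hall s' h').trans Finset.sdiff_subset), ⟨?_, ?_⟩, hall⟩
      · intro s' h'
        rw [Finset.mem_insert] at h'
        rcases h' with rfl | h'
        · exact ⟨h2, h3'⟩
        · exact hM1.1 s' h'
      · intro a ha b hb hab
        rw [Finset.mem_insert] at ha hb
        rcases ha with rfl | ha <;> rcases hb with rfl | hb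
        · exact absurd rfl hab
        · exact hdis b hb
        · exact (hdis a ha).symm
        · exact hM1.2 a ha b hb hab)
    rw [Finset.card_insert_of_notMem hsM] at this
    omega
  have htn : t ≤ T.card := by
    have : (t:ℝ) ≤ T.card := by nlinarith
    exact_mod_cast this
  have hcT : (T \ L).card = T.card - L.card := Finset.card_sdiff_of_subset hLT
  have hcU : ((T \ L) \ U).card = T.card - L.card - U.card := by rw [Finset.card_sdiff_of_subset hUT, hcT]
  have hbig : n2 ≤ ((T \ L) \ U).card := by
    rw [hcU]
    have h11 : M.card * (2*r-1) ≤ M.card * 11 := Nat.mul_le_mul_left _ (by omega)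
    have : n2 + 12 * t ≤ T.card := by
      have : (n2:ℝ) + 12 * t ≤ T.card := by
        have : 0 < 1000/e0 := by positivity
        nlinarith
      exact_mod_cast this
    omega
  have htur := turan hr hW hbig hu2 hTF
  have hmeet := card_meet T L hLT r
  have hsubL : E.filter (¬ Disjoint L ·) ⊆ (T.powersetCard r).filter (¬ Disjoint L ·) :=
    Finset.filter_subset_filter _ fun e he => Finset.mem_powersetCard.2 (hE e he)
  have hcL := Finset.card_le_card hsubL
  have hsplit := Finset.card_filter_add_card_filter_not (s := E) (Disjoint L ·)
  have hUcount : ((E.filter (Disjoint L ·)).card : ℝ) ≤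
      ((E.filter (Disjoint L ·)).filter (Disjoint U ·)).card + U.card * D0 r T.card := by
    rw [← Finset.card_filter_add_card_filter_not (s := E.filter (Disjoint L ·)) (Disjoint U ·)]
    push_cast
    gcongr
    have h1 : ((E.filter (Disjoint L ·)).filter (¬ Disjoint U ·)) ⊆ U.biUnion fun u => E.filter (u ∈ ·) := by
      intro e he
      rw [Finset.mem_filter, Finset.mem_filter, Finset.not_disjoint_iff] at he
      obtain ⟨h1, x, h2, h3⟩ := he
      rw [Finset.mem_biUnion]
      exact ⟨x, h2, by rw [Finset.mem_filter]; exact ⟨h1.1, h3⟩⟩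
    have h2 := (Finset.card_le_card h1).trans Finset.card_biUnion_le
    have h2' : ((((E.filter (Disjoint L ·)).filter (¬ Disjoint U ·)).card : ℕ) : ℝ) ≤ ∑ u ∈ U, ((E.filter (u ∈ ·)).card : ℝ) := by
      exact_mod_cast h2
    refine h2'.trans ?_
    rw [← nsmul_eq_mul]
    apply Finset.sum_le_card_nsmul
    intro u hu
    have := hUT hu
    rw [Finset.mem_sdiff, hL, Finset.mem_filter, not_and, not_le] at this
    exact (this.2 this.1).le
  have hch := chain hr hW hb htn (t - L.card) (by omega)
  rw [show T.card - t + (t - L.card) = T.card - L.card by omega, Nat.cast_sub hLt] at hch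
  have hD0 : 0 ≤ D0 r T.card := by
    unfold D0
    have := rlam_pos hr
    positivity
  have hwm : wB W ((T \ L) \ U).card ≤ wB W (T.card - L.card) := wB_mono hW (by omega)
  have hUr : (U.card : ℝ) ≤ M.card * (2*(r:ℝ)-1) := by
    have : (U.card : ℝ) ≤ M.card * ((2*r-1 : ℕ):ℝ) := by exact_mod_cast hUc
    rwa [Nat.cast_sub (by omega), Nat.cast_mul, Nat.cast_ofNat, Nat.cast_one] at this
  have hUD : U.card * D0 r T.card ≤ M.card * ((2*(r:ℝ)-1) * D0 r T.card) := by
    rw [← mul_assoc]; gcongr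
  have hr0 : (0:ℝ) ≤ (2*(r:ℝ)-1) * D0 r T.card := by
    apply mul_nonneg _ hD0
    have : (1:ℝ) ≤ r := by exact_mod_cast (by omega : 1 ≤ r)
    linarith
  have hkr : (M.card : ℝ) ≤ t - L.card := by
    have : (L.card : ℝ) + M.card ≤ t := by exact_mod_cast hk
    linarith
  have hkD : (M.card : ℝ) * ((2*(r:ℝ)-1) * D0 r T.card) ≤ (t - L.card) * ((2*(r:ℝ)-1) * D0 r T.card) := by gcongr
  have hmeet' : ((((T.powersetCard r).filter (¬ Disjoint L ·)).card : ℕ) : ℝ) + ((T.card - L.card).choose r : ℕ) = (T.card.choose r : ℕ) := by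
    exact_mod_cast hmeet
  have hcL' : ((E.filter (¬ Disjoint L ·)).card : ℝ) ≤ ((T.powersetCard r).filter (¬ Disjoint L ·)).card := by exact_mod_cast hcL
  have hsplit' : ((E.filter (Disjoint L ·)).card : ℝ) + (E.filter (¬ Disjoint L ·)).card = E.card := by exact_mod_cast hsplit
  have htur' : ((((E.filter (Disjoint L ·)).filter (Disjoint U ·)).card : ℕ) : ℝ) ≤ wB W ((T \ L) \ U).card := by
    exact_mod_cast htur.1
  have hwm' : (wB W ((T \ L) \ U).card : ℝ) ≤ wB W (T.card - L.card) := by exact_mod_cast hwm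
  have hfin : (E.card : ℝ) + ((T.card - t).choose r : ℕ) + (t - L.card) ≤ (T.card.choose r : ℕ) + wB W (T.card - t) := by
    linarith
  have hfin' : E.card + (T.card - t).choose r + t ≤ T.card.choose r + wB W (T.card - t) + L.card := by
    have : (E.card : ℝ) + ((T.card - t).choose r : ℕ) + t ≤ (T.card.choose r : ℕ) + wB W (T.card - t) + L.card := by linarith
    exact_mod_cast this
  refine ⟨by omega, fun heq => ?_⟩
  have hLt' : L.card = t := by omega
  have hM0 : M = ∅ := by rw [← Finset.card_eq_zero]; omega
  have hU0 : U = ∅ := by rw [hU, hM0]; simp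
  have hf0 : (E.filter (Disjoint L ·)).filter (Disjoint U ·) = E.filter (Disjoint L ·) := by
    rw [hU0]; simp
  rw [hf0, hU0, Finset.sdiff_empty, hcT] at htur
  have hmt : ((T.powersetCard r).filter (¬ Disjoint L ·)).card + (T.card - t).choose r = T.card.choose r := by
    rw [← hLt']; exact hmeet
  have hwt : (E.filter (Disjoint L ·)).card ≤ wB W (T.card - t) := by rw [← hLt']; exact htur.1
  refine ⟨L, hLT, hLt', ?_, ?_⟩
  · intro e he hd
    have := Finset.eq_of_subset_of_card_le hsubL (by omega)
    have hm : e ∈ (T.powersetCard r).filter (¬ Disjoint L ·) := Finset.mem_filter.2 ⟨he, hd⟩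
    rw [← this, Finset.mem_filter] at hm
    exact hm.1
  · apply htur.2
    rw [hLt']
    omega

end Matching2
end DensityCH
end

section
namespace DensityCH
open Finset
set_option linter.all false

section Link
variable {r : ℕ}

lemma BF_TF {α ι : Type*} [DecidableEq α] [DecidableEq ι] [Fintype ι] {W : Finset (Finset ι)}
    (hr : 0 < r) (hW : St r W) (φ : α → ι) (T : Finset α) : TF (BF φ T W) := by
  intro S a b hab ha hb hA hB C hC haC hbC _
  rw [mem_BF] at hA hB hC
  have h1 : ∀ c, c ∉ S → Set.InjOn φ ((insert c S : Finset α) : Set α) → φ c ∉ S.image φ := by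
    intro c hc hi hm
    rw [Finset.mem_image] at hm
    obtain ⟨d, hd, hdc⟩ := hm
    have := hi (by simp [hd]) (by simp) hdc
    exact hc (this ▸ hd)
  have h2 := hA.2.2
  have h3 := hB.2.2
  rw [Finset.image_insert] at h2 h3
  exact hab (hC.2.1 haC hbC (hW.eq_of hr (h1 a ha hA.2.1) (h1 b hb hB.2.1) h2 h3))

lemma ex_bij {A B : Finset ℕ} (h : A.card = B.card) : ∃ f : ℕ → ℕ, A.image f = B := by
  let e := Finset.equivOfCardEq h
  refine ⟨fun x => if hx : x ∈ A then (e ⟨x, hx⟩ : ℕ) else 0, ?_⟩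
  ext y
  rw [Finset.mem_image]
  constructor
  · rintro ⟨x, hx, rfl⟩
    rw [dif_pos hx]
    exact (e ⟨x, hx⟩).2
  · intro hy
    refine ⟨e.symm ⟨y, hy⟩, (e.symm ⟨y, hy⟩).2, ?_⟩
    rw [dif_pos (e.symm ⟨y, hy⟩).2]
    simp

lemma tri_edges (hr : r = 5 ∨ r = 6) : (genTri r).edges =
    {Finset.Icc 1 r, Finset.Icc 1 (r-1) ∪ {r+1}, Finset.Icc r (2*r - 1)} := by
  rcases hr with rfl | rfl <;> decide

lemma copy_not_TF (hr : r = 5 ∨ r = 6) {H : HGraph r} (h : (genTri r).IsCopyIn H) : ¬ TF H.edges := by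
  obtain ⟨f, h1, h2, h3⟩ := h
  intro hT
  rw [tri_edges hr] at h3
  have hv : (genTri r).verts = Finset.Icc 1 (2*r-1) := rfl
  rw [hv] at h1
  have hA := h3 (Finset.Icc 1 r) (by simp)
  have hB := h3 (Finset.Icc 1 (r-1) ∪ {r+1}) (by simp)
  have hC := h3 (Finset.Icc r (2*r-1)) (by simp)
  have e1 : Finset.Icc 1 r = insert r (Finset.Icc 1 (r-1)) := by ext; simp; omega
  have e2 : Finset.Icc 1 (r-1) ∪ {r+1} = insert (r+1) (Finset.Icc 1 (r-1)) := by ext; simp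
  rw [e1, Finset.image_insert] at hA
  rw [e2, Finset.image_insert] at hB
  have hn : ∀ i ∈ Finset.Icc r (2*r-1), f i ∉ (Finset.Icc 1 (r-1)).image f := by
    intro i hi hm
    rw [Finset.mem_image] at hm
    obtain ⟨j, hj, hij⟩ := hm
    rw [Finset.mem_Icc] at hi hj
    have := h1 (by rw [Finset.mem_coe, Finset.mem_Icc]; omega) (by rw [Finset.mem_coe, Finset.mem_Icc]; omega) hij
    omega
  refine hT ((Finset.Icc 1 (r-1)).image f) (f r) (f (r+1)) ?_ (hn r (by simp; omega)) (hn (r+1) (by simp; omega))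
    hA hB _ hC (Finset.mem_image_of_mem _ (by simp; omega)) (Finset.mem_image_of_mem _ (by simp; omega)) ?_
  · intro he
    have := h1 (by rw [Finset.mem_coe, Finset.mem_Icc]; omega) (by rw [Finset.mem_coe, Finset.mem_Icc]; omega) he
    omega
  · rw [Finset.disjoint_right]
    intro x hx
    rw [Finset.mem_image] at hx
    obtain ⟨i, hi, rfl⟩ := hx
    exact hn i hi

lemma not_TF_copy (hr : r = 5 ∨ r = 6) {H : HGraph r} (h : ¬ TF H.edges) : (genTri r).IsCopyIn H := by
  unfold TF at h
  push Not at h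
  obtain ⟨S, a, b, hab, ha, hb, hA, hB, C, hC, haC, hbC, hd⟩ := h
  have hSc := H.edges_card _ hA
  rw [Finset.card_insert_of_notMem ha] at hSc
  have hCc := H.edges_card _ hC
  obtain ⟨g, hg⟩ := ex_bij (A := Finset.Icc 1 (r-1)) (B := S) (by rw [Nat.card_Icc]; omega)
  have hsub : ({a, b} : Finset ℕ) ⊆ C := by
    rw [Finset.insert_subset_iff, Finset.singleton_subset_iff]; exact ⟨haC, hbC⟩
  obtain ⟨g', hg'⟩ := ex_bij (A := Finset.Icc (r+2) (2*r-1)) (B := C \ {a, b}) (by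
    rw [Nat.card_Icc, Finset.card_sdiff_of_subset hsub, Finset.card_pair hab]; omega)
  let f : ℕ → ℕ := fun i => if i ≤ r-1 then g i else if i = r then a else if i = r+1 then b else g' i
  have f1 : (Finset.Icc 1 (r-1)).image f = S := by
    rw [← hg]
    apply Finset.image_congr
    intro i hi
    rw [Finset.mem_coe, Finset.mem_Icc] at hi
    simp only [f, if_pos hi.2]
  have f2 : (Finset.Icc (r+2) (2*r-1)).image f = C \ {a, b} := by
    rw [← hg']
    apply Finset.image_congr
    intro i hi
    rw [Finset.mem_coe, Finset.mem_Icc] at hi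
    simp only [f]
    rw [if_neg (by omega), if_neg (by omega), if_neg (by omega)]
  have fa : f r = a := by
    simp only [f]
    rw [if_neg (by omega)]; simp
  have fb : f (r+1) = b := by
    simp only [f]
    rw [if_neg (by omega), if_neg (by omega)]; simp
  have f3 : (Finset.Icc r (2*r-1)).image f = C := by
    have : Finset.Icc r (2*r-1) = insert r (insert (r+1) (Finset.Icc (r+2) (2*r-1))) := by
      ext; simp; omega
    rw [this, Finset.image_insert, Finset.image_insert, f2, fa, fb]
    ext x
    simp only [Finset.mem_insert, Finset.mem_sdiff, Finset.mem_singleton]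
    constructor
    · rintro (rfl | rfl | h)
      · exact haC
      · exact hbC
      · exact h.1
    · intro hx; by_cases x = a <;> by_cases x = b <;> tauto
  have e1 : Finset.Icc 1 r = insert r (Finset.Icc 1 (r-1)) := by ext; simp; omega
  have e2 : Finset.Icc 1 (r-1) ∪ {r+1} = insert (r+1) (Finset.Icc 1 (r-1)) := by ext; simp
  have e3 : Finset.Icc 1 (2*r-1) = Finset.Icc 1 (r-1) ∪ Finset.Icc r (2*r-1) := by ext; simp; omega
  have him : (Finset.Icc 1 (2*r-1)).image f = S ∪ C := by rw [e3, Finset.image_union, f1, f3]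
  refine ⟨f, ?_, ?_, ?_⟩
  · show Set.InjOn f ((Finset.Icc 1 (2*r-1) : Finset ℕ) : Set ℕ)
    rw [← Finset.card_image_iff, him, Finset.card_union_of_disjoint hd, Nat.card_Icc]
    omega
  · intro v hv
    have : f v ∈ S ∪ C := by rw [← him]; exact Finset.mem_image_of_mem _ hv
    rw [Finset.mem_union] at this
    rcases this with h | h
    · exact H.edges_sub _ hA (Finset.mem_insert_of_mem h)
    · exact H.edges_sub _ hC h
  · rw [tri_edges hr]
    intro e he
    simp only [Finset.mem_insert, Finset.mem_singleton] at he
    rcases he with rfl | rfl | rfl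
    · rw [e1, Finset.image_insert, f1, fa]; exact hA
    · rw [e2, Finset.image_insert, f1, fb]; exact hB
    · rw [f3]; exact hC

lemma induce_edges (H : HGraph r) (S : Finset ℕ) : (H.induce S).edges = H.edges.filter (· ⊆ S) := by
  unfold HGraph.induce HGraph.ofEdges
  ext e
  simp only [Finset.mem_filter]
  constructor
  · exact fun h => h.1
  · exact fun h => ⟨h, Finset.subset_inter (H.edges_sub e h.1) h.2, H.edges_card e h.1⟩

lemma tri_verts : (genTri r).verts.card = 2*r-1 := by
  show (Finset.Icc 1 (2*r-1)).card = _
  rw [Nat.card_Icc]; omega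

lemma matching_iff (hr : r = 5 ∨ r = 6) (H : HGraph r) (k : ℕ) :
    (genTri r).HasMatching H k ↔ ∃ M, Ms r H.edges M ∧ (∀ s ∈ M, s ⊆ H.verts) ∧ M.card = k := by
  have hcopy : ∀ S, (genTri r).IsCopyIn (H.induce S) ↔ ¬ TF (H.edges.filter (· ⊆ S)) := by
    intro S
    rw [← induce_edges]
    exact ⟨copy_not_TF hr, not_TF_copy hr⟩
  unfold HGraph.HasMatching
  rw [tri_verts]
  simp only [hcopy]
  constructor
  · rintro ⟨S, h1, h2, h3⟩
    have hinj : Function.Injective S := by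
      intro i j hij
      by_contra hne
      have := h2 i j hne
      rw [hij, disjoint_self] at this
      have h4 := (h1 j).2
      rw [this] at h4
      simp at h4
      omega
    refine ⟨Finset.univ.image S, ⟨?_, ?_⟩, ?_, ?_⟩
    · intro s hs
      rw [Finset.mem_image] at hs
      obtain ⟨i, -, rfl⟩ := hs
      exact ⟨(h1 i).2, h3 i⟩
    · intro s hs s' hs' hne
      rw [Finset.mem_image] at hs hs'
      obtain ⟨i, -, rfl⟩ := hs
      obtain ⟨j, -, rfl⟩ := hs'
      exact h2 i j fun h => hne (by rw [h])
    · intro s hs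
      rw [Finset.mem_image] at hs
      obtain ⟨i, -, rfl⟩ := hs
      exact (h1 i).1
    · rw [Finset.card_image_of_injective _ hinj]; simp
  · rintro ⟨M, hM, hs, rfl⟩
    refine ⟨fun i => (M.equivFin.symm i : Finset ℕ), fun i => ?_, fun i j hij => ?_, fun i => ?_⟩
    · exact ⟨hs _ (M.equivFin.symm i).2, (hM.1 _ (M.equivFin.symm i).2).1⟩
    · apply hM.2 _ (M.equivFin.symm i).2 _ (M.equivFin.symm j).2
      intro h
      exact hij (M.equivFin.symm.injective (Subtype.ext h))
    · exact (hM.1 _ (M.equivFin.symm i).2).2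

/-- the design on a subtype -/
def Wp (W : HGraph r) : Finset (Finset W.verts) :=
  Finset.univ.filter fun e => e.map (Function.Embedding.subtype _) ∈ W.edges

lemma mem_Wp {W : HGraph r} {e : Finset W.verts} : e ∈ Wp W ↔ e.map (Function.Embedding.subtype _) ∈ W.edges := by
  unfold Wp; simp

lemma St_Wp (W : HGraph r) (hWcard : W.verts.card = r + 6)
    (hSteiner : ∀ S ∈ Finset.powersetCard (r-1) W.verts,
      ∃! e : Finset ℕ, e ∈ W.edges ∧ S ⊆ e) : St r (Wp W) := by
  refine ⟨by rw [Fintype.card_coe]; exact hWcard, ?_, ?_⟩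
  · intro e he
    rw [mem_Wp] at he
    have := W.edges_card _ he
    rwa [Finset.card_map] at this
  · intro S hS
    obtain ⟨e, ⟨h1, h2⟩, h3⟩ := hSteiner (S.map (Function.Embedding.subtype _)) (by
      rw [Finset.mem_powersetCard, Finset.card_map]
      refine ⟨?_, hS⟩
      intro x hx
      rw [Finset.mem_map] at hx
      obtain ⟨y, -, rfl⟩ := hx
      exact y.2)
    have hm : (e.subtype (· ∈ W.verts)).map (Function.Embedding.subtype _) = e :=
      Finset.subtype_map_of_mem (fun x hx => W.edges_sub e h1 hx)
    refine ⟨e.subtype (· ∈ W.verts), ⟨?_, ?_⟩, ?_⟩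
    · rw [mem_Wp, hm]; exact h1
    · intro x hx
      rw [Finset.mem_subtype]
      exact h2 (Finset.mem_map_of_mem (Function.Embedding.subtype _) hx)
    · rintro f ⟨hf1, hf2⟩
      rw [mem_Wp] at hf1
      have := h3 _ ⟨hf1, Finset.map_subset_map.2 hf2⟩
      rw [← hm] at this
      exact Finset.map_injective _ this

lemma map_val_iff (p : ℕ → ℕ) (e f : Finset ℕ) :
    Multiset.map p e.val = f.val ↔ Set.InjOn p (e : Set ℕ) ∧ e.image p = f := by
  constructor
  · intro h
    have hi : Set.InjOn p (e : Set ℕ) := by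
      intro x hx y hy hxy
      exact Multiset.inj_on_of_nodup_map (by rw [h]; exact f.nodup) x hx y hy hxy
    exact ⟨hi, Finset.eq_of_veq (by rw [Finset.image_val_of_injOn hi, h])⟩
  · rintro ⟨hi, rfl⟩
    rw [Finset.image_val_of_injOn hi]

lemma BF_part (W : HGraph r) (φ : ℕ → W.verts) (p : ℕ → ℕ) (V e : Finset ℕ) (hp : ∀ v ∈ V, (φ v : ℕ) = p v) :
    e ∈ BF φ V (Wp W) ↔ e ⊆ V ∧ e.card = r ∧ ∃ f ∈ W.edges, Multiset.map p e.val = f.val := by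
  rw [mem_BF, mem_Wp]
  apply and_congr_right
  intro he
  have h1 : (e.image φ).map (Function.Embedding.subtype _) = e.image p := by
    rw [Finset.map_eq_image, Finset.image_image]
    apply Finset.image_congr
    intro v hv
    exact hp v (he hv)
  have h2 : Set.InjOn φ (e : Set ℕ) ↔ Set.InjOn p (e : Set ℕ) := by
    constructor
    · intro h x hx y hy hxy
      rw [← hp x (he hx), ← hp y (he hy)] at hxy
      exact h hx hy (Subtype.ext hxy)
    · intro h x hx y hy hxy
      apply h hx hy
      rw [← hp x (he hx), ← hp y (he hy), hxy]
  rw [h1, h2]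
  constructor
  · rintro ⟨h3, h4⟩
    refine ⟨?_, _, h4, (map_val_iff _ _ _).2 ⟨h3, rfl⟩⟩
    rw [← Finset.card_image_of_injOn h3]
    exact W.edges_card _ h4
  · rintro ⟨-, f, h3, h4⟩
    rw [map_val_iff] at h4
    exact ⟨h4.1, h4.2 ▸ h3⟩

lemma blowup_iff (W G : HGraph r) (hne : W.verts.Nonempty) :
    IsBlowupOf W G ↔ ∃ φ : ℕ → W.verts, G.edges = BF φ G.verts (Wp W) := by
  constructor
  · rintro ⟨p, h1, h2⟩
    obtain ⟨w, hw⟩ := hne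
    refine ⟨fun v => if h : p v ∈ W.verts then ⟨p v, h⟩ else ⟨w, hw⟩, ?_⟩
    ext e
    rw [h2, BF_part W _ p]
    intro v hv
    rw [dif_pos (h1 v hv)]
  · rintro ⟨φ, h⟩
    refine ⟨fun v => φ v, fun v _ => (φ v).2, fun e => ?_⟩
    rw [h, BF_part W φ _ _ _ (fun v _ => rfl)]

end Link
end DensityCH
end

section
namespace DensityCH
open Finset
set_option linter.all false
set_option exponentiation.threshold 3000

section Final
variable {r : ℕ}

/-- structure of the extremal graphs -/
def Str (W H : HGraph r) (t : ℕ) : Prop :=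
  ∃ L ⊆ H.verts, L.card = t ∧ (∀ e ∈ H.verts.powersetCard r, ¬ Disjoint L e → e ∈ H.edges) ∧
    ∃ φ : ℕ → W.verts, H.edges.filter (Disjoint L ·) = BF φ (H.verts \ L) (Wp W) ∧
      (BF φ (H.verts \ L) (Wp W)).card = wB (Wp W) (H.verts.card - t)

lemma Str.card {W H : HGraph r} {t : ℕ} (h : Str W H t) :
    H.edges.card + (H.verts.card - t).choose r = H.verts.card.choose r + wB (Wp W) (H.verts.card - t) := by
  obtain ⟨L, hL, rfl, h1, φ, h2, h3⟩ := h
  rw [← Finset.card_filter_add_card_filter_not (s := H.edges) (Disjoint L ·), h2, h3, ← card_meet _ _ hL r]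
  have : H.edges.filter (¬ Disjoint L ·) = (H.verts.powersetCard r).filter (¬ Disjoint L ·) := by
    ext e
    rw [Finset.mem_filter, Finset.mem_filter]
    constructor
    · exact fun h => ⟨Finset.mem_powersetCard.2 ⟨H.edges_sub e h.1, H.edges_card e h.1⟩, h.2⟩
    · exact fun h => ⟨h1 e h.1 h.2, h.2⟩
  rw [this]; omega

lemma Str.noM (hr : r = 5 ∨ r = 6) {W H : HGraph r} {t : ℕ} (hW : St r (Wp W)) (h : Str W H t) :
    ¬ (genTri r).HasMatching H (t+1) := by
  rw [matching_iff hr]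
  rintro ⟨M, hM, hs, hc⟩
  obtain ⟨L, hL, rfl, h1, φ, h2, h3⟩ := h
  have hTF : TF (H.edges.filter (Disjoint L ·)) := by rw [h2]; exact BF_TF (by omega) hW _ _
  have hmeet : ∀ s ∈ M, ∃ x ∈ L, x ∈ s := by
    intro s hs
    by_contra hcon
    push Not at hcon
    apply (hM.1 s hs).2
    apply TF_mono hTF
    intro e he
    rw [Finset.mem_filter] at he ⊢
    refine ⟨he.1, ?_⟩
    rw [Finset.disjoint_left]
    exact fun x hx hxe => hcon x hx (he.2 hxe)
  choose! f hf1 hf2 using hmeet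
  obtain ⟨a, ha, b, hb, hab, hfab⟩ := Finset.exists_ne_map_eq_of_card_lt_of_maps_to (s := M) (t := L) (f := f)
    (by omega) (fun s hs => hf1 s hs)
  have := hM.2 a ha b hb hab
  rw [Finset.disjoint_left] at this
  exact this (hf2 a ha) (hfab ▸ hf2 b hb)

lemma mem_join (hr : 0 < r) (t : ℕ) (G : HGraph r) (e : Finset ℕ) :
    e ∈ ((completeOn r (Finset.range t)).join G).edges ↔
      e ⊆ Finset.range t ∪ G.verts ∧ e.card = r ∧ (¬ Disjoint (Finset.range t) e ∨ e ∈ G.edges) := by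
  unfold HGraph.join completeOn HGraph.ofEdges
  simp only [Finset.mem_filter, Finset.mem_union, Finset.mem_powersetCard]
  constructor
  · rintro ⟨h, h1, h2⟩
    refine ⟨h1, h2, ?_⟩
    rcases h with (h | h) | h
    · left
      intro hd
      have := hd.mono_left h.2.1
      rw [disjoint_self] at this
      rw [this] at h2; simp at h2; omega
    · right; exact h
    · left
      obtain ⟨x, hx⟩ := h.2.1
      rw [Finset.mem_inter] at hx
      exact Finset.not_disjoint_iff.2 ⟨x, hx.2, hx.1⟩
  · rintro ⟨h1, h2, h⟩
    refine ⟨?_, h1, h2⟩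
    rcases h with h | h
    · by_cases hg : (e ∩ G.verts).Nonempty
      · right
        refine ⟨⟨h1, h2⟩, ?_, hg⟩
        obtain ⟨x, hx, hx'⟩ := Finset.not_disjoint_iff.1 h
        exact ⟨x, Finset.mem_inter.2 ⟨hx', hx⟩⟩
      · left; left
        have : e ⊆ Finset.range t := by
          intro x hx
          rcases Finset.mem_union.1 (h1 hx) with h' | h'
          · exact h'
          · exact absurd ⟨x, Finset.mem_inter.2 ⟨hx, h'⟩⟩ hg
        exact ⟨⟨this, h2⟩, this, h2⟩
    · left; right; exact h

lemma join_verts (t : ℕ) (G : HGraph r) :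
    ((completeOn r (Finset.range t)).join G).verts = Finset.range t ∪ G.verts := rfl

/-- pulling back a blowup along an injection -/
lemma BF_pull {ι : Type*} [DecidableEq ι] (φ : ℕ → ι) (W : Finset (Finset ι)) (f : ℕ → ℕ) {e : Finset ℕ}
    (hf : Set.InjOn f (e : Set ℕ)) : (Set.InjOn φ ((e.image f : Finset ℕ) : Set ℕ) ∧ (e.image f).image φ ∈ W) ↔
      Set.InjOn (φ ∘ f) (e : Set ℕ) ∧ e.image (φ ∘ f) ∈ W := by
  rw [Finset.image_image, Finset.coe_image]
  apply and_congr_left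
  intro _
  constructor
  · intro h
    exact h.comp hf (Set.mapsTo_image f _)
  · intro h
    rintro _ ⟨x, hx, rfl⟩ _ ⟨y, hy, rfl⟩ hxy
    rw [h hx hy hxy]

lemma max_iff {W G : HGraph r} (hne : W.verts.Nonempty) {m : ℕ} (hm : G.verts.card = m) {φ : ℕ → W.verts}
    (hφ : G.edges = BF φ G.verts (Wp W)) (hce : ∀ e ∈ Wp W, e.card = r) :
    (∀ G' : HGraph r, G'.verts.card = m → IsBlowupOf W G' → G'.edges.card ≤ G.edges.card) ↔
      G.edges.card = wB (Wp W) m := by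
  constructor
  · intro h
    apply le_antisymm
    · rw [hφ, ← hm]; exact card_BF_le _ _ _
    · haveI : Nonempty W.verts := hne.to_subtype
      obtain ⟨ψ, hψ⟩ := ex_BF G.verts (Wp W)
      rw [← hm, ← hψ]
      refine h ⟨G.verts, BF ψ G.verts (Wp W), ?_, ?_⟩ hm ((blowup_iff _ _ hne).2 ⟨ψ, rfl⟩)
      · intro e he; rw [mem_BF] at he; exact he.1
      · intro e he
        rw [mem_BF] at he
        rw [← Finset.card_image_of_injOn he.2.1]
        exact hce _ he.2.2
  · intro h G' h1 h2
    obtain ⟨ψ, hψ⟩ := (blowup_iff _ _ hne).1 h2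
    rw [h, hψ, ← h1]
    exact card_BF_le _ _ _

lemma rhs_Str (hr : r = 5 ∨ r = 6) {W H : HGraph r} (hW : St r (Wp W)) (hne : W.verts.Nonempty) {n t : ℕ} (htn : t ≤ n)
    {G : HGraph r} (hG : G.verts.card = n - t) (hd : Disjoint G.verts (Finset.range t)) (hB : IsBlowupOf W G)
    (hmax : ∀ G' : HGraph r, G'.verts.card = n - t → IsBlowupOf W G' → G'.edges.card ≤ G.edges.card)
    (hI : H.Iso ((completeOn r (Finset.range t)).join G)) : H.verts.card = n ∧ Str W H t := by
  obtain ⟨φ, hφ⟩ := (blowup_iff _ _ hne).1 hB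
  rw [max_iff hne hG hφ hW.ce] at hmax
  obtain ⟨f, hf, hfe⟩ := hI
  rw [join_verts] at hf
  have him : H.verts.image f = Finset.range t ∪ G.verts := by
    apply Finset.coe_injective
    rw [Finset.coe_image]; exact hf.image_eq
  have hn : H.verts.card = n := by
    rw [← Finset.card_image_of_injOn hf.injOn, him, Finset.card_union_of_disjoint hd.symm, hG, Finset.card_range]
    omega
  refine ⟨hn, ?_⟩
  set L := H.verts.filter (fun v => f v ∈ Finset.range t) with hL
  have hLH : L ⊆ H.verts := Finset.filter_subset _ _
  have hLi : L.image f = Finset.range t := by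
    ext y
    rw [Finset.mem_image]
    constructor
    · rintro ⟨x, hx, rfl⟩
      exact (Finset.mem_filter.1 hx).2
    · intro hy
      have : y ∈ H.verts.image f := by rw [him]; exact Finset.mem_union_left _ hy
      obtain ⟨x, hx, rfl⟩ := Finset.mem_image.1 this
      exact ⟨x, Finset.mem_filter.2 ⟨hx, hy⟩, rfl⟩
  have hLc : L.card = t := by
    rw [← Finset.card_image_of_injOn (hf.injOn.mono (by exact_mod_cast hLH)), hLi, Finset.card_range]
  have hsub : ∀ e ⊆ H.verts, e.image f ⊆ Finset.range t ∪ G.verts := fun e he => by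
    rw [← him]; exact Finset.image_subset_image he
  have hce : ∀ e ⊆ H.verts, (e.image f).card = e.card := fun e he =>
    Finset.card_image_of_injOn (hf.injOn.mono (by exact_mod_cast he))
  have hdj : ∀ e ⊆ H.verts, (Disjoint (Finset.range t) (e.image f) ↔ Disjoint L e) := by
    intro e he
    rw [← not_iff_not, Finset.not_disjoint_iff, Finset.not_disjoint_iff]
    constructor
    · rintro ⟨y, h1, h2⟩
      obtain ⟨x, hx, rfl⟩ := Finset.mem_image.1 h2
      exact ⟨x, Finset.mem_filter.2 ⟨he hx, h1⟩, hx⟩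
    · rintro ⟨x, h1, h2⟩
      exact ⟨f x, (Finset.mem_filter.1 h1).2, Finset.mem_image_of_mem _ h2⟩
  have hEq : H.edges.filter (Disjoint L ·) = BF (φ ∘ f) (H.verts \ L) (Wp W) := by
    ext e
    rw [Finset.mem_filter, mem_BF, Finset.subset_sdiff]
    constructor
    · rintro ⟨h1, h2⟩
      have heH := H.edges_sub e h1
      have h3 := (hfe e (Finset.mem_powersetCard.2 ⟨heH, H.edges_card e h1⟩)).1 h1
      rw [mem_join (by omega)] at h3
      obtain ⟨-, -, h3⟩ := h3
      rw [hdj e heH] at h3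
      have h4 := h3.resolve_left (not_not.2 h2)
      rw [hφ, mem_BF] at h4
      exact ⟨⟨heH, h2.symm⟩, (BF_pull φ _ f (hf.injOn.mono (by exact_mod_cast heH))).1 h4.2⟩
    · rintro ⟨⟨heH, h2⟩, h3⟩
      have hec : e.card = r := by
        rw [← Finset.card_image_of_injOn h3.1]; exact hW.ce _ h3.2
      refine ⟨?_, h2.symm⟩
      rw [hfe e (Finset.mem_powersetCard.2 ⟨heH, hec⟩), mem_join (by omega)]
      refine ⟨hsub e heH, by rw [hce e heH, hec], Or.inr ?_⟩
      rw [hφ, mem_BF]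
      refine ⟨?_, (BF_pull φ _ f (hf.injOn.mono (by exact_mod_cast heH))).2 h3⟩
      intro y hy
      rcases Finset.mem_union.1 (hsub e heH hy) with h | h
      · exact absurd hy (Finset.disjoint_left.1 ((hdj e heH).2 h2.symm) h)
      · exact h
  refine ⟨L, hLH, hLc, ?_, φ ∘ f, hEq, ?_⟩
  · intro e he hdis
    have heH := (Finset.mem_powersetCard.1 he)
    rw [hfe e he, mem_join (by omega)]
    exact ⟨hsub e heH.1, by rw [hce e heH.1, heH.2], Or.inl (by rw [hdj e heH.1]; exact hdis)⟩
  · rw [hn, ← hmax, hφ, card_BF, card_BF]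
    congr 1
    funext i
    apply Finset.card_bij (fun v _ => f v)
    · intro v hv
      rw [Finset.mem_filter, Finset.mem_sdiff] at hv
      rw [Finset.mem_filter]
      refine ⟨?_, hv.2⟩
      have : f v ∈ Finset.range t ∪ G.verts := by rw [← him]; exact Finset.mem_image_of_mem _ hv.1.1
      rcases Finset.mem_union.1 this with h | h
      · exact absurd (Finset.mem_filter.2 ⟨hv.1.1, h⟩) hv.1.2
      · exact h
    · intro v hv w hw hvw
      rw [Finset.mem_filter, Finset.mem_sdiff] at hv hw
      exact hf.injOn hv.1.1 hw.1.1 hvw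
    · intro y hy
      rw [Finset.mem_filter] at hy
      have : y ∈ H.verts.image f := by rw [him]; exact Finset.mem_union_right _ hy.1
      obtain ⟨x, hx, rfl⟩ := Finset.mem_image.1 this
      refine ⟨x, ?_, rfl⟩
      rw [Finset.mem_filter, Finset.mem_sdiff]
      exact ⟨⟨hx, fun h => Finset.disjoint_left.1 hd hy.1 (Finset.mem_filter.1 h).2⟩, hy.2⟩

lemma Str_rhs (hr : r = 5 ∨ r = 6) {W H : HGraph r} (hW : St r (Wp W)) (hne : W.verts.Nonempty) {n t : ℕ}
    (hn : H.verts.card = n) (h : Str W H t) : ∃ G : HGraph r, G.verts.card = n - t ∧ Disjoint G.verts (Finset.range t) ∧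
          IsBlowupOf W G ∧
          (∀ G' : HGraph r, G'.verts.card = n - t → IsBlowupOf W G' →
            G'.edges.card ≤ G.edges.card) ∧
          H.Iso ((completeOn r (Finset.range t)).join G) := by
  obtain ⟨L, hL, hLc, h1, φ, h2, h3⟩ := h
  obtain ⟨g, hg⟩ := ex_bij (A := L) (B := Finset.range t) (by rw [Finset.card_range, hLc])
  let V : Finset ℕ := (H.verts \ L).image (· + t)
  have hVc : V.card = n - t := by
    rw [Finset.card_image_of_injective _ (add_left_injective t), Finset.card_sdiff_of_subset hL, hn, hLc]
  let G : HGraph r := ⟨V, BF (fun v => φ (v - t)) V (Wp W), fun e he => (mem_BF.1 he).1, fun e he => by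
    rw [mem_BF] at he
    rw [← Finset.card_image_of_injOn he.2.1]
    exact hW.ce _ he.2.2⟩
  have hGB : G.edges = BF (fun v => φ (v - t)) G.verts (Wp W) := rfl
  have hcard : G.edges.card = wB (Wp W) (n - t) := by
    rw [← hn, ← h3, hGB, card_BF, card_BF]
    congr 1
    funext i
    symm
    apply Finset.card_bij (fun v _ => v + t)
    · intro v hv
      rw [Finset.mem_filter] at hv
      rw [Finset.mem_filter]
      exact ⟨Finset.mem_image_of_mem _ hv.1, by simpa using hv.2⟩
    · intro v hv w hw hvw; omega
    · intro y hy
      rw [Finset.mem_filter] at hy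
      obtain ⟨x, hx, rfl⟩ := Finset.mem_image.1 hy.1
      exact ⟨x, Finset.mem_filter.2 ⟨hx, by simpa using hy.2⟩, rfl⟩
  have hVd : Disjoint V (Finset.range t) := by
    rw [Finset.disjoint_left]
    intro y hy hy'
    obtain ⟨x, hx, rfl⟩ := Finset.mem_image.1 hy
    rw [Finset.mem_range] at hy'
    omega
  refine ⟨G, hVc, hVd, (blowup_iff _ _ hne).2 ⟨_, hGB⟩, (max_iff hne hVc hGB hW.ce).2 hcard, ?_⟩
  let f : ℕ → ℕ := fun v => if v ∈ L then g v else v + t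
  have fL : ∀ v ∈ L, f v = g v := fun v hv => if_pos hv
  have fN : ∀ v, v ∉ L → f v = v + t := fun v hv => if_neg hv
  have him : H.verts.image f = Finset.range t ∪ V := by
    have e1 : H.verts = L ∪ (H.verts \ L) := (Finset.union_sdiff_of_subset hL).symm
    rw [e1, Finset.image_union, ← hg]
    congr 1
    · exact Finset.image_congr fun v hv => fL v hv
    · have : (H.verts \ L).image f = V := Finset.image_congr fun v hv => fN v (Finset.mem_sdiff.1 hv).2
      exact this
  have htn : t ≤ n := by rw [← hLc, ← hn]; exact Finset.card_le_card hL
  have hinj : Set.InjOn f (H.verts : Set ℕ) := by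
    rw [← Finset.card_image_iff, him, Finset.card_union_of_disjoint hVd.symm, hVc, Finset.card_range, hn]
    omega
  have fR : ∀ v ∈ L, f v ∈ Finset.range t := fun v hv => by
    rw [fL v hv, ← hg]; exact Finset.mem_image_of_mem _ hv
  have fR' : ∀ v, f v ∈ Finset.range t → v ∈ L := fun v hv => by
    by_contra hc
    rw [fN v hc, Finset.mem_range] at hv
    omega
  refine ⟨f, ⟨?_, hinj, ?_⟩, ?_⟩
  · intro v hv
    rw [join_verts, ← show H.verts.image f = Finset.range t ∪ G.verts from him]
    exact Finset.mem_image_of_mem _ hv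
  · intro y hy
    rw [join_verts, ← show H.verts.image f = Finset.range t ∪ G.verts from him, Finset.coe_image] at hy
    exact hy
  · intro e he
    have heH := Finset.mem_powersetCard.1 he
    have hie : Set.InjOn f (e : Set ℕ) := hinj.mono (by exact_mod_cast heH.1)
    rw [mem_join (by omega)]
    have hs : e.image f ⊆ Finset.range t ∪ G.verts := by
      rw [← show H.verts.image f = Finset.range t ∪ G.verts from him]; exact Finset.image_subset_image heH.1
    have hc : (e.image f).card = r := by rw [Finset.card_image_of_injOn hie, heH.2]
    by_cases hd : Disjoint L e
    · have hd' : Disjoint (Finset.range t) (e.image f) := by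
        rw [Finset.disjoint_right]
        intro y hy hy'
        obtain ⟨x, hx, rfl⟩ := Finset.mem_image.1 hy
        exact Finset.disjoint_left.1 hd (fR' x hy') hx
      have hkey : e ∈ H.edges ↔ e ∈ BF φ (H.verts \ L) (Wp W) := by
        rw [← h2, Finset.mem_filter]; exact ⟨fun h => ⟨h, hd⟩, fun h => h.1⟩
      have hco : ∀ v ∈ e, ((fun v => φ (v - t)) ∘ f) v = φ v := by
        intro v hv
        simp only [Function.comp]
        rw [fN v (fun h => Finset.disjoint_left.1 hd h hv)]
        simp
      have hpull := BF_pull (fun v => φ (v - t)) (Wp W) f hie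
      have himg : e.image ((fun v => φ (v - t)) ∘ f) = e.image φ := Finset.image_congr fun v hv => hco v hv
      have hio : Set.InjOn ((fun v => φ (v - t)) ∘ f) (e : Set ℕ) ↔ Set.InjOn φ (e : Set ℕ) :=
        Set.EqOn.injOn_iff (fun v hv => hco v hv)
      rw [himg, hio] at hpull
      rw [hkey, mem_BF, ← hpull, hGB, mem_BF]
      constructor
      · rintro ⟨h4, h5⟩
        refine ⟨hs, hc, Or.inr ⟨?_, h5⟩⟩
        intro y hy
        rcases Finset.mem_union.1 (hs hy) with h | h
        · exact absurd hy (Finset.disjoint_left.1 hd' h)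
        · exact h
      · rintro ⟨-, -, h4⟩
        have h5 := h4.resolve_left (not_not.2 hd')
        exact ⟨Finset.subset_sdiff.2 ⟨heH.1, hd.symm⟩, h5.2⟩
    · have hd' : ¬ Disjoint (Finset.range t) (e.image f) := by
        obtain ⟨x, h4, h5⟩ := Finset.not_disjoint_iff.1 hd
        exact Finset.not_disjoint_iff.2 ⟨f x, fR x h4, Finset.mem_image_of_mem _ h5⟩
      exact ⟨fun _ => ⟨hs, hc, Or.inl hd'⟩, fun _ => h1 e he hd⟩

lemma Str_exists {W : HGraph r} (hW : St r (Wp W)) (hne : W.verts.Nonempty) {n t : ℕ} (htn : t ≤ n) :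
    ∃ H : HGraph r, H.verts.card = n ∧ Str W H t := by
  haveI : Nonempty W.verts := hne.to_subtype
  obtain ⟨φ, hφ⟩ := ex_BF (Finset.range n \ Finset.range t) (Wp W)
  have hsub : Finset.range t ⊆ Finset.range n := Finset.range_subset_range.2 htn
  let H : HGraph r := ⟨Finset.range n, (Finset.powersetCard r (Finset.range n)).filter
    (fun e => ¬ Disjoint (Finset.range t) e ∨ e ∈ BF φ (Finset.range n \ Finset.range t) (Wp W)),
    fun e he => (Finset.mem_powersetCard.1 (Finset.mem_filter.1 he).1).1,
    fun e he => (Finset.mem_powersetCard.1 (Finset.mem_filter.1 he).1).2⟩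
  refine ⟨H, Finset.card_range n, Finset.range t, hsub, Finset.card_range t, ?_, φ, ?_, ?_⟩
  · intro e he hd
    exact Finset.mem_filter.2 ⟨he, Or.inl hd⟩
  · ext e
    rw [Finset.mem_filter]
    constructor
    · rintro ⟨h1, h2⟩
      exact (Finset.mem_filter.1 h1).2.resolve_left (not_not.2 h2)
    · intro h
      have h' := mem_BF.1 h
      have h2 := Finset.subset_sdiff.1 h'.1
      refine ⟨Finset.mem_filter.2 ⟨Finset.mem_powersetCard.2 ⟨h2.1, ?_⟩, Or.inr h⟩, h2.2.symm⟩
      rw [← Finset.card_image_of_injOn h'.2.1]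
      exact hW.ce _ h'.2.2
  · rw [show H.verts = Finset.range n from rfl, hφ, Finset.card_sdiff_of_subset hsub]
    simp

lemma ex_value (hr : r = 5 ∨ r = 6) {W : HGraph r} (hW : St r (Wp W)) (hne : W.verts.Nonempty) {n t : ℕ}
    (htn : t ≤ n) (hb : Big n t) :
    exMatchN r n t (genTri r) + (n - t).choose r = n.choose r + wB (Wp W) (n - t) := by
  obtain ⟨H, hn, hH⟩ := Str_exists hW hne htn
  have hc := hH.card
  rw [hn] at hc
  have : IsGreatest {m | ∃ H : HGraph r, H.verts.card = n ∧ ¬ (genTri r).HasMatching H (t+1) ∧ H.edges.card = m}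
      H.edges.card := by
    refine ⟨⟨H, hn, hH.noM hr hW, rfl⟩, ?_⟩
    rintro m ⟨H', h1, h2, rfl⟩
    have := (main_abs hr hW (T := H'.verts) (t := t) (by rw [h1]; exact hb) (E := H'.edges)
      (fun e he => ⟨H'.edges_sub e he, H'.edges_card e he⟩) (fun M h3 h4 h5 => h2 (by
        rw [matching_iff hr]; exact ⟨M, h3, h4, h5⟩))).1
    rw [h1] at this
    omega
  unfold exMatchN
  rw [this.csSup_eq]
  exact hc

lemma final (hr : r = 5 ∨ r = 6)
    (W : HGraph r) (hWcard : W.verts.card = r + 6)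
    (hSteiner : ∀ S ∈ Finset.powersetCard (r-1) W.verts,
      ∃! e : Finset ℕ, e ∈ W.edges ∧ S ⊆ e) :
    ∃ N₀ : ℕ, ∃ c : ℝ, 0 < c ∧ ∀ n : ℕ, N₀ ≤ n → ∀ t : ℕ, (t : ℝ) ≤ c * n →
      ∀ H : HGraph r, IsExtremalMatchingFree r n t (genTri r) H ↔
        ∃ G : HGraph r, G.verts.card = n - t ∧ Disjoint G.verts (Finset.range t) ∧
          IsBlowupOf W G ∧
          (∀ G' : HGraph r, G'.verts.card = n - t → IsBlowupOf W G' →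
            G'.edges.card ≤ G.edges.card) ∧
          H.Iso ((completeOn r (Finset.range t)).join G) := by
  have he := e0_pos
  have he1 : e0 ≤ 1/1000 := e0_le1.trans (by norm_num)
  have hW := St_Wp W hWcard hSteiner
  have hne : W.verts.Nonempty := by rw [← Finset.card_pos]; omega
  refine ⟨⌈(1000/e0 + n2)/e0⌉₊, e0/100, by positivity, fun n hn t ht H => ?_⟩
  have hb : Big n t := by
    refine ⟨?_, ht⟩
    have h1 : (1000/e0 + n2)/e0 ≤ n := (Nat.le_ceil _).trans (by exact_mod_cast hn)
    rw [div_le_iff₀ he] at h1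
    linarith
  have htn : t ≤ n := by
    have h0 : (0:ℝ) ≤ n := Nat.cast_nonneg _
    have : (t:ℝ) ≤ n := by nlinarith
    exact_mod_cast this
  have hv := ex_value hr hW hne htn hb
  constructor
  · rintro ⟨h1, h2, h3⟩
    apply Str_rhs hr hW hne h1
    have hm := (main_abs hr hW (T := H.verts) (t := t) (by rw [h1]; exact hb) (E := H.edges)
      (fun e he => ⟨H.edges_sub e he, H.edges_card e he⟩) (fun M h3 h4 h5 => h2 (by
        rw [matching_iff hr]; exact ⟨M, h3, h4, h5⟩))).2 (by rw [h1, h3]; exact hv)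
    obtain ⟨L, hL, hLc, h4, φ, h5⟩ := hm
    refine ⟨L, hL, hLc, h4, φ, h5, ?_⟩
    have hmeet := card_meet _ _ hL r
    have hsplit := Finset.card_filter_add_card_filter_not (s := H.edges) (Disjoint L ·)
    have hle : (H.edges.filter (¬ Disjoint L ·)).card ≤ ((H.verts.powersetCard r).filter (¬ Disjoint L ·)).card :=
      Finset.card_le_card (Finset.filter_subset_filter _ fun e he =>
        Finset.mem_powersetCard.2 ⟨H.edges_sub e he, H.edges_card e he⟩)
    have hle2 := card_BF_le φ (H.verts \ L) (Wp W)
    rw [Finset.card_sdiff_of_subset hL, hLc] at hle2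
    rw [h5] at hsplit
    rw [hLc] at hmeet
    rw [h1] at *
    omega
  · rintro ⟨G, h1, h2, h3, h4, h5⟩
    obtain ⟨h6, h7⟩ := rhs_Str hr hW hne htn h1 h2 h3 h4 h5
    refine ⟨h6, h7.noM hr hW, ?_⟩
    have := h7.card
    rw [h6] at this
    omega

end Final
end DensityCH
end

namespace DensityCH

/-- the density Corrádi–Hajnal theorem for the 5- and 6-uniform
generalized triangles.  Here `W` is the Steiner system `𝕎_r` (with `11 = r + 6`
vertices for `r = 5` and `12 = r + 6` vertices for `r = 6`), and `𝕎_r(n−t)` is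
characterized as a maximum-size blowup of `W` on `n − t` vertices. -/
theorem statement_9 (r : ℕ) (hr : r = 5 ∨ r = 6)
    (W : HGraph r) (hWcard : W.verts.card = r + 6)
    (hSteiner : ∀ S ∈ Finset.powersetCard (r-1) W.verts,
      ∃! e : Finset ℕ, e ∈ W.edges ∧ S ⊆ e) :
    ∃ N₀ : ℕ, ∃ c : ℝ, 0 < c ∧ ∀ n : ℕ, N₀ ≤ n → ∀ t : ℕ, (t : ℝ) ≤ c * n →
      ∀ H : HGraph r, IsExtremalMatchingFree r n t (genTri r) H ↔
        ∃ G : HGraph r, G.verts.card = n - t ∧ Disjoint G.verts (Finset.range t) ∧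
          IsBlowupOf W G ∧
          (∀ G' : HGraph r, G'.verts.card = n - t → IsBlowupOf W G' →
            G'.edges.card ≤ G.edges.card) ∧
          H.Iso ((completeOn r (Finset.range t)).join G) := by
  exact final hr W hWcard hSteiner

end DensityCH
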